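/- arXiv:0812.2017 — 3 statements merged into one kernel-verified Lean document; each statement's English description precedes it below -/
import Mathlib

section
/- Let G be a countable amenable group, let (X, 𝒳, μ) be a probability space, and let T⁽¹⁾, …, T⁽ᵈ⁾ be pairwise commuting measure-preserving actions of G on X. Fix a two-sided Følner sequence Φ in G. For a sequence P = (i₁, …, i_k) of distinct indices in {1, …, d} and bounded measurable functions f_ε, ε ∈ {0,1}ᵏ, the iterated limit I_P(f) = lim_{N₁→∞} ⋯ lim_{N_k→∞} (1/(|Φ_{N₁}| ⋯ |Φ_{N_k}|)) Σ_{g₁ ∈ Φ_{N₁}} ⋯ Σ_{g_k ∈ Φ_{N_k}} ∫ ∏_{ε ∈ {0,1}ᵏ} f_ε ∘ ∏_{j=1}^k (T^{(i_j)}_{g_j})^{ε_j} dμ exists. Moreover, I_P depends only on the set {i₁, …, i_k} and not on the order: for every permutation σ of {1, …, k}, letting σ act on {0,1}ᵏ by permuting coordinates, one has I_{(i_{σ(1)}, …, i_{σ(k)})}((f_{σ(ε)})_{ε ∈ {0,1}ᵏ}) = I_{(i₁, …, i_k)}((f_ε)_{ε ∈ {0,1}ᵏ}). -/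
open MeasureTheory Filter Topology

/-- A left Følner sequence: finite nonempty sets with `|Φ N ∩ gΦ N|/|Φ N| → 1` for all `g`. -/
def IsLeftFolner {G : Type*} [Group G] [DecidableEq G] (Φ : ℕ → Finset G) : Prop :=
  (∀ N, (Φ N).Nonempty) ∧
    ∀ g : G, Tendsto
      (fun N => (((Φ N) ∩ (Φ N).image (fun x => g * x)).card : ℝ) / ((Φ N).card : ℝ))
      atTop (𝓝 1)

/-- A right Følner sequence: finite nonempty sets with `|Φ N ∩ Φ N g|/|Φ N| → 1` for all `g`. -/
def IsRightFolner {G : Type*} [Group G] [DecidableEq G] (Φ : ℕ → Finset G) : Prop :=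
  (∀ N, (Φ N).Nonempty) ∧
    ∀ g : G, Tendsto
      (fun N => (((Φ N) ∩ (Φ N).image (fun x => x * g)).card : ℝ) / ((Φ N).card : ℝ))
      atTop (𝓝 1)

/-- A two-sided Følner sequence is both a left and a right Følner sequence. -/
def IsTwoSidedFolner {G : Type*} [Group G] [DecidableEq G] (Φ : ℕ → Finset G) : Prop :=
  IsLeftFolner Φ ∧ IsRightFolner Φ
/-- `cubeMapP T P g ε = ∏_{j=1}^k (T^{(P j)}_{g j})^(ε j)` : the composition, over all `j`
with `ε j = true`, of the maps `T (P j) (g j)` (the actions commute, so the order is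
immaterial). -/
def cubeMapP {G X : Type*} {d k : ℕ} (T : Fin d → G → X → X) (P : Fin k → Fin d)
    (g : Fin k → G) (ε : Fin k → Bool) : X → X :=
  fun x => (List.ofFn (fun j : Fin k => if ε j then T (P j) (g j) else id)).foldr (· ∘ ·) id x

/-- `IterLimExists A l` says that the iterated limit
`lim_{N₁→∞} ⋯ lim_{N_k→∞} A (N₁, …, N_k)` exists (innermost limit in the last variable)
and equals `l`. -/
def IterLimExists : ∀ {k : ℕ}, ((Fin k → ℕ) → ℝ) → ℝ → Prop
  | 0, A, l => A (fun i => i.elim0) = l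
  | _ + 1, A, l => ∃ B,
      (∀ M, Filter.Tendsto (fun n => A (Fin.snoc M n)) Filter.atTop (nhds (B M))) ∧
      IterLimExists B l

/-- The multiparameter averages
`(1/(|Φ_{N₁}| ⋯ |Φ_{N_k}|)) Σ_{g₁ ∈ Φ_{N₁}} ⋯ Σ_{g_k ∈ Φ_{N_k}}
  ∫ ∏_{ε ∈ {0,1}ᵏ} f_ε ∘ ∏_j (T^{(P j)}_{g_j})^{ε_j} dμ`. -/
noncomputable def cubeIntAvg {G X : Type*} [Group G] [MeasurableSpace X]
    (μ : MeasureTheory.Measure X) {d k : ℕ} (T : Fin d → G → X → X) (P : Fin k → Fin d)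
    (Φ : ℕ → Finset G) (f : (Fin k → Bool) → X → ℝ) (N : Fin k → ℕ) : ℝ :=
  (∏ j, ((Φ (N j)).card : ℝ))⁻¹ *
    ∑ g ∈ Fintype.piFinset (fun j => Φ (N j)),
      ∫ x, ∏ ε : Fin k → Bool, f ε (cubeMapP T P g ε x) ∂μ

set_option linter.unusedSectionVars false

/-! ### Almost invariant probability measures -/

section AlmostInvariant

variable {G : Type*} [Group G] [MeasurableSpace G] [Countable G] [MeasurableSingletonClass G]

lemma integrable_of_abs_le {Ω : Type*} [MeasurableSpace Ω] {ρ : Measure Ω} [IsFiniteMeasure ρ]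
    {φ : Ω → ℝ} (hφ : Measurable φ) {C : ℝ} (hC : ∀ o, |φ o| ≤ C) : Integrable φ ρ :=
  Integrable.of_bound hφ.aestronglyMeasurable C (ae_of_all _ hC)

lemma abs_integral_le {Ω : Type*} [MeasurableSpace Ω] {ρ : Measure Ω} [IsProbabilityMeasure ρ]
    {φ : Ω → ℝ} {C : ℝ} (hC : ∀ o, |φ o| ≤ C) : |∫ o, φ o ∂ρ| ≤ C := by
  simpa using norm_integral_le_of_norm_le_const (μ := ρ) (f := φ) (C := C) (ae_of_all _ hC)

/-- `ν` is `δ`-almost invariant, on either side, under averages of translates along `lam`. -/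
def IsAlmostInvariant (lam ν : ProbabilityMeasure G) (δ : ℝ) : Prop :=
  ∀ φ : G → ℝ, (∀ g, |φ g| ≤ 1) →
    |(∫ x, ∫ g, φ (g * x) ∂(lam : Measure G) ∂(ν : Measure G)) - ∫ x, φ x ∂(ν : Measure G)| ≤ δ ∧
    |(∫ x, ∫ g, φ (x * g⁻¹) ∂(lam : Measure G) ∂(ν : Measure G)) - ∫ x, φ x ∂(ν : Measure G)| ≤ δ

/-- The filter of probability measures approximating a two-sided invariant mean. -/
def almostInvariantFilter (G : Type*) [Group G] [MeasurableSpace G] :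
    Filter (ProbabilityMeasure G) :=
  ⨅ p : ProbabilityMeasure G × {δ : ℝ // 0 < δ}, 𝓟 {ν | IsAlmostInvariant p.1 ν p.2}

lemma eventually_isAlmostInvariant (lam : ProbabilityMeasure G) {δ : ℝ} (hδ : 0 < δ) :
    ∀ᶠ ν in almostInvariantFilter G, IsAlmostInvariant lam ν δ :=
  mem_iInf_of_mem (lam, ⟨δ, hδ⟩) (mem_principal_self _)

lemma tendsto_almostInvariantFilter {α : Type*} {l : Filter α} {u : α → ProbabilityMeasure G}
    (h : ∀ lam : ProbabilityMeasure G, ∀ δ > 0, ∀ᶠ a in l, IsAlmostInvariant lam (u a) δ) :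
    Tendsto u l (almostInvariantFilter G) :=
  tendsto_iInf.2 fun p => tendsto_principal.2 (h p.1 p.2 p.2.2)

/-- The midpoint of two probability measures. -/
noncomputable def probMidpoint {α : Type*} [MeasurableSpace α] (a b : ProbabilityMeasure α) :
    ProbabilityMeasure α :=
  ⟨(2⁻¹ : ENNReal) • (a : Measure α) + (2⁻¹ : ENNReal) • (b : Measure α),
    ⟨by simp [ENNReal.inv_two_add_inv_two]⟩⟩

lemma integral_probMidpoint {α : Type*} [MeasurableSpace α] (a b : ProbabilityMeasure α)
    {φ : α → ℝ} (hφ : Measurable φ) {C : ℝ} (hC : ∀ x, |φ x| ≤ C) :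
    ∫ x, φ x ∂(probMidpoint a b : Measure α) =
      (∫ x, φ x ∂(a : Measure α) + ∫ x, φ x ∂(b : Measure α)) / 2 := by
  change ∫ x, φ x ∂((2⁻¹ : ENNReal) • (a : Measure α) + (2⁻¹ : ENNReal) • (b : Measure α)) = _
  rw [integral_add_measure ((integrable_of_abs_le hφ hC).smul_measure (by simp))
    ((integrable_of_abs_le hφ hC).smul_measure (by simp)), integral_smul_measure,
    integral_smul_measure]
  simp
  ring

lemma IsAlmostInvariant.probMidpoint {lam a b : ProbabilityMeasure G} {δ : ℝ}
    (ha : IsAlmostInvariant lam a δ) (hb : IsAlmostInvariant lam b δ) :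
    IsAlmostInvariant lam (probMidpoint a b) δ := by
  intro φ hφ
  rw [integral_probMidpoint a b Measurable.of_discrete hφ,
    integral_probMidpoint a b Measurable.of_discrete fun x => abs_integral_le fun g => hφ _,
    integral_probMidpoint a b Measurable.of_discrete fun x => abs_integral_le fun g => hφ _]
  obtain ⟨h1, h2⟩ := ha φ hφ
  obtain ⟨h3, h4⟩ := hb φ hφ
  simp only [abs_le] at *
  constructor <;> constructor <;> linarith

lemma tendsto_probMidpoint {α : Type*} {l : Filter α} {u v : α → ProbabilityMeasure G}
    (hu : Tendsto u l (almostInvariantFilter G)) (hv : Tendsto v l (almostInvariantFilter G)) :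
    Tendsto (fun a => probMidpoint (u a) (v a)) l (almostInvariantFilter G) :=
  tendsto_almostInvariantFilter fun lam _ hδ =>
    ((hu.eventually (eventually_isAlmostInvariant lam hδ)).and
      (hv.eventually (eventually_isAlmostInvariant lam hδ))).mono fun _ h => h.1.probMidpoint h.2

/-- The uniform probability measure on a nonempty finite set. -/
noncomputable def uniformProb (s : Finset G) (hs : s.Nonempty) : ProbabilityMeasure G :=
  ⟨(PMF.uniformOfFinset s hs).toMeasure, inferInstance⟩

lemma uniformProb_real_singleton [DecidableEq G] (s : Finset G) (hs : s.Nonempty) (g : G) :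
    (uniformProb s hs : Measure G).real {g} = if g ∈ s then (s.card : ℝ)⁻¹ else 0 := by
  change (PMF.uniformOfFinset s hs).toMeasure.real {g} = _
  rw [Measure.real, PMF.toMeasure_apply_singleton _ _ (measurableSet_singleton g),
    PMF.uniformOfFinset_apply]
  split_ifs <;> simp

lemma integral_uniformProb (s : Finset G) (hs : s.Nonempty) (φ : G → ℝ) {C : ℝ}
    (hφ : ∀ g, |φ g| ≤ C) :
    ∫ g, φ g ∂(uniformProb s hs : Measure G) = (s.card : ℝ)⁻¹ * ∑ g ∈ s, φ g := by
  classical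
  rw [integral_countable (integrable_of_abs_le Measurable.of_discrete hφ),
    tsum_eq_sum (s := s), Finset.mul_sum]
  · refine Finset.sum_congr rfl fun g hg => ?_
    rw [uniformProb_real_singleton, if_pos hg, smul_eq_mul]
  · intro g hg
    rw [uniformProb_real_singleton, if_neg hg, zero_smul]

lemma integral_pi_uniformProb {ι : Type*} [Fintype ι] [DecidableEq ι] (s : ι → Finset G)
    (hs : ∀ j, (s j).Nonempty) (c : (ι → G) → ℝ) {C : ℝ} (hc : ∀ g, |c g| ≤ C) :
    ∫ g, c g ∂Measure.pi (fun j => (uniformProb (s j) (hs j) : Measure G)) =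
      (∏ j, ((s j).card : ℝ))⁻¹ * ∑ g ∈ Fintype.piFinset s, c g := by
  classical
  have key : ∀ g : ι → G, (Measure.pi fun j => (uniformProb (s j) (hs j) : Measure G)).real {g}
      = ∏ j, if g j ∈ s j then ((s j).card : ℝ)⁻¹ else 0 := by
    intro g
    rw [Measure.real, Measure.pi_singleton, ENNReal.toReal_prod]
    exact Finset.prod_congr rfl fun j _ => uniformProb_real_singleton _ _ _
  rw [integral_countable (integrable_of_abs_le Measurable.of_discrete hc),
    tsum_eq_sum (s := Fintype.piFinset s), Finset.mul_sum]
  · refine Finset.sum_congr rfl fun g hg => ?_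
    rw [Fintype.mem_piFinset] at hg
    rw [key, smul_eq_mul, ← Finset.prod_inv_distrib]
    congr 1
    exact Finset.prod_congr rfl fun j _ => if_pos (hg j)
  · intro g hg
    rw [Fintype.mem_piFinset] at hg
    push Not at hg
    obtain ⟨j, hj⟩ := hg
    rw [key, Finset.prod_eq_zero (Finset.mem_univ j) (if_neg hj), zero_smul]

lemma abs_sum_image_sub_sum_le [DecidableEq G] (s : Finset G) (m : G → G)
    (hm : Function.Injective m) (φ : G → ℝ) (hφ : ∀ g, |φ g| ≤ 1) :
    |∑ x ∈ s, φ (m x) - ∑ x ∈ s, φ x| ≤ 2 * ((s.card : ℝ) - ((s ∩ s.image m).card : ℝ)) := by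
  have h1 : ∑ x ∈ s, φ (m x) = ∑ x ∈ s.image m, φ x := (Finset.sum_image hm.injOn).symm
  have hb : ∀ t : Finset G, |∑ x ∈ t, φ x| ≤ t.card := fun t =>
    (Finset.abs_sum_le_sum_abs _ _).trans
      ((Finset.sum_le_sum fun x _ => hφ x).trans (by simp))
  have h2 := Finset.sum_inter_add_sum_sdiff s (s.image m) φ
  have h3 := Finset.sum_inter_add_sum_sdiff (s.image m) s φ
  have h4 : ((s ∩ s.image m).card : ℝ) + ((s \ s.image m).card : ℝ) = s.card := by
    exact_mod_cast Finset.card_inter_add_card_sdiff s (s.image m)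
  have h5 : ((s ∩ s.image m).card : ℝ) + ((s.image m \ s).card : ℝ) = s.card := by
    rw [Finset.inter_comm]
    have := Finset.card_inter_add_card_sdiff (s.image m) s
    rw [Finset.card_image_of_injective s hm] at this
    exact_mod_cast this
  rw [Finset.inter_comm] at h3
  have h6 := hb (s \ s.image m)
  have h7 := hb (s.image m \ s)
  rw [abs_le] at *
  constructor <;> linarith

lemma abs_integral_uniformProb_comp_sub_le [DecidableEq G] (s : Finset G) (hs : s.Nonempty)
    (m : G → G) (hm : Function.Injective m) (φ : G → ℝ) (hφ : ∀ g, |φ g| ≤ 1) :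
    |∫ x, φ (m x) ∂(uniformProb s hs : Measure G) - ∫ x, φ x ∂(uniformProb s hs : Measure G)| ≤
      2 * (1 - ((s ∩ s.image m).card : ℝ) / (s.card : ℝ)) := by
  have hc : (0 : ℝ) < s.card := by exact_mod_cast hs.card_pos
  rw [integral_uniformProb s hs _ (fun g => hφ (m g)), integral_uniformProb s hs _ hφ, ← mul_sub,
    abs_mul, abs_of_pos (inv_pos.2 hc), inv_mul_le_iff₀ hc]
  refine (abs_sum_image_sub_sum_le s m hm φ hφ).trans (le_of_eq ?_)
  field_simp

lemma tendsto_integral_folnerDefect (lam : ProbabilityMeasure G) (r : ℕ → G → ℝ)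
    (hr0 : ∀ n g, 0 ≤ r n g) (hr1 : ∀ n g, r n g ≤ 1)
    (hr : ∀ g, Tendsto (fun n => r n g) atTop (𝓝 1)) :
    Tendsto (fun n => ∫ g, 2 * (1 - r n g) ∂(lam : Measure G)) atTop (𝓝 0) := by
  have h := tendsto_integral_of_dominated_convergence (μ := (lam : Measure G))
    (F := fun n g => 2 * (1 - r n g)) (f := fun _ => 0) (fun _ => 2)
    (fun n => Measurable.of_discrete.aestronglyMeasurable) (integrable_const _)
    (fun n => ae_of_all _ fun g => by
      rw [Real.norm_eq_abs, abs_le]; constructor <;> linarith [hr0 n g, hr1 n g])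
    (ae_of_all _ fun g => by simpa using ((hr g).const_sub 1).const_mul 2)
  simpa using h

lemma abs_integral_integral_translate_sub_le (lam ν : ProbabilityMeasure G) (m : G → G → G)
    (φ : G → ℝ) (hφ : ∀ g, |φ g| ≤ 1) (e : G → ℝ) (he : ∀ g, |e g| ≤ 2)
    (h : ∀ g, |∫ x, φ (m g x) ∂(ν : Measure G) - ∫ x, φ x ∂(ν : Measure G)| ≤ e g) :
    |(∫ x, ∫ g, φ (m g x) ∂(lam : Measure G) ∂(ν : Measure G)) - ∫ x, φ x ∂(ν : Measure G)| ≤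
      ∫ g, e g ∂(lam : Measure G) := by
  rw [integral_integral_swap (integrable_of_abs_le Measurable.of_discrete
    (fun p : G × G => hφ (m p.2 p.1)))]
  have h1 : ∫ x, φ x ∂(ν : Measure G) =
      ∫ _g : G, (∫ x, φ x ∂(ν : Measure G)) ∂(lam : Measure G) := by simp
  rw [h1, ← integral_sub (integrable_of_abs_le Measurable.of_discrete
    fun g => abs_integral_le fun x => hφ _) (integrable_const _)]
  refine (abs_integral_le_integral_abs).trans (integral_mono_of_nonneg ?_ ?_ ?_)
  · exact ae_of_all _ fun g => abs_nonneg _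
  · exact integrable_of_abs_le Measurable.of_discrete he
  · exact ae_of_all _ h

lemma IsTwoSidedFolner.tendsto_uniformProb [DecidableEq G] {Φ : ℕ → Finset G}
    (hΦ : IsTwoSidedFolner Φ) :
    Tendsto (fun n => uniformProb (Φ n) (hΦ.1.1 n)) atTop (almostInvariantFilter G) := by
  refine tendsto_almostInvariantFilter fun lam δ hδ => ?_
  have hr0 : ∀ (m : G → G → G) n g,
      0 ≤ (((Φ n) ∩ (Φ n).image (m g)).card : ℝ) / ((Φ n).card : ℝ) := fun m n g => by positivity
  have hr1 : ∀ (m : G → G → G) n g,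
      (((Φ n) ∩ (Φ n).image (m g)).card : ℝ) / ((Φ n).card : ℝ) ≤ 1 := fun m n g =>
    div_le_one_of_le₀ (by exact_mod_cast Finset.card_le_card Finset.inter_subset_left)
      (by positivity)
  have hL := tendsto_integral_folnerDefect lam _ (hr0 fun g x => g * x) (hr1 _) hΦ.1.2
  have hR := tendsto_integral_folnerDefect lam _ (hr0 fun g x => x * g⁻¹) (hr1 _)
    fun g => hΦ.2.2 g⁻¹
  filter_upwards [hL.eventually (gt_mem_nhds hδ), hR.eventually (gt_mem_nhds hδ)] with n h1 h2
  have he : ∀ (m : G → G → G) g,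
      |2 * (1 - (((Φ n) ∩ (Φ n).image (m g)).card : ℝ) / ((Φ n).card : ℝ))| ≤ 2 := fun m g => by
    rw [abs_le]; constructor <;> linarith [hr0 m n g, hr1 m n g]
  intro φ hφ
  exact ⟨(abs_integral_integral_translate_sub_le lam _ (fun g x => g * x) φ hφ _ (he _) fun g =>
      abs_integral_uniformProb_comp_sub_le _ _ _ (mul_right_injective g) φ hφ).trans h1.le,
    (abs_integral_integral_translate_sub_le lam _ (fun g x => x * g⁻¹) φ hφ _ (he _) fun g =>
      abs_integral_uniformProb_comp_sub_le _ _ _ (mul_left_injective g⁻¹) φ hφ).trans h2.le⟩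

end AlmostInvariant

/-! ### Positive definite kernels on labelled group elements -/

section Kernel

variable {Ω : Type*} [MeasurableSpace Ω] {ρ : Measure Ω} [IsProbabilityMeasure ρ] {C : ℝ}

section Countable

variable {Z : Type*} [MeasurableSpace Z] [Countable Z] [MeasurableSingletonClass Z]
  {U : Z → Ω → ℝ}

lemma measurable_integral_kernel (hU : ∀ y, Measurable (U y)) (a : Measure Z) [SFinite a] :
    Measurable fun o => ∫ y, U y o ∂a :=
  (StronglyMeasurable.integral_prod_left (f := U) (μ := a)
    (measurable_from_prod_countable_right hU).stronglyMeasurable).measurable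

lemma abs_mul_le_sq {a b C : ℝ} (ha : |a| ≤ C) (hb : |b| ≤ C) : |a * b| ≤ C ^ 2 := by
  rw [abs_mul, sq]
  exact mul_le_mul ha hb (abs_nonneg _) ((abs_nonneg _).trans ha)

lemma integral_prod_kernel {U' : Z → Ω → ℝ} (hU : ∀ y, Measurable (U y))
    (hC : ∀ y o, |U y o| ≤ C) (hU' : ∀ y, Measurable (U' y)) (hC' : ∀ y o, |U' y o| ≤ C)
    (a b : Measure Z) [IsProbabilityMeasure a] [IsProbabilityMeasure b] :
    ∫ p : Z × Z, (∫ o, U p.1 o * U' p.2 o ∂ρ) ∂(a.prod b) =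
      ∫ o, (∫ y, U y o ∂a) * (∫ y, U' y o ∂b) ∂ρ := by
  rw [integral_integral_swap]
  · exact integral_congr_ae (ae_of_all _ fun o => integral_prod_mul (fun y => U y o) fun y => U' y o)
  · refine integrable_of_abs_le (C := C ^ 2) (measurable_from_prod_countable_right
      fun p : Z × Z => (hU p.1).mul (hU' p.2)) fun q => ?_
    exact abs_mul_le_sq (hC _ _) (hC' _ _)

end Countable

variable {G : Type*} [Group G] [MeasurableSpace G] [Countable G] [MeasurableSingletonClass G]
  {U : G × Bool → Ω → ℝ}

/-- The kernel `U` averaged against the product of `ν` and the law `θ` of the label. -/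
noncomputable def smear (U : G × Bool → Ω → ℝ) (ν : ProbabilityMeasure G)
    (θ : ProbabilityMeasure Bool) (o : Ω) : ℝ :=
  ∫ y, U y o ∂((ν : Measure G).prod (θ : Measure Bool))

lemma measurable_smear (hU : ∀ y, Measurable (U y)) (ν : ProbabilityMeasure G)
    (θ : ProbabilityMeasure Bool) : Measurable (smear U ν θ) :=
  measurable_integral_kernel hU _

lemma abs_smear_le (hC : ∀ y o, |U y o| ≤ C) (ν : ProbabilityMeasure G)
    (θ : ProbabilityMeasure Bool) (o : Ω) : |smear U ν θ o| ≤ C :=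
  abs_integral_le fun y => hC y o

lemma smear_eq_integral (hC : ∀ y o, |U y o| ≤ C) (ν : ProbabilityMeasure G)
    (θ : ProbabilityMeasure Bool) (o : Ω) :
    smear U ν θ o = ∫ g, ∫ l, U (g, l) o ∂(θ : Measure Bool) ∂(ν : Measure G) :=
  integral_prod _ (integrable_of_abs_le Measurable.of_discrete fun y => hC y o)

lemma smear_probMidpoint_left (hC : ∀ y o, |U y o| ≤ C) (ν ν' : ProbabilityMeasure G)
    (θ : ProbabilityMeasure Bool) (o : Ω) :
    smear U (probMidpoint ν ν') θ o = (smear U ν θ o + smear U ν' θ o) / 2 := by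
  simp only [smear_eq_integral hC]
  exact integral_probMidpoint _ _ Measurable.of_discrete fun g => abs_integral_le fun l => hC _ o

lemma smear_probMidpoint_right (hC : ∀ y o, |U y o| ≤ C) (ν : ProbabilityMeasure G)
    (θ θ' : ProbabilityMeasure Bool) (o : Ω) :
    smear U ν (probMidpoint θ θ') o = (smear U ν θ o + smear U ν θ' o) / 2 := by
  simp only [smear_eq_integral hC]
  rw [← integral_add, ← integral_div]
  · congr 1 with g
    exact integral_probMidpoint _ _ Measurable.of_discrete fun l => hC _ o
  all_goals
    exact integrable_of_abs_le Measurable.of_discrete fun g => abs_integral_le fun l => hC _ o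

/-- The Dirac measure as a probability measure. -/
noncomputable def probDirac {α : Type*} [MeasurableSpace α] (a : α) : ProbabilityMeasure α :=
  ⟨Measure.dirac a, inferInstance⟩

lemma smear_probDirac (hC : ∀ y o, |U y o| ≤ C) (ν : ProbabilityMeasure G) (l : Bool) (o : Ω) :
    smear U ν (probDirac l) o = ∫ g, U (g, l) o ∂(ν : Measure G) := by
  rw [smear_eq_integral hC]
  exact integral_congr_ae (ae_of_all _ fun g => integral_dirac (fun l => U (g, l) o) l)

lemma integrable_smear_mul (hU : ∀ y, Measurable (U y)) (hC : ∀ y o, |U y o| ≤ C)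
    (ν ν' : ProbabilityMeasure G) (θ θ' : ProbabilityMeasure Bool) :
    Integrable (fun o => smear U ν θ o * smear U ν' θ' o) ρ :=
  integrable_of_abs_le ((measurable_smear hU _ _).mul (measurable_smear hU _ _))
    fun _ => abs_mul_le_sq (abs_smear_le hC _ _ _) (abs_smear_le hC _ _ _)

lemma integrable_smear_sq (hU : ∀ y, Measurable (U y)) (hC : ∀ y o, |U y o| ≤ C)
    (ν : ProbabilityMeasure G) (θ : ProbabilityMeasure Bool) :
    Integrable (fun o => smear U ν θ o ^ 2) ρ := by
  simpa only [sq] using integrable_smear_mul hU hC ν ν θ θ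

lemma integral_smear_mul_polarization (hU : ∀ y, Measurable (U y)) (hC : ∀ y o, |U y o| ≤ C)
    (ν : ProbabilityMeasure G) (θ θ' : ProbabilityMeasure Bool) :
    ∫ o, smear U ν θ o * smear U ν θ' o ∂ρ =
      2 * ∫ o, smear U ν (probMidpoint θ θ') o ^ 2 ∂ρ
        - (1 / 2) * ∫ o, smear U ν θ o ^ 2 ∂ρ - (1 / 2) * ∫ o, smear U ν θ' o ^ 2 ∂ρ := by
  simp only [← integral_const_mul]
  rw [← integral_sub, ← integral_sub]
  · congr 1 with o
    rw [smear_probMidpoint_right hC]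
    ring
  · exact ((integrable_smear_sq hU hC _ _).const_mul _).sub
      ((integrable_smear_sq hU hC _ _).const_mul _)
  all_goals exact (integrable_smear_sq hU hC _ _).const_mul _

lemma integral_sq_smear_sub (hU : ∀ y, Measurable (U y)) (hC : ∀ y o, |U y o| ≤ C)
    (ν ν' : ProbabilityMeasure G) (θ : ProbabilityMeasure Bool) :
    ∫ o, (smear U ν θ o - smear U ν' θ o) ^ 2 ∂ρ =
      2 * ∫ o, smear U ν θ o ^ 2 ∂ρ + 2 * ∫ o, smear U ν' θ o ^ 2 ∂ρ
        - 4 * ∫ o, smear U (probMidpoint ν ν') θ o ^ 2 ∂ρ := by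
  simp only [← integral_const_mul]
  rw [← integral_add, ← integral_sub]
  · congr 1 with o
    rw [smear_probMidpoint_left hC]
    ring
  · exact ((integrable_smear_sq hU hC _ _).const_mul _).add
      ((integrable_smear_sq hU hC _ _).const_mul _)
  all_goals exact (integrable_smear_sq hU hC _ _).const_mul _

lemma abs_integral_smear_mul_sub_le (hU : ∀ y, Measurable (U y)) (hC : ∀ y o, |U y o| ≤ C)
    (ν ν' : ProbabilityMeasure G) (θ θ' : ProbabilityMeasure Bool) {η : ℝ} (hη : 0 < η)
    (h : ∫ o, (smear U ν θ o - smear U ν' θ o) ^ 2 ∂ρ ≤ η ^ 2) :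
    |∫ o, smear U ν' θ o * smear U ν θ' o ∂ρ - ∫ o, smear U ν θ o * smear U ν θ' o ∂ρ| ≤
      2 * C * η := by
  have hint : Integrable (fun o => (smear U ν θ o - smear U ν' θ o) ^ 2) ρ := by
    refine integrable_of_abs_le (C := (C + C) ^ 2)
      (((measurable_smear hU _ _).sub (measurable_smear hU _ _)).pow_const 2) fun o => ?_
    rw [abs_pow]
    exact pow_le_pow_left₀ (abs_nonneg _)
      ((abs_sub _ _).trans (add_le_add (abs_smear_le hC _ _ _) (abs_smear_le hC _ _ _))) 2
  obtain ⟨o₀⟩ : Nonempty Ω := nonempty_of_isProbabilityMeasure ρ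
  have hC0 : 0 ≤ C := (abs_nonneg _).trans (hC (1, true) o₀)
  rw [← integral_sub (integrable_smear_mul hU hC _ _ _ _) (integrable_smear_mul hU hC _ _ _ _)]
  calc |∫ o, (smear U ν' θ o * smear U ν θ' o - smear U ν θ o * smear U ν θ' o) ∂ρ|
      ≤ ∫ o, |smear U ν' θ o * smear U ν θ' o - smear U ν θ o * smear U ν θ' o| ∂ρ :=
        abs_integral_le_integral_abs
    _ ≤ ∫ o, C * (η + (smear U ν θ o - smear U ν' θ o) ^ 2 / η) ∂ρ := by
        refine integral_mono_of_nonneg (ae_of_all _ fun _ => abs_nonneg _)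
          (((integrable_const _).add (hint.div_const _)).const_mul _) (ae_of_all _ fun o => ?_)
        simp only
        rw [← sub_mul, abs_mul, mul_comm, abs_sub_comm]
        refine mul_le_mul (abs_smear_le hC _ _ _) ?_ (abs_nonneg _) hC0
        rw [← sq_abs, ← sub_nonneg]
        have h2 : η + |smear U ν θ o - smear U ν' θ o| ^ 2 / η - |smear U ν θ o - smear U ν' θ o| =
            ((η - |smear U ν θ o - smear U ν' θ o| / 2) ^ 2 +
              3 / 4 * |smear U ν θ o - smear U ν' θ o| ^ 2) / η := by
          field_simp; ring
        rw [h2]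
        positivity
    _ = C * (η + (∫ o, (smear U ν θ o - smear U ν' θ o) ^ 2 ∂ρ) / η) := by
        rw [integral_const_mul, integral_add (integrable_const _) (hint.div_const _),
          integral_div]
        simp
    _ ≤ C * (η + η ^ 2 / η) := by gcongr
    _ = 2 * C * η := by field_simp; ring

lemma sq_integral_le {α : Type*} [MeasurableSpace α] {m : Measure α} [IsProbabilityMeasure m]
    {φ : α → ℝ} (hφ : Measurable φ) (hC : ∀ x, |φ x| ≤ C) :
    (∫ x, φ x ∂m) ^ 2 ≤ ∫ x, φ x ^ 2 ∂m := by
  have h1 : Integrable φ m := integrable_of_abs_le hφ hC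
  have h2 : Integrable (fun x => φ x ^ 2) m := by
    simp only [sq]
    exact integrable_of_abs_le (hφ.mul hφ) fun x => abs_mul_le_sq (hC x) (hC x)
  have h3 : 0 ≤ ∫ x, (φ x ^ 2 - 2 * (∫ y, φ y ∂m) * φ x + (∫ y, φ y ∂m) ^ 2) ∂m :=
    integral_nonneg fun x => by
      simp only [Pi.zero_apply]
      nlinarith [sq_nonneg (φ x - ∫ y, φ y ∂m)]
  have h4 := h1.const_mul (2 * ∫ y, φ y ∂m)
  rw [integral_add (by exact h2.sub h4) (integrable_const _), integral_sub h2 h4,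
    integral_const_mul] at h3
  simp only [integral_const, probReal_univ, one_smul] at h3
  nlinarith

lemma integral_smear_sq_le (hU : ∀ y, Measurable (U y)) (hC : ∀ y o, |U y o| ≤ C) (hC1 : 1 ≤ C)
    (hinv : ∀ (x : G) (y y' : G × Bool),
      ∫ o, U (y.1 * x, y.2) o * U (y'.1 * x, y'.2) o ∂ρ = ∫ o, U y o * U y' o ∂ρ)
    (ν₀ ν : ProbabilityMeasure G) (θ : ProbabilityMeasure Bool) {δ : ℝ}
    (h : IsAlmostInvariant ν₀ ν δ) :
    ∫ o, smear U ν θ o ^ 2 ∂ρ ≤ ∫ o, smear U ν₀ θ o ^ 2 ∂ρ + 2 * C ^ 2 * δ := by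
  set V : G → Ω → ℝ := fun x => smear (fun y : G × Bool => U (y.1 * x, y.2)) ν₀ θ with hV
  have hVm : ∀ x, Measurable (V x) := fun x => measurable_smear (fun y => hU _) _ _
  have hVC : ∀ x o, |V x o| ≤ C := fun x => abs_smear_le (fun y o => hC _ o) _ _
  have hVsq : ∀ x, ∫ o, V x o ^ 2 ∂ρ = ∫ o, smear U ν₀ θ o ^ 2 ∂ρ := by
    intro x
    simp only [sq]
    refine (integral_prod_kernel (fun y : G × Bool => hU (y.1 * x, y.2)) (fun y o => hC _ o)
      (fun y : G × Bool => hU (y.1 * x, y.2)) (fun y o => hC _ o) _ _).symm.trans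
      (Eq.trans ?_ (integral_prod_kernel hU hC hU hC _ _))
    exact integral_congr_ae (ae_of_all _ fun p => hinv x p.1 p.2)
  have hclose : ∀ o, |∫ x, V x o ∂(ν : Measure G) - smear U ν θ o| ≤ C * δ := by
    intro o
    have h1 := (h (fun g => (∫ l, U (g, l) o ∂(θ : Measure Bool)) / C) fun g => by
      rw [abs_div, abs_of_pos (by linarith : 0 < C), div_le_one (by linarith)]
      exact abs_integral_le fun l => hC _ _).1
    simp only [integral_div] at h1
    rw [← sub_div, abs_div, abs_of_pos (by linarith : 0 < C), div_le_iff₀ (by linarith)] at h1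
    rw [smear_eq_integral hC, mul_comm]
    have h2 : ∀ x, V x o = ∫ g, ∫ l, U (g * x, l) o ∂(θ : Measure Bool) ∂(ν₀ : Measure G) :=
      fun x => smear_eq_integral (fun y o => hC _ o) _ _ _
    simpa only [h2] using h1
  have hVbar : Measurable fun o => ∫ x, V x o ∂(ν : Measure G) := measurable_integral_kernel hVm _
  have hVbarC : ∀ o, |∫ x, V x o ∂(ν : Measure G)| ≤ C := fun o => abs_integral_le fun x => hVC x o
  have hVint : Integrable (fun o => (∫ x, V x o ∂(ν : Measure G)) ^ 2) ρ := by
    simp only [sq]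
    exact integrable_of_abs_le (hVbar.mul hVbar) fun o => abs_mul_le_sq (hVbarC o) (hVbarC o)
  have hVV : Integrable (Function.uncurry fun o x => V x o ^ 2) (ρ.prod (ν : Measure G)) := by
    refine integrable_of_abs_le (C := C ^ 2) (measurable_from_prod_countable_left
      fun x => (hVm x).pow_const 2) fun q => ?_
    simp only [Function.uncurry, sq (V _ _)]
    exact abs_mul_le_sq (hVC _ _) (hVC _ _)
  calc ∫ o, smear U ν θ o ^ 2 ∂ρ
      ≤ ∫ o, ((∫ x, V x o ∂(ν : Measure G)) ^ 2 + 2 * C ^ 2 * δ) ∂ρ := by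
        refine integral_mono (integrable_smear_sq hU hC _ _)
          (hVint.add (integrable_const _)) fun o => ?_
        have h1 := abs_le.1 (hclose o)
        have h2 := abs_le.1 (hVbarC o)
        have h3 := abs_le.1 (abs_smear_le hC ν θ o)
        have h4 : |(smear U ν θ o + ∫ x, V x o ∂(ν : Measure G)) *
            (∫ x, V x o ∂(ν : Measure G) - smear U ν θ o)| ≤ (2 * C) * (C * δ) := by
          rw [abs_mul]
          refine mul_le_mul ?_ (hclose o) (abs_nonneg _) (by linarith)
          rw [abs_le]; constructor <;> linarith
        have h5 := (abs_le.1 h4).1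
        simp only
        nlinarith
    _ = ∫ o, (∫ x, V x o ∂(ν : Measure G)) ^ 2 ∂ρ + 2 * C ^ 2 * δ := by
        rw [integral_add hVint (integrable_const _)]
        simp
    _ ≤ ∫ o, ∫ x, V x o ^ 2 ∂(ν : Measure G) ∂ρ + 2 * C ^ 2 * δ := by
        refine add_le_add_left (integral_mono hVint hVV.integral_prod_left fun o => ?_) _
        exact sq_integral_le Measurable.of_discrete fun x => hVC x _
    _ = ∫ o, smear U ν₀ θ o ^ 2 ∂ρ + 2 * C ^ 2 * δ := by
        rw [integral_integral_swap hVV]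
        simp [hVsq]

lemma abs_integral_kernel_sub_le (hU : ∀ y, Measurable (U y)) (hC : ∀ y o, |U y o| ≤ C)
    (hC1 : 1 ≤ C)
    (hinv : ∀ (x : G) (y y' : G × Bool),
      ∫ o, U (y.1 * x, y.2) o * U (y'.1 * x, y'.2) o ∂ρ = ∫ o, U y o * U y' o ∂ρ)
    (lam ν : ProbabilityMeasure G) (l l' : Bool) {δ : ℝ} (h : IsAlmostInvariant lam ν δ) :
    |∫ o, smear U lam (probDirac l) o * smear U ν (probDirac l') o ∂ρ
      - ∫ g, (∫ o, U (1, l) o * U (g, l') o ∂ρ) ∂(ν : Measure G)| ≤ C ^ 2 * δ := by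
  have hC2 : 0 < C ^ 2 := by positivity
  have hk : ∀ y y', |∫ o, U y o * U y' o ∂ρ| ≤ C ^ 2 :=
    fun y y' => abs_integral_le fun o => abs_mul_le_sq (hC _ _) (hC _ _)
  have h1 := (h (fun g => (∫ o, U (1, l) o * U (g, l') o ∂ρ) / C ^ 2) fun g => by
    rw [abs_div, abs_of_pos hC2, div_le_one hC2]
    exact hk _ _).2
  simp only [integral_div] at h1
  rw [← sub_div, abs_div, abs_of_pos hC2, div_le_iff₀ hC2] at h1
  simp only [smear_probDirac hC]
  rw [← integral_prod_kernel (fun g => hU (g, l)) (fun g o => hC _ o) (fun g => hU (g, l'))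
    (fun g o => hC _ o) (lam : Measure G) (ν : Measure G), mul_comm, integral_prod_symm _
    (integrable_of_abs_le Measurable.of_discrete fun p => hk _ _)]
  have h2 : ∀ x g, ∫ o, U (g, l) o * U (x, l') o ∂ρ =
      ∫ o, U (1, l) o * U (x * g⁻¹, l') o ∂ρ := by
    intro x g
    simpa using hinv g (1, l) (x * g⁻¹, l')
  have h3 : ∫ x, ∫ g, (∫ o, U (g, l) o * U (x, l') o ∂ρ) ∂(lam : Measure G) ∂(ν : Measure G) =
      ∫ x, ∫ g, (∫ o, U (1, l) o * U (x * g⁻¹, l') o ∂ρ) ∂(lam : Measure G) ∂(ν : Measure G) :=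
    integral_congr_ae (ae_of_all _ fun x => integral_congr_ae (ae_of_all _ fun g => h2 x g))
  rw [← h3] at h1
  exact h1

end Kernel


/-! ### Cube averages along product measures -/

section CubeSystem

/-- A measure-preserving action of `ι → G` together with bounded observables indexed by the
vertices of the cube `ι → Bool`. -/
structure CubeSystem (ι G : Type*) [Group G] {X : Type*} [MeasurableSpace X] (μ : Measure X) where
  /-- The action. -/
  act : (ι → G) → X → X
  act_mul : ∀ g h x, act (g * h) x = act g (act h x)
  measurePreserving_act : ∀ g, MeasurePreserving (act g) μ μ
  /-- The observables. -/
  obs : (ι → Bool) → X → ℝ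
  measurable_obs : ∀ ε, Measurable (obs ε)
  /-- A common bound for the observables. -/
  bound : ℝ
  one_le_bound : 1 ≤ bound
  abs_obs_le : ∀ ε x, |obs ε x| ≤ bound

/-- The vertex of the cube with sides `z j` singled out by `ω`. -/
def cubePick {ι Z : Type*} (ω : ι → Bool) (z : ι → Z × Z) : ι → Z :=
  fun j => if ω j then (z j).2 else (z j).1

lemma cubePick_update {ι Z : Type*} [DecidableEq ι] (ω : ι → Bool) (z : ι → Z × Z) (j : ι)
    (p : Z × Z) :
    cubePick ω (Function.update z j p) =
      Function.update (cubePick ω z) j (if ω j then p.2 else p.1) := by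
  ext1 i
  by_cases h : i = j
  · subst h; simp [cubePick]
  · simp [cubePick, h]

lemma cubePick_update_update {ι Z : Type*} [DecidableEq ι] (ω : ι → Bool) (z : ι → Z × Z) (j : ι)
    (b : Bool) (y : Z) :
    Function.update (cubePick (Function.update ω j b) z) j y =
      Function.update (cubePick ω z) j y := by
  ext1 i
  by_cases h : i = j
  · subst h; simp
  · simp [cubePick, h]

lemma map_update_pi_prod {ι Z : Type*} [Fintype ι] [DecidableEq ι] [MeasurableSpace Z]
    (W : ι → ProbabilityMeasure Z) (j : ι) (ξ : ProbabilityMeasure Z) :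
    ((Measure.pi fun i => (W i : Measure Z)).prod (ξ : Measure Z)).map
        (fun q => Function.update q.1 j q.2) =
      Measure.pi fun i => (Function.update W j ξ i : Measure Z) := by
  have hm : Measurable fun q : (ι → Z) × Z => Function.update q.1 j q.2 := by
    refine measurable_pi_lambda _ fun i => ?_
    by_cases h : i = j
    · subst h; simpa using measurable_snd
    · simpa [h] using measurable_fst.eval
  refine (Measure.pi_eq fun s hs => ?_).symm
  rw [Measure.map_apply hm (MeasurableSet.univ_pi hs)]
  have h1 : (fun q : (ι → Z) × Z => Function.update q.1 j q.2) ⁻¹' Set.univ.pi s =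
      Set.univ.pi (Function.update s j Set.univ) ×ˢ s j := by
    ext ⟨z, p⟩
    simp only [Set.mem_preimage, Set.mem_pi, Set.mem_univ, true_imp_iff, Set.mem_prod]
    constructor
    · intro h
      refine ⟨fun i => ?_, by simpa using h j⟩
      by_cases hi : i = j
      · subst hi; simp
      · simpa [hi] using h i
    · rintro ⟨h, h'⟩ i
      by_cases hi : i = j
      · subst hi; simpa using h'
      · simpa [hi] using h i
  rw [h1, Measure.prod_prod, Measure.pi_pi, ← Finset.prod_erase_mul _ _ (Finset.mem_univ j),
    ← Finset.prod_erase_mul _ _ (Finset.mem_univ j)]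
  simp only [Function.update_self, measure_univ, mul_one]
  congr 1
  refine Finset.prod_congr rfl fun i hi => ?_
  simp [Finset.ne_of_mem_erase hi]

namespace CubeSystem

variable {ι G X : Type*} [Fintype ι] [DecidableEq ι] [Group G] [MeasurableSpace X] {μ : Measure X}
  (D : CubeSystem ι G μ)

/-- The contribution of a single vertex of the cube. -/
def vertex (y : ι → G × Bool) (x : X) : ℝ :=
  D.obs (fun j => (y j).2) (D.act (fun j => (y j).1) x)

lemma measurable_vertex (y : ι → G × Bool) : Measurable (D.vertex y) :=
  (D.measurable_obs _).comp (D.measurePreserving_act _).measurable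

lemma abs_vertex_le (y : ι → G × Bool) (x : X) : |D.vertex y x| ≤ D.bound :=
  D.abs_obs_le _ _

lemma vertex_update_mul (y : ι → G × Bool) (j : ι) (a : G × Bool) (h : G) (x : X) :
    D.vertex (Function.update y j (a.1 * h, a.2)) x =
      D.vertex (Function.update y j a) (D.act (Pi.mulSingle j h) x) := by
  rw [vertex, vertex, ← D.act_mul]
  congr 1
  · congr 1 with i
    by_cases hi : i = j
    · subst hi; simp
    · simp [hi]
  · congr 1 with i
    by_cases hi : i = j
    · subst hi; simp
    · simp [hi]

/-- The correlation of the observables at the vertices of a cube. -/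
noncomputable def form (z : ι → (G × Bool) × (G × Bool)) : ℝ :=
  ∫ x, ∏ ω : ι → Bool, D.vertex (cubePick ω z) x ∂μ

/-- The bound for products of observables. -/
noncomputable def formBound : ℝ := D.bound ^ Fintype.card (ι → Bool)

lemma one_le_formBound : 1 ≤ D.formBound := one_le_pow₀ D.one_le_bound

lemma abs_prod_vertex_le (s : Finset (ι → Bool)) (y : (ι → Bool) → ι → G × Bool) (x : X) :
    |∏ ω ∈ s, D.vertex (y ω) x| ≤ D.formBound := by
  rw [Finset.abs_prod]
  calc ∏ ω ∈ s, |D.vertex (y ω) x| ≤ ∏ ω ∈ s, D.bound :=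
        Finset.prod_le_prod (fun _ _ => abs_nonneg _) fun _ _ => D.abs_vertex_le _ _
    _ = D.bound ^ s.card := by simp
    _ ≤ D.formBound := pow_le_pow_right₀ D.one_le_bound (Finset.card_le_univ s)

lemma abs_form_le [IsProbabilityMeasure μ] (z : ι → (G × Bool) × (G × Bool)) :
    |D.form z| ≤ D.formBound :=
  abs_integral_le fun _ => D.abs_prod_vertex_le _ _ _

/-- The product over half of the vertices of a cube, with `j`-th side replaced by `y`. -/
noncomputable def kern (j : ι) (y : G × Bool) (o : (ι → (G × Bool) × (G × Bool)) × X) : ℝ :=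
  ∏ ω : ι → Bool with ω j = false, D.vertex (Function.update (cubePick ω o.1) j y) o.2

lemma abs_kern_le (j : ι) (y : G × Bool) (o : (ι → (G × Bool) × (G × Bool)) × X) :
    |D.kern j y o| ≤ D.formBound :=
  D.abs_prod_vertex_le _ _ _

lemma form_update (z : ι → (G × Bool) × (G × Bool)) (j : ι) (p : (G × Bool) × (G × Bool)) :
    D.form (Function.update z j p) = ∫ x, D.kern j p.1 (z, x) * D.kern j p.2 (z, x) ∂μ := by
  refine integral_congr_ae (ae_of_all _ fun x => ?_)
  simp only [kern]
  rw [← Finset.prod_filter_mul_prod_filter_not Finset.univ (fun ω : ι → Bool => ω j = false)]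
  congr 1
  · refine Finset.prod_congr rfl fun ω hω => ?_
    rw [cubePick_update]
    simp [(Finset.mem_filter.1 hω).2]
  · refine Finset.prod_nbij' (fun ω => Function.update ω j false)
      (fun ω => Function.update ω j true) ?_ ?_ ?_ ?_ ?_
    · simp
    · simp
    · intro ω hω
      have : ω j = true := by simpa using hω
      simp [← this]
    · intro ω hω
      have : ω j = false := by simpa using hω
      simp [← this]
    · intro ω hω
      have : ω j = true := by simpa using hω
      rw [cubePick_update, cubePick_update_update]
      simp [this]

variable [MeasurableSpace G] [Countable G] [MeasurableSingletonClass G]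

lemma measurable_kern (j : ι) (y : G × Bool) : Measurable (D.kern j y) :=
  measurable_from_prod_countable_right fun z =>
    Finset.measurable_prod _ fun ω _ =>
      D.measurable_vertex (Function.update (cubePick ω z) j y)

lemma measurable_kern_mul (j : ι) (y y' : G × Bool) :
    Measurable fun o => D.kern j y o * D.kern j y' o :=
  (D.measurable_kern _ _).mul (D.measurable_kern _ _)

lemma abs_kern_mul_le (j : ι) (y y' : G × Bool) (o : (ι → (G × Bool) × (G × Bool)) × X) :
    |D.kern j y o * D.kern j y' o| ≤ D.formBound ^ 2 :=
  abs_mul_le_sq (D.abs_kern_le _ _ _) (D.abs_kern_le _ _ _)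

/-- The average of `form` with respect to a product measure. -/
noncomputable def avg (W : ι → ProbabilityMeasure ((G × Bool) × (G × Bool))) : ℝ :=
  ∫ z, D.form z ∂Measure.pi fun j => (W j : Measure ((G × Bool) × (G × Bool)))

variable [IsProbabilityMeasure μ]

lemma abs_avg_le (W : ι → ProbabilityMeasure ((G × Bool) × (G × Bool))) :
    |D.avg W| ≤ D.formBound :=
  abs_integral_le D.abs_form_le

variable (μ) in
/-- The space on which the kernels `kern` live. -/
noncomputable def kernMeasure (W : ι → ProbabilityMeasure ((G × Bool) × (G × Bool))) :
    Measure ((ι → (G × Bool) × (G × Bool)) × X) :=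
  (Measure.pi fun j => (W j : Measure ((G × Bool) × (G × Bool)))).prod μ

instance (W : ι → ProbabilityMeasure ((G × Bool) × (G × Bool))) :
    IsProbabilityMeasure (kernMeasure μ W) := by
  unfold kernMeasure; infer_instance

lemma avg_update (W : ι → ProbabilityMeasure ((G × Bool) × (G × Bool))) (j : ι)
    (ξ : ProbabilityMeasure ((G × Bool) × (G × Bool))) :
    D.avg (Function.update W j ξ) =
      ∫ p, (∫ o, D.kern j p.1 o * D.kern j p.2 o ∂kernMeasure μ W)
        ∂(ξ : Measure ((G × Bool) × (G × Bool))) := by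
  rw [avg, ← map_update_pi_prod, integral_map Measurable.of_discrete.aemeasurable
    Measurable.of_discrete.aestronglyMeasurable, integral_prod_symm _
    (integrable_of_abs_le Measurable.of_discrete fun q => D.abs_form_le _)]
  refine integral_congr_ae (ae_of_all _ fun p => ?_)
  simp only [kernMeasure]
  rw [integral_prod _ (integrable_of_abs_le (D.measurable_kern_mul _ _ _)
    (D.abs_kern_mul_le _ _ _))]
  simp only [D.form_update]

lemma integral_kern_mul_right (W : ι → ProbabilityMeasure ((G × Bool) × (G × Bool))) (j : ι)
    (h : G) (y y' : G × Bool) :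
    ∫ o, D.kern j (y.1 * h, y.2) o * D.kern j (y'.1 * h, y'.2) o ∂kernMeasure μ W =
      ∫ o, D.kern j y o * D.kern j y' o ∂kernMeasure μ W := by
  have h1 : MeasurePreserving (Prod.map id (D.act (Pi.mulSingle j h)))
      (kernMeasure μ W) (kernMeasure μ W) :=
    (MeasurePreserving.id _).prod (D.measurePreserving_act _)
  conv_rhs => rw [← h1.map_eq]
  rw [integral_map h1.measurable.aemeasurable
    (D.measurable_kern_mul _ _ _).aestronglyMeasurable]
  simp only [kern, vertex_update_mul, Prod.map_fst, Prod.map_snd, id]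

end CubeSystem

end CubeSystem

/-! ### Convergence along almost invariant measures -/

section Convergence

lemma tendsto_apply_pi {ι β : Type*} (l : Filter β) (j : ι) :
    Tendsto (fun ν : ι → β => ν j) (Filter.pi fun _ => l) l :=
  tendsto_eval_pi _ j

lemma tendsto_update_pi {ι β : Type*} [DecidableEq ι] (l : Filter β) (j : ι) :
    Tendsto (fun q : (ι → β) × β => Function.update q.1 j q.2)
      ((Filter.pi fun _ => l) ×ˢ l) (Filter.pi fun _ => l) := by
  refine tendsto_pi.2 fun i => ?_
  by_cases h : i = j
  · subst h; simpa using tendsto_snd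
  · simpa [h, Function.comp_def] using (tendsto_apply_pi l i).comp tendsto_fst

lemma exists_eventually_lt_of_tendsto_prod {α β : Type*} {l : Filter α} {l' : Filter β} [l'.NeBot]
    {F : α → β → ℝ} {a c : ℝ} (h : Tendsto (fun q : α × β => F q.1 q.2) (l ×ˢ l') (𝓝 a))
    (hac : a < c) : ∃ b, ∀ᶠ x in l, F x b < c :=
  (eventually_swap_iff.1 (h.eventually_lt_const hac)).curry.exists

/-- The ways in which a side of a random cube can depend on a probability measure on the group. -/
inductive SideLaw (G : Type*) [MeasurableSpace G]
  /-- The second endpoint is random and the first endpoint is trivial. -/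
  | based
  /-- The endpoints are independent, with independent labels of law `θ`. -/
  | indep (θ : ProbabilityMeasure Bool)
  /-- The side has a law which does not depend on the measure. -/
  | fixed (ξ : ProbabilityMeasure ((G × Bool) × (G × Bool)))

/-- The law of a side of the given type. -/
noncomputable def SideLaw.law {G : Type*} [Group G] [MeasurableSpace G] [Countable G]
    [MeasurableSingletonClass G] (ν : ProbabilityMeasure G) :
    SideLaw G → ProbabilityMeasure ((G × Bool) × (G × Bool))
  | based => ν.map (f := fun g => ((1, false), (g, true))) Measurable.of_discrete.aemeasurable
  | indep θ => (ν.prod θ).prod (ν.prod θ)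
  | fixed ξ => ξ

namespace CubeSystem

variable {ι G X : Type*} [Fintype ι] [DecidableEq ι] [Group G] [MeasurableSpace X] {μ : Measure X}
  (D : CubeSystem ι G μ) [MeasurableSpace G] [Countable G] [MeasurableSingletonClass G]

/-- The average of `form` over cubes with independent sides of the given types. -/
noncomputable def value (m : ι → SideLaw G) (ν : ι → ProbabilityMeasure G) : ℝ :=
  D.avg fun j => (m j).law (ν j)

lemma value_update_update (m : ι → SideLaw G) (ν : ι → ProbabilityMeasure G) (j : ι)
    (a : SideLaw G) (ν' : ProbabilityMeasure G) :
    D.value (Function.update m j a) (Function.update ν j ν') =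
      D.avg (Function.update (fun i => (m i).law (ν i)) j (a.law ν')) := by
  rw [value]
  congr 1 with i : 1
  by_cases h : i = j
  · subst h; simp
  · simp [h]

variable [IsProbabilityMeasure μ]

lemma value_indep (m : ι → SideLaw G) (ν : ι → ProbabilityMeasure G) (j : ι)
    (θ : ProbabilityMeasure Bool) (ν' : ProbabilityMeasure G) :
    D.value (Function.update m j (.indep θ)) (Function.update ν j ν') =
      ∫ o, smear (D.kern j) ν' θ o ^ 2 ∂kernMeasure μ (fun i => (m i).law (ν i)) := by
  rw [value_update_update, avg_update]
  simp only [sq]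
  exact integral_prod_kernel (D.measurable_kern j) (D.abs_kern_le j) (D.measurable_kern j)
    (D.abs_kern_le j) _ _

lemma value_based (m : ι → SideLaw G) (ν : ι → ProbabilityMeasure G) (j : ι)
    (ν' : ProbabilityMeasure G) :
    D.value (Function.update m j .based) (Function.update ν j ν') =
      ∫ g, (∫ o, D.kern j (1, false) o * D.kern j (g, true) o
        ∂kernMeasure μ (fun i => (m i).law (ν i))) ∂(ν' : Measure G) := by
  rw [value_update_update, avg_update]
  exact integral_map Measurable.of_discrete.aemeasurable
    Measurable.of_discrete.aestronglyMeasurable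

lemma value_update_le (m : ι → SideLaw G) (ν : ι → ProbabilityMeasure G) (j : ι)
    (hj : m j ≠ .based) (ν₀ ν' : ProbabilityMeasure G) {δ : ℝ} (hδ : 0 ≤ δ)
    (h : IsAlmostInvariant ν₀ ν' δ) :
    D.value m (Function.update ν j ν') ≤
      D.value m (Function.update ν j ν₀) + 2 * D.formBound ^ 2 * δ := by
  rw [← Function.update_eq_self j m]
  cases hm : m j with
  | based => exact absurd hm hj
  | indep θ =>
    rw [value_indep, value_indep]
    exact integral_smear_sq_le (D.measurable_kern j) (D.abs_kern_le j) D.one_le_formBound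
      (D.integral_kern_mul_right _ j) _ _ _ h
  | fixed ξ =>
    rw [value_update_update, value_update_update]
    simp only [SideLaw.law]
    have := D.one_le_formBound
    exact le_add_of_nonneg_right (by positivity)

lemma value_le (m : ι → SideLaw G) (hm : ∀ j, m j ≠ .based) (ν₀ ν : ι → ProbabilityMeasure G)
    {δ : ℝ} (hδ : 0 ≤ δ) (h : ∀ j, IsAlmostInvariant (ν₀ j) (ν j) δ) :
    D.value m ν ≤ D.value m ν₀ + Fintype.card ι * (2 * D.formBound ^ 2 * δ) := by
  have key : ∀ s : Finset ι,
      D.value m (s.piecewise ν ν₀) ≤ D.value m ν₀ + s.card * (2 * D.formBound ^ 2 * δ) := by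
    intro s
    induction s using Finset.induction_on with
    | empty => simp
    | insert j s hj ih =>
      rw [Finset.piecewise_insert, Finset.card_insert_of_notMem hj]
      have h1 := D.value_update_le m (s.piecewise ν ν₀) j (hm j) (ν₀ j) (ν j) hδ (h j)
      have h2 : Function.update (s.piecewise ν ν₀) j (ν₀ j) = s.piecewise ν ν₀ := by
        rw [← Finset.piecewise_eq_of_notMem s ν ν₀ hj, Function.update_eq_self]
      rw [h2] at h1
      push_cast
      linarith
  simpa using key Finset.univ

/-- Without based sides the averages decrease, up to small errors, along more and more invariant
measures. -/
lemma tendsto_value_of_ne_based (m : ι → SideLaw G) (hm : ∀ j, m j ≠ .based) :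
    Tendsto (D.value m) (Filter.pi fun _ => almostInvariantFilter G) (𝓝 (⨅ ν, D.value m ν)) := by
  have hbdd : BddBelow (Set.range (D.value m)) :=
    ⟨-D.formBound, by rintro _ ⟨ν, rfl⟩; exact (abs_le.1 (D.abs_avg_le _)).1⟩
  have : Nonempty (ι → ProbabilityMeasure G) := ⟨fun _ => probDirac 1⟩
  refine tendsto_order.2 ⟨fun a ha => .of_forall fun ν => ha.trans_le (ciInf_le hbdd ν),
    fun a ha => ?_⟩
  obtain ⟨ν₀, hν₀⟩ := exists_lt_of_ciInf_lt ha
  have hC := D.one_le_formBound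
  set K : ℝ := (Fintype.card ι + 1) * (2 * D.formBound ^ 2) with hK
  have hKpos : 0 < K := by positivity
  set δ : ℝ := (a - D.value m ν₀) / K with hδ
  have hδpos : 0 < δ := div_pos (sub_pos.2 hν₀) hKpos
  have hev : ∀ᶠ ν : ι → ProbabilityMeasure G in Filter.pi fun _ => almostInvariantFilter G,
      ∀ j, IsAlmostInvariant (ν₀ j) (ν j) δ :=
    eventually_all.2 fun j =>
      (tendsto_apply_pi _ j).eventually (eventually_isAlmostInvariant (ν₀ j) hδpos)
  filter_upwards [hev] with ν hν
  refine (D.value_le m hm ν₀ ν hδpos.le hν).trans_lt ?_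
  have h1 : K * δ = a - D.value m ν₀ := mul_div_cancel₀ _ hKpos.ne'
  have h2 : 0 < 2 * D.formBound ^ 2 * δ := by positivity
  have h3 : K * δ = Fintype.card ι * (2 * D.formBound ^ 2 * δ) + 2 * D.formBound ^ 2 * δ := by
    rw [hK]; ring
  linarith

lemma exists_eventually_integral_smear_sub_sq_le [(almostInvariantFilter G).NeBot]
    (m : ι → SideLaw G) (j : ι) (θ : ProbabilityMeasure Bool) {ℓ : ℝ}
    (h : Tendsto (D.value (Function.update m j (.indep θ)))
      (Filter.pi fun _ => almostInvariantFilter G) (𝓝 ℓ)) {η : ℝ} (hη : 0 < η) :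
    ∃ lam : ProbabilityMeasure G,
      ∀ᶠ ν : ι → ProbabilityMeasure G in Filter.pi fun _ => almostInvariantFilter G,
        ∫ o, (smear (D.kern j) (ν j) θ o - smear (D.kern j) lam θ o) ^ 2
          ∂kernMeasure μ (fun i => (m i).law (ν i)) ≤ η ^ 2 := by
  have h0 : Tendsto (fun q : (ι → ProbabilityMeasure G) × ProbabilityMeasure G =>
      probMidpoint (q.1 j) q.2)
      ((Filter.pi fun _ => almostInvariantFilter G) ×ˢ almostInvariantFilter G)
      (almostInvariantFilter G) :=
    tendsto_probMidpoint ((tendsto_apply_pi (almostInvariantFilter G) j).comp tendsto_fst)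
      tendsto_snd
  have h2 : Tendsto (fun q : (ι → ProbabilityMeasure G) × ProbabilityMeasure G =>
      2 * D.value (Function.update m j (.indep θ)) q.1
        + 2 * D.value (Function.update m j (.indep θ)) (Function.update q.1 j q.2)
        - 4 * D.value (Function.update m j (.indep θ))
          (Function.update q.1 j (probMidpoint (q.1 j) q.2)))
      ((Filter.pi fun _ => almostInvariantFilter G) ×ˢ almostInvariantFilter G)
      (𝓝 (2 * ℓ + 2 * ℓ - 4 * ℓ)) :=
    (((h.comp tendsto_fst).const_mul 2).add
      ((h.comp (tendsto_update_pi (almostInvariantFilter G) j)).const_mul 2)).sub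
      ((h.comp ((tendsto_update_pi (almostInvariantFilter G) j).comp
        (tendsto_fst.prodMk h0))).const_mul 4)
  have h3 : 2 * ℓ + 2 * ℓ - 4 * ℓ < η ^ 2 := by
    have := pow_pos hη 2
    linarith
  obtain ⟨lam, hlam⟩ := exists_eventually_lt_of_tendsto_prod
    (F := fun ν lam => 2 * D.value (Function.update m j (.indep θ)) ν
        + 2 * D.value (Function.update m j (.indep θ)) (Function.update ν j lam)
        - 4 * D.value (Function.update m j (.indep θ))
          (Function.update ν j (probMidpoint (ν j) lam))) h2 h3
  refine ⟨lam, ?_⟩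
  filter_upwards [hlam] with ν hν
  rw [integral_sq_smear_sub (D.measurable_kern j) (D.abs_kern_le j), ← value_indep,
    ← value_indep, ← value_indep, Function.update_eq_self]
  exact hν.le

lemma tendsto_value_of_based [(almostInvariantFilter G).NeBot] (m : ι → SideLaw G) (j : ι)
    (hj : m j = .based)
    (h : ∀ θ, ∃ ℓ, Tendsto (D.value (Function.update m j (.indep θ)))
      (Filter.pi fun _ => almostInvariantFilter G) (𝓝 ℓ)) :
    ∃ ℓ, Tendsto (D.value m) (Filter.pi fun _ => almostInvariantFilter G) (𝓝 ℓ) := by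
  choose L hL using h
  have hC := D.one_le_formBound
  have hlim := (((hL (probMidpoint (probDirac false) (probDirac true))).const_mul 2).sub
    ((hL (probDirac false)).const_mul (1 / 2))).sub ((hL (probDirac true)).const_mul (1 / 2))
  refine ⟨_, hlim.congr_dist (Metric.tendsto_nhds.2 fun ε hε => ?_)⟩
  have hη : 0 < ε / (8 * D.formBound) := by positivity
  have hδ : 0 < ε / (4 * D.formBound ^ 2) := by positivity
  obtain ⟨lam, hlam⟩ :=
    D.exists_eventually_integral_smear_sub_sq_le m j (probDirac false) (hL _) hη
  filter_upwards [hlam, (tendsto_apply_pi _ j).eventually (eventually_isAlmostInvariant lam hδ)]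
    with ν h1 h2
  have hval : ∀ a, D.value (Function.update m j a) ν =
      D.value (Function.update m j a) (Function.update ν j (ν j)) := fun a => by
    rw [Function.update_eq_self]
  have h3 := abs_integral_smear_mul_sub_le (D.measurable_kern j) (D.abs_kern_le j) (ν j) lam
    (probDirac false) (probDirac true) hη h1
  have h4 := abs_integral_kernel_sub_le (D.measurable_kern j) (D.abs_kern_le j) hC
    (D.integral_kern_mul_right (fun i => (m i).law (ν i)) j) lam (ν j) false true h2
  rw [← value_based, Function.update_eq_self, ← hj, Function.update_eq_self] at h4
  rw [integral_smear_mul_polarization (D.measurable_kern j) (D.abs_kern_le j) (ν j)] at h3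
  simp only [← value_indep, ← hval] at h3
  have h5 : 2 * D.formBound * (ε / (8 * D.formBound)) = ε / 4 := by field_simp; norm_num
  have h6 : D.formBound ^ 2 * (ε / (4 * D.formBound ^ 2)) = ε / 4 := by field_simp
  rw [h5] at h3
  rw [h6] at h4
  rw [Real.dist_eq, sub_zero, Real.dist_eq, abs_abs]
  rw [abs_le] at h3 h4
  rw [abs_lt]
  constructor <;> linarith

theorem exists_tendsto_value [(almostInvariantFilter G).NeBot] (m : ι → SideLaw G) :
    ∃ ℓ, Tendsto (D.value m) (Filter.pi fun _ => almostInvariantFilter G) (𝓝 ℓ) := by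
  suffices H : ∀ (J : Finset ι) (m : ι → SideLaw G), (∀ j, m j = .based → j ∈ J) →
      ∃ ℓ, Tendsto (D.value m) (Filter.pi fun _ => almostInvariantFilter G) (𝓝 ℓ) from
    H Finset.univ m fun j _ => Finset.mem_univ j
  intro J
  induction J using Finset.induction_on with
  | empty => exact fun m hm => ⟨_, D.tendsto_value_of_ne_based m fun j hj => by simpa using hm j hj⟩
  | insert j J _ ih =>
    intro m hm
    by_cases hj : m j = .based
    · refine D.tendsto_value_of_based m j hj fun θ => ih _ fun i hi => ?_
      by_cases hij : i = j
      · subst hij; simp at hi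
      · exact Finset.mem_of_mem_insert_of_ne (hm i (by simpa [hij] using hi)) hij
    · exact ih m fun i hi =>
        Finset.mem_of_mem_insert_of_ne (hm i hi) fun hij => hj (hij ▸ hi)

end CubeSystem

end Convergence

/-! ### Iterated limits -/

section IteratedLimits

lemma tendsto_of_tendsto_snoc {k : ℕ} {A : (Fin (k + 1) → ℕ) → ℝ} {B : (Fin k → ℕ) → ℝ} {ℓ : ℝ}
    (hA : Tendsto A atTop (𝓝 ℓ))
    (hB : ∀ M : Fin k → ℕ, Tendsto (fun n => A (Fin.snoc M n)) atTop (𝓝 (B M))) :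
    Tendsto B atTop (𝓝 ℓ) := by
  refine Metric.tendsto_atTop.2 fun ε hε => ?_
  obtain ⟨N₀, hN₀⟩ := Metric.tendsto_atTop.1 hA (ε / 2) (half_pos hε)
  refine ⟨fun j => N₀ j.castSucc, fun N hN => ?_⟩
  refine lt_of_le_of_lt (le_of_tendsto ((hB N).dist tendsto_const_nhds) ?_) (half_lt_self hε)
  filter_upwards [eventually_ge_atTop (N₀ (Fin.last k))] with n hn
  refine (hN₀ _ fun j => ?_).le
  induction j using Fin.lastCases with
  | last => simpa using hn
  | cast j => simpa using hN j

lemma snoc_piecewise {k : ℕ} (J : Finset (Fin k)) (N M : Fin k → ℕ) (n n' : ℕ) :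
    (insert (Fin.last k) (J.map Fin.castSuccEmb)).piecewise (Fin.snoc N n : Fin (k + 1) → ℕ)
      (Fin.snoc M n') = Fin.snoc (J.piecewise N M) n := by
  ext1 j
  induction j using Fin.lastCases with
  | last => simp [Finset.piecewise]
  | cast j => simp [Finset.piecewise, (Fin.castSucc_lt_last j).ne]

/-- An iterated limit exists if all the joint limits in a subset of the variables exist. -/
lemma exists_iterLimExists : ∀ {k : ℕ} (A : (Fin k → ℕ) → ℝ),
    (∀ (J : Finset (Fin k)) (M : Fin k → ℕ),
      ∃ ℓ, Tendsto (fun N => A (J.piecewise N M)) atTop (𝓝 ℓ)) → ∃ I, IterLimExists A I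
  | 0, A, _ => ⟨_, rfl⟩
  | k + 1, A, h => by
    have h1 : ∀ M : Fin k → ℕ, ∃ ℓ, Tendsto (fun n => A (Fin.snoc M n)) atTop (𝓝 ℓ) := by
      intro M
      obtain ⟨ℓ, hℓ⟩ := h (insert (Fin.last k) ((∅ : Finset (Fin k)).map Fin.castSuccEmb))
        (Fin.snoc M 0)
      have h2 : Tendsto (fun (n : ℕ) (_ : Fin (k + 1)) => n) atTop atTop :=
        tendsto_atTop.2 fun N => (eventually_ge_atTop (∑ j, N j)).mono fun n hn j =>
          (Finset.single_le_sum (fun _ _ => Nat.zero_le _) (Finset.mem_univ j)).trans hn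
      refine ⟨ℓ, (hℓ.comp h2).congr fun n => ?_⟩
      have h3 : (fun _ : Fin (k + 1) => n) = Fin.snoc (fun _ : Fin k => n) n := by
        ext1 j
        induction j using Fin.lastCases <;> simp
      rw [Function.comp_apply, h3, snoc_piecewise]
      simp
    choose B hB using h1
    obtain ⟨I, hI⟩ := exists_iterLimExists B fun J M => by
      obtain ⟨ℓ, hℓ⟩ := h (insert (Fin.last k) (J.map Fin.castSuccEmb)) (Fin.snoc M 0)
      refine ⟨ℓ, tendsto_of_tendsto_snoc hℓ fun N => ?_⟩
      simp only [snoc_piecewise]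
      exact hB _
    exact ⟨I, B, hB, hI⟩

lemma IterLimExists.eq_of_tendsto : ∀ {k : ℕ} {A : (Fin k → ℕ) → ℝ} {I ℓ : ℝ},
    IterLimExists A I → Tendsto A atTop (𝓝 ℓ) → I = ℓ
  | 0, A, I, ℓ, hI, hA => by
    have h1 : A = fun _ => I := by
      ext1 N
      rw [← show A (fun i => i.elim0) = I from hI]
      exact congrArg A (Subsingleton.elim _ _)
    rw [h1] at hA
    exact tendsto_nhds_unique tendsto_const_nhds hA
  | k + 1, A, I, ℓ, ⟨B, hB, hI⟩, hA => hI.eq_of_tendsto (tendsto_of_tendsto_snoc hA hB)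

end IteratedLimits

/-! ### Averages along Følner sequences -/

section Folner

namespace CubeSystem

variable {ι G X : Type*} [Fintype ι] [DecidableEq ι] [Group G] [MeasurableSpace X] {μ : Measure X}
  (D : CubeSystem ι G μ)

/-- The correlation of the observables along the cube spanned by `g`. -/
noncomputable def basedForm (g : ι → G) : ℝ :=
  ∫ x, ∏ ω : ι → Bool, D.obs ω (D.act (fun j => if ω j then g j else 1) x) ∂μ

lemma form_based (g : ι → G) : D.form (fun j => ((1, false), (g j, true))) = D.basedForm g := by
  refine integral_congr_ae (ae_of_all _ fun x => Finset.prod_congr rfl fun ω _ => ?_)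
  simp only [vertex, cubePick]
  congr 1
  · ext1 j; by_cases h : ω j <;> simp [h]
  · congr 1 with j; by_cases h : ω j <;> simp [h]

variable [MeasurableSpace G] [Countable G] [MeasurableSingletonClass G]

lemma avg_based (ν : ι → ProbabilityMeasure G) :
    D.avg (fun j => SideLaw.based.law (ν j)) =
      ∫ g, D.basedForm g ∂Measure.pi fun j => (ν j : Measure G) := by
  have h1 : (Measure.pi fun j => (SideLaw.based.law (ν j) : Measure ((G × Bool) × (G × Bool)))) =
      (Measure.pi fun j => (ν j : Measure G)).map
        fun g j => (((1, false), (g j, true)) : (G × Bool) × (G × Bool)) :=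
    (Measure.pi_map_pi fun _ => Measurable.of_discrete.aemeasurable).symm
  rw [avg, h1, integral_map Measurable.of_discrete.aemeasurable
    Measurable.of_discrete.aestronglyMeasurable]
  simp only [form_based]

/-- The averages of a cube system along a Følner sequence converge jointly in any subset of the
variables. -/
theorem exists_tendsto_folner [IsProbabilityMeasure μ] [DecidableEq G] {Φ : ℕ → Finset G}
    (hΦ : IsTwoSidedFolner Φ) (J : Finset ι) (M : ι → ℕ) :
    ∃ ℓ, Tendsto (fun N : ι → ℕ => (∏ j, ((Φ (J.piecewise N M j)).card : ℝ))⁻¹ *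
      ∑ g ∈ Fintype.piFinset (fun j => Φ (J.piecewise N M j)), D.basedForm g) atTop (𝓝 ℓ) := by
  have hu := hΦ.tendsto_uniformProb
  set u : ℕ → ProbabilityMeasure G := fun n => uniformProb (Φ n) (hΦ.1.1 n)
  have : (almostInvariantFilter G).NeBot := hu.neBot
  obtain ⟨ℓ, hℓ⟩ := D.exists_tendsto_value fun j =>
    if j ∈ J then .based else .fixed (SideLaw.based.law (u (M j)))
  have h1 : Tendsto (fun (N : ι → ℕ) j => u (N j)) atTop
      (Filter.pi fun _ => almostInvariantFilter G) :=
    tendsto_pi.2 fun j => hu.comp (tendsto_atTop.2 fun b =>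
      (eventually_ge_atTop fun _ => b).mono fun N hN => hN j)
  refine ⟨ℓ, (hℓ.comp h1).congr fun N => ?_⟩
  have h2 : ∀ j, SideLaw.law (u (N j))
      (if j ∈ J then SideLaw.based else SideLaw.fixed (SideLaw.based.law (u (M j)))) =
      SideLaw.based.law (u (J.piecewise N M j)) := fun j => by
    by_cases h : j ∈ J <;> simp [h, SideLaw.law]
  rw [Function.comp_apply, value]
  simp only [h2]
  rw [avg_based]
  exact integral_pi_uniformProb _ _ _ fun g => by rw [← form_based]; exact D.abs_form_le _

end CubeSystem

end Folner

/-! ### Products of commuting actions -/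

section Actions

lemma List.prod_ofFn_mul {M : Type*} [Monoid M] : ∀ {k : ℕ} (a b : Fin k → M),
    (∀ i j, i ≠ j → Commute (a i) (b j)) →
      (List.ofFn fun j => a j * b j).prod = (List.ofFn a).prod * (List.ofFn b).prod
  | 0, a, b, _ => by simp
  | k + 1, a, b, h => by
    have h1 : Commute (List.ofFn fun j : Fin k => a j.succ).prod (b 0) :=
      Commute.list_prod_left _ _ fun x hx => by
        obtain ⟨i, rfl⟩ := (List.mem_ofFn' _ _).1 hx
        exact h _ _ (Fin.succ_ne_zero i)
    simp only [List.ofFn_succ, List.prod_cons]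
    rw [List.prod_ofFn_mul (fun j => a j.succ) (fun j => b j.succ)
      fun i j hij => h _ _ fun h' => hij (Fin.succ_injective _ h'), mul_assoc, mul_assoc,
      ← mul_assoc (b 0), ← mul_assoc _ (b 0), h1.eq]

lemma List.prod_ofFn_comp_perm {M : Type*} [Monoid M] {k : ℕ} (σ : Equiv.Perm (Fin k))
    (a : Fin k → M) (h : ∀ i j, i ≠ j → Commute (a i) (a j)) :
    (List.ofFn fun j => a (σ j)).prod = (List.ofFn a).prod :=
  (σ.ofFn_comp_perm a).prod_eq' (List.pairwise_ofFn.2 fun _ _ hij =>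
    h _ _ (σ.injective.ne hij.ne))

lemma measurePreserving_prod_ofFn {X : Type*} [MeasurableSpace X] {μ : Measure X} :
    ∀ {k : ℕ} (a : Fin k → Function.End X), (∀ j, MeasurePreserving (a j) μ μ) →
      MeasurePreserving ((List.ofFn a).prod : Function.End X) μ μ
  | 0, _, _ => MeasurePreserving.id μ
  | k + 1, a, h => by
    rw [List.ofFn_succ, List.prod_cons]
    exact (h 0).comp (measurePreserving_prod_ofFn (fun j => a j.succ) fun j => h _)

variable {G X : Type*} [Group G] {d k : ℕ} {T : Fin d → G → X → X}

/-- The map `T i g` as an element of the monoid of self-maps. -/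
def actionEnd (T : Fin d → G → X → X) (i : Fin d) (g : G) : Function.End X := T i g

lemma cubeMapP_eq_prod (T : Fin d → G → X → X) (P : Fin k → Fin d) (g : Fin k → G)
    (ε : Fin k → Bool) : cubeMapP T P g ε =
      (List.ofFn fun j => if ε j then actionEnd T (P j) (g j) else 1).prod :=
  rfl

lemma action_one (hT_bij : ∀ i g, Function.Bijective (T i g))
    (hT_hom : ∀ i g h, T i (g * h) = T i g ∘ T i h) (i : Fin d) : T i 1 = id := by
  funext x
  apply (hT_bij i 1).injective
  have := congrFun (hT_hom i 1 1) x
  rw [mul_one] at this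
  exact this.symm

lemma cubeMapP_eq_prod_ite (hT_bij : ∀ i g, Function.Bijective (T i g))
    (hT_hom : ∀ i g h, T i (g * h) = T i g ∘ T i h) (P : Fin k → Fin d) (g : Fin k → G)
    (ε : Fin k → Bool) : cubeMapP T P g ε =
      (List.ofFn fun j => actionEnd T (P j) (if ε j then g j else 1)).prod := by
  rw [cubeMapP_eq_prod]
  congr 2 with j : 1
  by_cases h : ε j
  · simp [h]
  · simp only [h]
    exact (action_one hT_bij hT_hom (P j)).symm

/-- The cube system attached to commuting measure-preserving actions. -/
noncomputable def cubeSystemOfActions [MeasurableSpace X] {μ : Measure X}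
    (hT_mp : ∀ i g, MeasurePreserving (T i g) μ μ)
    (hT_hom : ∀ i g h, T i (g * h) = T i g ∘ T i h)
    (hT_comm : ∀ i j, i ≠ j → ∀ g h, T i g ∘ T j h = T j h ∘ T i g)
    (P : Fin k → Fin d) (hP : Function.Injective P) (f : (Fin k → Bool) → X → ℝ)
    (hf : ∀ ε, Measurable (f ε)) {R : ℝ} (hR : 1 ≤ R) (hfR : ∀ ε x, |f ε x| ≤ R) :
    CubeSystem (Fin k) G μ where
  act g := (List.ofFn fun j => actionEnd T (P j) (g j)).prod
  act_mul g h x := by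
    have h1 := List.prod_ofFn_mul (fun j => actionEnd T (P j) (g j))
      (fun j => actionEnd T (P j) (h j)) fun i j hij => hT_comm _ _ (hP.ne hij) _ _
    have h2 : (List.ofFn fun j => actionEnd T (P j) ((g * h) j)) =
        List.ofFn fun j => actionEnd T (P j) (g j) * actionEnd T (P j) (h j) := by
      congr 1 with j : 1
      exact hT_hom _ _ _
    rw [h2, h1]
    rfl
  measurePreserving_act g := measurePreserving_prod_ofFn _ fun j => hT_mp _ _
  obs := f
  measurable_obs := hf
  bound := R
  one_le_bound := hR
  abs_obs_le := hfR

lemma cubeMapP_comp_perm (hT_comm : ∀ i j, i ≠ j → ∀ g h, T i g ∘ T j h = T j h ∘ T i g)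
    {P : Fin k → Fin d} (hP : Function.Injective P) (σ : Equiv.Perm (Fin k)) (g : Fin k → G)
    (ε : Fin k → Bool) :
    cubeMapP T (P ∘ σ) (fun j => g (σ j)) (fun j => ε (σ j)) = cubeMapP T P g ε := by
  refine List.prod_ofFn_comp_perm σ
    (fun j => if ε j then actionEnd T (P j) (g j) else 1) fun i j hij => ?_
  have h1 : Commute (actionEnd T (P i) (g i)) (actionEnd T (P j) (g j)) :=
    hT_comm _ _ (hP.ne hij) _ _
  split_ifs <;> simp [h1]

lemma cubeIntAvg_comp_perm [MeasurableSpace X] (μ : Measure X)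
    (hT_comm : ∀ i j, i ≠ j → ∀ g h, T i g ∘ T j h = T j h ∘ T i g)
    {P : Fin k → Fin d} (hP : Function.Injective P) (σ : Equiv.Perm (Fin k)) (Φ : ℕ → Finset G)
    (f : (Fin k → Bool) → X → ℝ) (N : Fin k → ℕ) :
    cubeIntAvg μ T (P ∘ σ) Φ (fun ε => f (fun j => ε (σ.symm j))) N =
      cubeIntAvg μ T P Φ f (fun j => N (σ.symm j)) := by
  unfold cubeIntAvg
  congr 1
  · rw [Equiv.prod_comp σ.symm fun j => ((Φ (N j)).card : ℝ)]
  · refine Finset.sum_equiv (σ.arrowCongr (Equiv.refl G)) (fun g => ?_) fun g _ => ?_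
    · simp only [Fintype.mem_piFinset, Equiv.arrowCongr_apply, Function.comp_apply,
        Equiv.refl_apply]
      exact (σ.symm.forall_congr_right (q := fun j => g j ∈ Φ (N j))).symm
    · refine integral_congr_ae (ae_of_all _ fun x => ?_)
      refine Fintype.prod_equiv (σ.arrowCongr (Equiv.refl Bool)) _ _ fun ε => ?_
      have h1 := cubeMapP_comp_perm hT_comm hP σ (σ.arrowCongr (Equiv.refl G) g)
        (σ.arrowCongr (Equiv.refl Bool) ε)
      simp only [Equiv.arrowCongr_apply, Equiv.coe_refl, Function.comp_apply,
        Equiv.symm_apply_apply, id] at h1 ⊢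
      rw [← h1]
      rfl

end Actions

/-- The iterated limit defining the cube joining integral exists, and it is
invariant under simultaneously permuting the tuple of indices `(i₁, …, i_k)` and letting the
permutation act on the cube `{0,1}ᵏ` by permuting coordinates. -/
theorem iterated_cube_limit_exists_and_perm_invariant
    {G X : Type*} [Group G] [Countable G] [DecidableEq G]
    [MeasurableSpace X] (μ : MeasureTheory.Measure X) [MeasureTheory.IsProbabilityMeasure μ]
    (d : ℕ) (T : Fin d → G → X → X)
    (hT_mp : ∀ i g, MeasureTheory.MeasurePreserving (T i g) μ μ)
    (hT_bij : ∀ i g, Function.Bijective (T i g))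
    (hT_hom : ∀ i g h, T i (g * h) = T i g ∘ T i h)
    (hT_comm : ∀ i j, i ≠ j → ∀ g h, T i g ∘ T j h = T j h ∘ T i g)
    (Φ : ℕ → Finset G) (hΦ : IsTwoSidedFolner Φ)
    (k : ℕ) (P : Fin k → Fin d) (hP : Function.Injective P)
    (f : (Fin k → Bool) → X → ℝ)
    (hf_meas : ∀ ε, Measurable (f ε))
    (hf_bdd : ∀ ε, ∃ C, ∀ x, |f ε x| ≤ C) :
    (∃ I : ℝ, IterLimExists (cubeIntAvg μ T P Φ f) I) ∧
    ∀ (σ : Equiv.Perm (Fin k)) (I I' : ℝ),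
      IterLimExists (cubeIntAvg μ T P Φ f) I →
      IterLimExists
        (cubeIntAvg μ T (P ∘ σ) Φ (fun ε => f (fun j => ε (σ.symm j)))) I' →
      I' = I := by
  let _ : MeasurableSpace G := ⊤
  have : MeasurableSingletonClass G := ⟨fun _ => trivial⟩
  choose R hR using hf_bdd
  set D := cubeSystemOfActions hT_mp hT_hom hT_comm P hP f hf_meas
    (R := 1 + ∑ ε, |R ε|) (le_add_of_nonneg_right (by positivity)) fun ε x => by
      have h1 := Finset.single_le_sum (f := fun ε => |R ε|) (fun _ _ => abs_nonneg _)
        (Finset.mem_univ ε)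
      have h2 := le_abs_self (R ε)
      have h3 := hR ε x
      linarith
  have hform : ∀ g, D.basedForm g = ∫ x, ∏ ε : Fin k → Bool, f ε (cubeMapP T P g ε x) ∂μ :=
    fun g => by
      simp only [cubeMapP_eq_prod_ite hT_bij hT_hom]
      rfl
  have hlim : ∀ (J : Finset (Fin k)) (M : Fin k → ℕ),
      ∃ ℓ, Tendsto (fun N => cubeIntAvg μ T P Φ f (J.piecewise N M)) atTop (𝓝 ℓ) := fun J M => by
    have h1 := D.exists_tendsto_folner hΦ J M
    simp only [hform] at h1
    exact h1
  refine ⟨exists_iterLimExists _ hlim, fun σ I I' hI hI' => ?_⟩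
  obtain ⟨ℓ, hℓ⟩ := hlim Finset.univ 0
  simp only [Finset.piecewise_univ] at hℓ
  rw [hI.eq_of_tendsto hℓ]
  refine hI'.eq_of_tendsto ?_
  have hσ : Tendsto (fun (N : Fin k → ℕ) j => N (σ.symm j)) atTop atTop :=
    tendsto_atTop.2 fun M => (eventually_ge_atTop fun j => M (σ j)).mono fun N hN j => by
      simpa using hN (σ.symm j)
  exact (hℓ.comp hσ).congr fun N => (cubeIntAvg_comp_perm μ hT_comm hP σ Φ f N).symm
end

section
/- Let G be a countable amenable group, let (X, 𝒳, μ) be a probability space, and let T⁽¹⁾, …, T⁽ᵈ⁾ be pairwise commuting measure-preserving actions of G on X. Fix a two-sided Følner sequence Φ in G and let η = {i₁, …, i_k} ⊆ {1, …, d}. For real-valued functions f_ε ∈ L^∞(μ), ε ∈ {0,1}ᵏ, each bounded by 1 in absolute value, one has lim_{N₁→∞} ⋯ lim_{N_k→∞} (1/(|Φ_{N₁}| ⋯ |Φ_{N_k}|)) Σ_{g₁ ∈ Φ_{N₁}} ⋯ Σ_{g_k ∈ Φ_{N_k}} ∫ ∏_{ε ∈ {0,1}ᵏ} f_ε ∘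 ∏_{j=1}^k (T^{(i_j)}_{g_j})^{ε_j} dμ ≤ min_{ε ∈ {0,1}ᵏ} |||f_ε|||_η, where |||f|||_η denotes the 2ᵏ-th root of the corresponding iterated limit with all functions equal to f. -/
open MeasureTheory Filter Topology

/-- The algebra of bounded measurable real-valued functions. -/
def BoundedMeas (X : Type*) [MeasurableSpace X] : Subalgebra ℝ (X → ℝ) where
  carrier := {f | Measurable f ∧ ∃ C, ∀ x, |f x| ≤ C}
  mul_mem' := by
    rintro f g ⟨hf, C, hC⟩ ⟨hg, D, hD⟩
    refine ⟨hf.mul hg, C * D, fun x => ?_⟩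
    rw [Pi.mul_apply, abs_mul]
    exact mul_le_mul (hC x) (hD x) (abs_nonneg _) ((abs_nonneg _).trans (hC x))
  add_mem' := by
    rintro f g ⟨hf, C, hC⟩ ⟨hg, D, hD⟩
    exact ⟨hf.add hg, C + D, fun x => (abs_add_le _ _).trans (add_le_add (hC x) (hD x))⟩
  algebraMap_mem' r := ⟨measurable_const, |r|, fun _ => le_rfl⟩

namespace BoundedMeas

variable {X Y : Type*} [MeasurableSpace X] [MeasurableSpace Y]

/-- Composition of a bounded measurable function with a measurable map. -/
def compMap (f : BoundedMeas Y) (φ : {φ : X → Y // Measurable φ}) : BoundedMeas X :=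
  ⟨fun x => f.1 (φ.1 x), f.2.1.comp φ.2, f.2.2.imp fun _ h _ => h _⟩

/-- The function `(x, y) ↦ a x * b y`. -/
def tensor (a : BoundedMeas X) (b : BoundedMeas Y) : BoundedMeas (X × Y) :=
  compMap a ⟨Prod.fst, measurable_fst⟩ * compMap b ⟨Prod.snd, measurable_snd⟩

end BoundedMeas

/-- A mean on a measurable space: a normalized positive linear functional on bounded measurable
functions. -/
structure FinAddMean (X : Type*) [MeasurableSpace X] where
  /-- The underlying linear functional. -/
  toFun : BoundedMeas X →ₗ[ℝ] ℝ
  nonneg' : ∀ f : BoundedMeas X, (∀ x, 0 ≤ f.1 x) → 0 ≤ toFun f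
  one' : toFun 1 = 1

open BoundedMeas

namespace FinAddMean

variable {X Y G : Type*} [MeasurableSpace X] [MeasurableSpace Y] [MeasurableSpace G]

instance : CoeFun (FinAddMean X) fun _ => BoundedMeas X → ℝ := ⟨fun Λ => Λ.toFun⟩

theorem mono (Λ : FinAddMean X) {f g : BoundedMeas X} (h : ∀ x, f.1 x ≤ g.1 x) : Λ f ≤ Λ g := by
  have := Λ.nonneg' (g - f) fun x => sub_nonneg.2 (h x)
  rw [map_sub] at this
  linarith

theorem apply_smul_one (Λ : FinAddMean X) (c : ℝ) : Λ (c • 1) = c := by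
  rw [map_smul, Λ.one', smul_eq_mul, mul_one]

theorem le_of_forall_le (Λ : FinAddMean X) {f : BoundedMeas X} {C : ℝ} (h : ∀ x, f.1 x ≤ C) :
    Λ f ≤ C := by
  rw [← Λ.apply_smul_one C]
  exact Λ.mono fun x => by simpa using h x

theorem le_of_forall_ge (Λ : FinAddMean X) {f : BoundedMeas X} {C : ℝ} (h : ∀ x, C ≤ f.1 x) :
    C ≤ Λ f := by
  rw [← Λ.apply_smul_one C]
  exact Λ.mono fun x => by simpa using h x

theorem abs_le (Λ : FinAddMean X) {f : BoundedMeas X} {C : ℝ} (h : ∀ x, |f.1 x| ≤ C) :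
    |Λ f| ≤ C :=
  _root_.abs_le.2 ⟨Λ.le_of_forall_ge fun x => (_root_.abs_le.1 (h x)).1,
    Λ.le_of_forall_le fun x => (_root_.abs_le.1 (h x)).2⟩

/-- The Cauchy-Schwarz inequality for means, in pointwise form. -/
theorem sq_le_mul (Λ : FinAddMean X) {u v w : BoundedMeas X} (hv : ∀ x, 0 ≤ v.1 x)
    (hw : ∀ x, 0 ≤ w.1 x) (h : ∀ x, u.1 x ^ 2 ≤ v.1 x * w.1 x) : Λ u ^ 2 ≤ Λ v * Λ w := by
  have key : ∀ s : ℝ, 0 ≤ Λ v * (s * s) + (2 * Λ u) * s + Λ w := by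
    intro s
    have := Λ.nonneg' ((s * s) • v + (2 * s) • u + w) (fun x => ?_)
    · simp only [map_add, map_smul, smul_eq_mul] at this
      linarith
    · change 0 ≤ s * s * v.1 x + 2 * s * u.1 x + w.1 x
      rcases (hv x).eq_or_lt with h0 | h0
      · have hx := h x
        rw [← h0, zero_mul] at hx
        have : u.1 x = 0 := by nlinarith
        rw [← h0, this]
        simpa using hw x
      · refine nonneg_of_mul_nonneg_right (a := v.1 x) ?_ h0
        nlinarith [h x, sq_nonneg (s * v.1 x + u.1 x)]
  have := discrim_le_zero key
  rw [discrim] at this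
  nlinarith

/-- The push-forward of a mean under a measurable map. -/
def map (Λ : FinAddMean X) (φ : {φ : X → Y // Measurable φ}) : FinAddMean Y where
  toFun :=
    { toFun := fun f => Λ (compMap f φ)
      map_add' := fun f g => Λ.toFun.map_add (compMap f φ) (compMap g φ)
      map_smul' := fun c f => Λ.toFun.map_smul c (compMap f φ) }
  nonneg' _ hf := Λ.nonneg' _ fun _ => hf _
  one' := Λ.one'

variable [DiscreteMeasurableSpace G]

/-- Evaluating a family of means at a bounded function, as a bounded function of the index. -/
def evalFamily (κ : G → FinAddMean X) (f : BoundedMeas X) : BoundedMeas G :=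
  ⟨fun g => κ g f, .of_discrete, f.2.2.imp fun _ h _ => (κ _).abs_le h⟩

/-- Averaging a family of means against a mean on the index set. -/
def bind (m : FinAddMean G) (κ : G → FinAddMean X) : FinAddMean X where
  toFun :=
    { toFun := fun f => m (evalFamily κ f)
      map_add' := fun f g => by
        rw [← map_add]
        congr 1
        exact Subtype.ext (funext fun x => (κ x).toFun.map_add f g)
      map_smul' := fun c f => by
        rw [RingHom.id_apply, ← map_smul]
        congr 1
        exact Subtype.ext (funext fun x => (κ x).toFun.map_smul c f) }
  nonneg' f hf := m.nonneg' _ fun x => (κ x).nonneg' f hf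
  one' := by
    rw [← m.one']
    exact congrArg m.toFun (Subtype.ext (funext fun x => (κ x).one'))

/-- The coupling of `Λ` with itself obtained by averaging the graphs of the maps `T g`. -/
def square (m : FinAddMean G) (Λ : FinAddMean X) (T : G → {φ : X → X // Measurable φ}) :
    FinAddMean (X × X) :=
  m.bind fun g => Λ.map ⟨fun x => (x, (T g).1 x), measurable_id.prodMk (T g).2⟩

/-- Left and right translation invariance of a mean on a group. -/
structure IsBiinvariant [Group G] (m : FinAddMean G) : Prop where
  left : ∀ (u : BoundedMeas G) (h : G), m (compMap u ⟨fun g => h * g, .of_discrete⟩) = m u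
  right : ∀ (u : BoundedMeas G) (h : G), m (compMap u ⟨fun g => g * h, .of_discrete⟩) = m u

end FinAddMean

section SquareCauchySchwarz

open FinAddMean

variable {X G : Type*} [MeasurableSpace X]

/-- `tensor` as a bilinear map. -/
def tensorBilin (X : Type*) [MeasurableSpace X] :
    BoundedMeas X →ₗ[ℝ] BoundedMeas X →ₗ[ℝ] BoundedMeas (X × X) :=
  LinearMap.mk₂ ℝ tensor
    (fun _ _ _ => Subtype.ext (funext fun _ => add_mul _ _ _))
    (fun _ _ _ => Subtype.ext (funext fun _ => mul_assoc _ _ _))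
    (fun _ _ _ => Subtype.ext (funext fun _ => mul_add _ _ _))
    (fun c a b => Subtype.ext (funext fun x => mul_left_comm (a.1 x.1) c (b.1 x.2)))

variable (Λ : FinAddMean X) (T : G → {φ : X → X // Measurable φ})

/-- The convex hull of the orbit of `a` under the maps `T g`. -/
def orbitHull (a : BoundedMeas X) : Set (BoundedMeas X) :=
  convexHull ℝ (Set.range fun g => compMap a (T g))

/-- The least value of `Λ (a' * a')` over the convex hull of the orbit of `a`. -/
noncomputable def hullInf (a : BoundedMeas X) : ℝ :=
  sInf ((fun a' => Λ (a' * a')) '' orbitHull T a)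

theorem orbitHull_nonempty [Nonempty G] (a : BoundedMeas X) : (orbitHull T a).Nonempty :=
  (Set.range_nonempty _).convexHull

theorem hullInf_nonneg (a : BoundedMeas X) : 0 ≤ hullInf Λ T a :=
  Real.sInf_nonneg (by rintro _ ⟨a', -, rfl⟩; exact Λ.nonneg' _ fun x => mul_self_nonneg _)

theorem hullInf_le {a a' : BoundedMeas X} (ha : a' ∈ orbitHull T a) :
    hullInf Λ T a ≤ Λ (a' * a') :=
  csInf_le ⟨0, by rintro _ ⟨a', -, rfl⟩; exact Λ.nonneg' _ fun x => mul_self_nonneg _⟩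
    ⟨a', ha, rfl⟩

theorem le_hullInf [Nonempty G] {a : BoundedMeas X} {c : ℝ} (h : ∀ a' ∈ orbitHull T a, c ≤ Λ (a' * a')) :
    c ≤ hullInf Λ T a :=
  le_csInf ((orbitHull_nonempty T a).image _) (by rintro _ ⟨a', ha, rfl⟩; exact h a' ha)

variable [MeasurableSpace G] [DiscreteMeasurableSpace G] (m : FinAddMean G)

theorem square_tensor_sq_le (a b : BoundedMeas X)
    (hinv : ∀ g f, Λ (compMap f (T g)) = Λ f) :
    m.square Λ T (tensor a b) ^ 2 ≤ Λ (a * a) * Λ (b * b) := by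
  have hx : ∀ g, Λ (a * compMap b (T g)) ^ 2 ≤ Λ (a * a) * Λ (b * b) := by
    intro g
    rw [← hinv g (b * b)]
    refine Λ.sq_le_mul (fun x => mul_self_nonneg _) (fun x => mul_self_nonneg _) fun x => ?_
    change (a.1 x * b.1 _) ^ 2 ≤ a.1 x * a.1 x * (b.1 _ * b.1 _)
    exact le_of_eq (by ring)
  rw [← Real.sqrt_le_sqrt_iff (mul_nonneg (Λ.nonneg' _ fun x => mul_self_nonneg _)
    (Λ.nonneg' _ fun x => mul_self_nonneg _)), Real.sqrt_sq_eq_abs]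
  exact m.abs_le fun g => Real.abs_le_sqrt (hx g)

variable [Group G]

theorem square_tensor_left (hm : m.IsBiinvariant)
    (hT : ∀ g h x, (T (g * h)).1 x = (T g).1 ((T h).1 x))
    (hinv : ∀ g f, Λ (compMap f (T g)) = Λ f) {a a' : BoundedMeas X}
    (ha : a' ∈ orbitHull T a) (b : BoundedMeas X) :
    m.square Λ T (tensor a' b) = m.square Λ T (tensor a b) := by
  have hconv : Convex ℝ {a' | m.square Λ T (tensor a' b) = m.square Λ T (tensor a b)} :=
    convex_hyperplane (r := m.square Λ T (tensor a b)) (f := fun a' => m.square Λ T (tensor a' b))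
      (((m.square Λ T).toFun ∘ₗ (tensorBilin X).flip b).isLinear)
  refine convexHull_min ?_ hconv ha
  rintro _ ⟨h, rfl⟩
  rw [Set.mem_ofPred_eq]
  refine Eq.trans ?_ (hm.right (evalFamily _ (tensor a b)) h⁻¹)
  refine congrArg m.toFun (Subtype.ext (funext fun g => ?_))
  refine Eq.trans (congrArg Λ.toFun (Subtype.ext (funext fun x => ?_)))
    (hinv h (compMap (tensor a b) _))
  change a.1 ((T h).1 x) * b.1 ((T g).1 x) = a.1 ((T h).1 x) * b.1 ((T (g * h⁻¹)).1 ((T h).1 x))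
  rw [← hT, inv_mul_cancel_right]

theorem square_tensor_right (hm : m.IsBiinvariant)
    (hT : ∀ g h x, (T (g * h)).1 x = (T g).1 ((T h).1 x))
    (a : BoundedMeas X) {b b' : BoundedMeas X} (hb : b' ∈ orbitHull T b) :
    m.square Λ T (tensor a b') = m.square Λ T (tensor a b) := by
  have hconv : Convex ℝ {b' | m.square Λ T (tensor a b') = m.square Λ T (tensor a b)} :=
    convex_hyperplane (r := m.square Λ T (tensor a b)) (f := fun b' => m.square Λ T (tensor a b'))
      (((m.square Λ T).toFun ∘ₗ (tensorBilin X) a).isLinear)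
  refine convexHull_min ?_ hconv hb
  rintro _ ⟨h, rfl⟩
  rw [Set.mem_ofPred_eq]
  refine Eq.trans ?_ (hm.left (evalFamily _ (tensor a b)) h)
  refine congrArg m.toFun (Subtype.ext (funext fun g => ?_))
  refine congrArg Λ.toFun (Subtype.ext (funext fun x => ?_))
  change a.1 x * b.1 ((T h).1 ((T g).1 x)) = a.1 x * b.1 ((T (h * g)).1 x)
  rw [hT]

theorem hullInf_le_square (hm : m.IsBiinvariant)
    (hT : ∀ g h x, (T (g * h)).1 x = (T g).1 ((T h).1 x))
    (hinv : ∀ g f, Λ (compMap f (T g)) = Λ f) (a : BoundedMeas X) :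
    hullInf Λ T a ≤ m.square Λ T (tensor a a) := by
  set i := hullInf Λ T a
  set L := m.square Λ T (tensor a a) with hL
  set C := Λ (a * a)
  have h1 : ∀ t : ℝ, 0 < t → t < 1 → ∀ a' ∈ orbitHull T a,
      i ≤ (1 - t) ^ 2 * Λ (a' * a') + 2 * t * (1 - t) * L + t ^ 2 * C := by
    intro t ht ht1 a' ha'
    have hpos : 0 < 2 * t * (1 - t) := by have := sub_pos.2 ht1; positivity
    have h2 : (i - (1 - t) ^ 2 * Λ (a' * a') - t ^ 2 * C) / (2 * t * (1 - t)) ≤ L := by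
      rw [hL, ← square_tensor_left Λ T m hm hT hinv ha']
      refine m.le_of_forall_ge fun g => ?_
      rw [div_le_iff₀' hpos]
      have hc : compMap a (T g) ∈ orbitHull T a := subset_convexHull _ _ ⟨g, rfl⟩
      have hmem := convex_convexHull ℝ _ ha' hc (sub_nonneg.2 ht1.le) ht.le (sub_add_cancel 1 t)
      have hi := hullInf_le Λ T hmem
      have hcc : Λ (compMap a (T g) * compMap a (T g)) = C := hinv g (a * a)
      have hexp : ((1 - t) • a' + t • compMap a (T g)) * ((1 - t) • a' + t • compMap a (T g)) =
          ((1 - t) ^ 2) • (a' * a') + (2 * t * (1 - t)) • (a' * compMap a (T g)) +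
            (t ^ 2) • (compMap a (T g) * compMap a (T g)) := by
        refine Subtype.ext (funext fun x => ?_)
        change ((1 - t) * a'.1 x + t * (compMap a (T g)).1 x) *
          ((1 - t) * a'.1 x + t * (compMap a (T g)).1 x) = (1 - t) ^ 2 * (a'.1 x * a'.1 x) +
          2 * t * (1 - t) * (a'.1 x * (compMap a (T g)).1 x) +
          t ^ 2 * ((compMap a (T g)).1 x * (compMap a (T g)).1 x)
        ring
      rw [hexp, map_add, map_add, map_smul, map_smul, map_smul, hcc, smul_eq_mul, smul_eq_mul,
        smul_eq_mul] at hi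
      change _ ≤ 2 * t * (1 - t) * Λ (a' * compMap a (T g))
      linarith
    rw [div_le_iff₀' hpos] at h2
    linarith
  have h2 : ∀ t : ℝ, 0 < t → t < 1 → (2 - t) * i ≤ 2 * (1 - t) * L + t * C := by
    intro t ht ht1
    have hpos : 0 < (1 - t) ^ 2 := pow_pos (sub_pos.2 ht1) 2
    have h3 : (i - 2 * t * (1 - t) * L - t ^ 2 * C) / (1 - t) ^ 2 ≤ i := by
      refine le_hullInf Λ T fun a' ha' => ?_
      rw [div_le_iff₀' hpos]
      linarith [h1 t ht ht1 a' ha']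
    rw [div_le_iff₀' hpos] at h3
    refine le_of_mul_le_mul_left ?_ ht
    nlinarith
  by_contra! hlt
  obtain ⟨t, ht, ht1, hlt'⟩ : ∃ t : ℝ, 0 < t ∧ t < 1 ∧ t * (C - 2 * L + i) < 2 * (i - L) := by
    refine ⟨min (1 / 2) ((i - L) / (1 + |C - 2 * L + i|)), ?_, ?_, ?_⟩
    · have := sub_pos.2 hlt
      positivity
    · exact (min_le_left _ _).trans_lt (by norm_num)
    · set D := C - 2 * L + i
      have hd : 0 < 1 + |D| := by positivity
      have hmin : min (1 / 2) ((i - L) / (1 + |D|)) * (1 + |D|) ≤ i - L :=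
        (le_div_iff₀ hd).1 (min_le_right _ _)
      have hpos : 0 < min (1 / 2) ((i - L) / (1 + |D|)) := by
        have := sub_pos.2 hlt
        positivity
      nlinarith [le_abs_self D]
  nlinarith [h2 t ht ht1]

/-- The Cauchy-Schwarz inequality for the relative square of a mean along an action. -/
theorem square_tensor_sq_le_mul (hm : m.IsBiinvariant)
    (hT : ∀ g h x, (T (g * h)).1 x = (T g).1 ((T h).1 x))
    (hinv : ∀ g f, Λ (compMap f (T g)) = Λ f) (a b : BoundedMeas X) :
    m.square Λ T (tensor a b) ^ 2 ≤
      m.square Λ T (tensor a a) * m.square Λ T (tensor b b) := by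
  have h : ∀ a' ∈ orbitHull T a, ∀ b' ∈ orbitHull T b,
      m.square Λ T (tensor a b) ^ 2 ≤ Λ (a' * a') * Λ (b' * b') := fun a' ha b' hb => by
    rw [← square_tensor_left Λ T m hm hT hinv ha, ← square_tensor_right Λ T m hm hT _ hb]
    exact square_tensor_sq_le Λ T m a' b' hinv
  set q := m.square Λ T (tensor a b) ^ 2
  have h1 : ∀ a' ∈ orbitHull T a, q ≤ Λ (a' * a') * hullInf Λ T b := fun a' ha => by
    have h0 : 0 ≤ Λ (a' * a') := Λ.nonneg' _ fun x => mul_self_nonneg _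
    rcases h0.eq_or_lt with h0 | h0
    · obtain ⟨b', hb⟩ := orbitHull_nonempty T b
      simpa [← h0] using h a' ha b' hb
    · rw [← div_le_iff₀' h0]
      exact le_hullInf Λ T fun b' hb => (div_le_iff₀' h0).2 (h a' ha b' hb)
  have h2 : q ≤ hullInf Λ T a * hullInf Λ T b := by
    rcases (hullInf_nonneg Λ T b).eq_or_lt with h0 | h0
    · obtain ⟨a', ha⟩ := orbitHull_nonempty T a
      simpa [← h0] using h1 a' ha
    · rw [← div_le_iff₀ h0]
      exact le_hullInf Λ T fun a' ha => (div_le_iff₀ h0).2 (h1 a' ha)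
  exact h2.trans (mul_le_mul (hullInf_le_square Λ T m hm hT hinv a)
    (hullInf_le_square Λ T m hm hT hinv b) (hullInf_nonneg Λ T b)
    ((hullInf_nonneg Λ T a).trans (hullInf_le_square Λ T m hm hT hinv a)))

end SquareCauchySchwarz
section CubeFunctionals

open FinAddMean

theorem cubeMapP_snoc {G X : Type*} {d k : ℕ} (T : Fin d → G → X → X) (P : Fin (k + 1) → Fin d)
    (g : Fin k → G) (h : G) (ε : Fin k → Bool) (b : Bool) (x : X) :
    cubeMapP T P (Fin.snoc g h : Fin (k + 1) → G) (Fin.snoc ε b : Fin (k + 1) → Bool) x =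
      cubeMapP T (fun j => P j.castSucc) g ε ((if b then T (P (Fin.last k)) h else id) x) := by
  have aux : ∀ (L : List (X → X)) (φ : X → X) (y : X),
      L.foldr (· ∘ ·) φ y = L.foldr (· ∘ ·) id (φ y) := by
    intro L φ y
    induction L with
    | nil => rfl
    | cons a L ih => simp only [List.foldr_cons, Function.comp_apply, ih]
  simp only [cubeMapP, List.ofFn_succ', List.concat_eq_append, List.foldr_append, Fin.snoc_castSucc,
    Fin.snoc_last, List.foldr_cons, List.foldr_nil, Function.comp_id]
  exact aux _ _ _

theorem exists_snoc_eq {α : Type*} {k : ℕ} (e : Fin (k + 1) → α) :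
    ∃ (e' : Fin k → α) (a : α), e = Fin.snoc e' a :=
  ⟨Fin.init e, e (Fin.last k), (Fin.snoc_init_self e).symm⟩

theorem prod_bool_snoc {M : Type*} [CommMonoid M] {k : ℕ} (F : (Fin (k + 1) → Bool) → M) :
    ∏ ε, F ε = ∏ ε : Fin k → Bool, F (Fin.snoc ε false) * F (Fin.snoc ε true) := by
  rw [← (Fin.snocEquiv fun _ => Bool).prod_comp, Fintype.prod_prod_type, Fintype.prod_bool, mul_comm,
    Finset.prod_mul_distrib]
  rfl

variable {G X : Type*} [MeasurableSpace X] {d k : ℕ}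

theorem measurable_cubeMapP (T : Fin d → G → {φ : X → X // Measurable φ}) (P : Fin k → Fin d)
    (g : Fin k → G) (ε : Fin k → Bool) : Measurable (cubeMapP (fun i h => (T i h).1) P g ε) := by
  induction k with
  | zero => exact measurable_id
  | succ k ih =>
    obtain ⟨g, h, rfl⟩ := exists_snoc_eq g
    obtain ⟨ε, b, rfl⟩ := exists_snoc_eq ε
    simp only [funext (cubeMapP_snoc (fun i h => (T i h).1) P g h ε b)]
    refine (ih _ g ε).comp ?_
    cases b
    · exact measurable_id
    · exact (T _ h).2

/-- The diagonal action on the square. -/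
def diagMap (T : Fin d → G → {φ : X → X // Measurable φ}) (i : Fin d) (g : G) :
    {φ : X × X → X × X // Measurable φ} :=
  ⟨Prod.map (T i g).1 (T i g).1, (T i g).2.prodMap (T i g).2⟩

theorem cubeMapP_diagMap (T : Fin d → G → {φ : X → X // Measurable φ}) (P : Fin k → Fin d)
    (g : Fin k → G) (ε : Fin k → Bool) (p : X × X) :
    cubeMapP (fun i h => (diagMap T i h).1) P g ε p =
      (cubeMapP (fun i h => (T i h).1) P g ε p.1, cubeMapP (fun i h => (T i h).1) P g ε p.2) := by
  induction k generalizing p with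
  | zero => rfl
  | succ k ih =>
    obtain ⟨g, h, rfl⟩ := exists_snoc_eq g
    obtain ⟨ε, b, rfl⟩ := exists_snoc_eq ε
    simp only [cubeMapP_snoc, ih]
    cases b <;> rfl

/-- The function `x ↦ ∏ ε, f ε (T^ε x)`. -/
def cubeProd (T : Fin d → G → {φ : X → X // Measurable φ}) (P : Fin k → Fin d)
    (f : (Fin k → Bool) → BoundedMeas X) (g : Fin k → G) : BoundedMeas X :=
  ∏ ε, compMap (f ε) ⟨cubeMapP (fun i h => (T i h).1) P g ε, measurable_cubeMapP T P g ε⟩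

theorem cubeProd_apply (T : Fin d → G → {φ : X → X // Measurable φ}) (P : Fin k → Fin d)
    (f : (Fin k → Bool) → BoundedMeas X) (g : Fin k → G) (x : X) :
    (cubeProd T P f g).1 x = ∏ ε, (f ε).1 (cubeMapP (fun i h => (T i h).1) P g ε x) := by
  rw [cubeProd]
  change (((BoundedMeas X).subtype _ : X → ℝ)) x = _
  rw [map_prod, Finset.prod_apply]
  rfl

theorem cubeProd_diagMap_tensor (T : Fin d → G → {φ : X → X // Measurable φ}) (P : Fin k → Fin d)
    (a b : (Fin k → Bool) → BoundedMeas X) (g : Fin k → G) :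
    cubeProd (diagMap T) P (fun ε => tensor (a ε) (b ε)) g =
      tensor (cubeProd T P a g) (cubeProd T P b g) := by
  refine Subtype.ext (funext fun p => ?_)
  change _ = (cubeProd T P a g).1 p.1 * (cubeProd T P b g).1 p.2
  simp only [cubeProd_apply, cubeMapP_diagMap, ← Finset.prod_mul_distrib]
  rfl

theorem exists_abs_cubeProd_le (T : Fin d → G → {φ : X → X // Measurable φ}) (P : Fin k → Fin d)
    (f : (Fin k → Bool) → BoundedMeas X) : ∃ C, ∀ g x, |(cubeProd T P f g).1 x| ≤ C := by
  choose C hC using fun ε => (f ε).2.2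
  refine ⟨∏ ε, C ε, fun g x => ?_⟩
  rw [cubeProd_apply, Finset.abs_prod]
  exact Finset.prod_le_prod (fun _ _ => abs_nonneg _) fun ε _ => hC ε _

variable [MeasurableSpace G] [DiscreteMeasurableSpace G] [Countable G]

/-- The `k`-fold iterate of a mean, with the last coordinate averaged first. -/
def FinAddMean.iterate (m : FinAddMean G) : (k : ℕ) → FinAddMean (Fin k → G)
  | 0 =>
    { toFun :=
        { toFun := fun f => f.1 fun i => i.elim0
          map_add' := fun _ _ => rfl
          map_smul' := fun _ _ => rfl }
      nonneg' := fun _ hf => hf _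
      one' := rfl }
  | k + 1 => (m.iterate k).bind fun g => m.map ⟨fun h => (Fin.snoc g h : Fin (k + 1) → G), .of_discrete⟩

/-- The function `g ↦ Λ (∏ ε, f ε ∘ T^ε)`. -/
def cubeFun (Λ : FinAddMean X) (T : Fin d → G → {φ : X → X // Measurable φ}) (P : Fin k → Fin d)
    (f : (Fin k → Bool) → BoundedMeas X) : BoundedMeas (Fin k → G) :=
  ⟨fun g => Λ (cubeProd T P f g), .of_discrete,
    (exists_abs_cubeProd_le T P f).imp fun _ h g => Λ.abs_le (h g)⟩

theorem iterate_cubeFun_succ (m : FinAddMean G) (Λ : FinAddMean X)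
    (T : Fin d → G → {φ : X → X // Measurable φ}) (P : Fin (k + 1) → Fin d)
    (f : (Fin (k + 1) → Bool) → BoundedMeas X) :
    m.iterate (k + 1) (cubeFun Λ T P f) =
      m.iterate k (cubeFun (m.square Λ (T (P (Fin.last k)))) (diagMap T) (fun j => P j.castSucc)
        fun ε => tensor (f (Fin.snoc ε false)) (f (Fin.snoc ε true))) := by
  refine congrArg (m.iterate k).toFun (Subtype.ext (funext fun g => ?_))
  refine congrArg m.toFun (Subtype.ext (funext fun h => ?_))
  refine congrArg Λ.toFun (Subtype.ext (funext fun x => ?_))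
  change (cubeProd T P f _).1 x = (cubeProd _ _ _ g).1 (x, _)
  rw [cubeProd_apply, cubeProd_apply, prod_bool_snoc]
  refine Finset.prod_congr rfl fun ε _ => ?_
  rw [cubeMapP_diagMap]
  simp only [cubeMapP_snoc]
  rfl

/-- The Cauchy-Schwarz-Gowers inequality for iterated means. -/
theorem abs_iterate_cubeFun_pow_le {G : Type*} [Group G] [MeasurableSpace G]
    [DiscreteMeasurableSpace G] [Countable G] {m : FinAddMean G} (hm : m.IsBiinvariant)
    {X : Type*} [MeasurableSpace X] (Λ : FinAddMean X) {d k : ℕ}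
    (T : Fin d → G → {φ : X → X // Measurable φ})
    (hhom : ∀ i g h x, (T i (g * h)).1 x = (T i g).1 ((T i h).1 x))
    (hcomm : ∀ i j, i ≠ j → ∀ g h x, (T i g).1 ((T j h).1 x) = (T j h).1 ((T i g).1 x))
    (P : Fin k → Fin d) (hP : Function.Injective P)
    (hinv : ∀ j g f, Λ (compMap f (T (P j) g)) = Λ f)
    (f : (Fin k → Bool) → BoundedMeas X) :
    |m.iterate k (cubeFun Λ T P f)| ^ 2 ^ k ≤
      ∏ ε, |m.iterate k (cubeFun Λ T P fun _ => f ε)| := by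
  induction k generalizing X with
  | zero =>
    rw [Fintype.prod_unique, pow_zero, pow_one]
    refine le_of_eq ?_
    congr 4
    exact funext fun ε => congrArg f (Subsingleton.elim _ _)
  | succ k ih =>
    have hcs : ∀ a b : BoundedMeas X,
        |m.iterate k (cubeFun (m.square Λ (T (P (Fin.last k)))) (diagMap T)
          (fun j => P j.castSucc) fun _ => tensor a b)| ^ 2 ≤
        |m.iterate (k + 1) (cubeFun Λ T P fun _ => a)| *
          |m.iterate (k + 1) (cubeFun Λ T P fun _ => b)| := by
      intro a b
      have hsq := fun a b => square_tensor_sq_le_mul Λ (T (P (Fin.last k))) m hm (hhom _)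
        (hinv _) a b
      have hnonneg : ∀ (a : BoundedMeas X) (g : Fin k → G), 0 ≤ (cubeFun
          (m.square Λ (T (P (Fin.last k)))) (diagMap T) (fun j => P j.castSucc)
          fun _ => tensor a a).1 g := by
        intro a g
        change 0 ≤ m.square Λ _ (cubeProd _ _ _ _)
        rw [cubeProd_diagMap_tensor]
        exact (hullInf_nonneg Λ (T (P (Fin.last k))) _).trans
          (hullInf_le_square Λ _ m hm (hhom _) (hinv _) _)
      rw [sq_abs, iterate_cubeFun_succ, iterate_cubeFun_succ, ← abs_mul]
      refine le_trans ?_ (le_abs_self _)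
      refine (m.iterate k).sq_le_mul (hnonneg a) (hnonneg b) fun g => ?_
      change m.square Λ _ (cubeProd _ _ _ _) ^ 2 ≤
        m.square Λ _ (cubeProd _ _ _ _) * m.square Λ _ (cubeProd _ _ _ _)
      rw [cubeProd_diagMap_tensor, cubeProd_diagMap_tensor, cubeProd_diagMap_tensor]
      exact hsq _ _
    have hstep := ih (m.square Λ (T (P (Fin.last k)))) (diagMap T)
      (fun i g h p => Prod.ext (hhom i g h p.1) (hhom i g h p.2))
      (fun i j hij g h p => Prod.ext (hcomm i j hij g h p.1) (hcomm i j hij g h p.2))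
      (fun j => P j.castSucc) (hP.comp (Fin.castSucc_injective k))
      (fun j g F => by
        refine congrArg m.toFun (Subtype.ext (funext fun h => ?_))
        refine Eq.trans (congrArg Λ.toFun (Subtype.ext (funext fun x => ?_)))
          (hinv j.castSucc g (compMap F ⟨fun x => (x, (T (P (Fin.last k)) h).1 x), _⟩))
        refine congrArg F.1 (Prod.ext rfl ?_)
        exact hcomm _ _ (hP.ne (Fin.castSucc_lt_last j).ne) g h x)
      fun ε => tensor (f (Fin.snoc ε false)) (f (Fin.snoc ε true))
    rw [iterate_cubeFun_succ, pow_succ 2, pow_mul, prod_bool_snoc]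
    refine (pow_le_pow_left₀ (by positivity) hstep 2).trans ?_
    rw [← Finset.prod_pow]
    exact Finset.prod_le_prod (fun _ _ => by positivity) fun ε _ => hcs _ _

end CubeFunctionals

section FolnerMean

open FinAddMean

theorem abs_sum_comp_sub_sum_le {G : Type*} [DecidableEq G] (S : Finset G) {σ : G → G}
    (hσ : Function.Injective σ) {u : G → ℝ} {C : ℝ} (hu : ∀ g, |u g| ≤ C) :
    |∑ g ∈ S, u (σ g) - ∑ g ∈ S, u g| ≤ 2 * C * (S.card - (S ∩ S.image σ).card) := by
  have hcard : (S.image σ).card = S.card := Finset.card_image_of_injective S hσ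
  have hbound : ∀ A : Finset G, |∑ g ∈ A, u g| ≤ A.card * C := fun A =>
    (Finset.abs_sum_le_sum_abs _ _).trans
      ((Finset.sum_le_card_nsmul _ _ _ fun g _ => hu g).trans_eq (nsmul_eq_mul _ _))
  have h1 := Finset.sum_inter_add_sum_sdiff S (S.image σ) u
  have h2 := Finset.sum_inter_add_sum_sdiff (S.image σ) S u
  have c1 := Finset.card_inter_add_card_sdiff S (S.image σ)
  have c2 := Finset.card_inter_add_card_sdiff (S.image σ) S
  rw [Finset.inter_comm] at h2 c2
  rw [hcard] at c2
  have c1' : ((S ∩ S.image σ).card : ℝ) + (S \ S.image σ).card = S.card := by exact_mod_cast c1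
  have c2' : ((S ∩ S.image σ).card : ℝ) + (S.image σ \ S).card = S.card := by exact_mod_cast c2
  rw [← Finset.sum_image (f := u) hσ.injOn, ← h1, ← h2, add_sub_add_left_eq_sub]
  refine (abs_sub _ _).trans ((add_le_add (hbound _) (hbound _)).trans_eq ?_)
  rw [eq_sub_of_add_eq' c1', eq_sub_of_add_eq' c2']
  ring

variable {G : Type*} [MeasurableSpace G]

theorem exists_mean_tendsto (Φ : ℕ → Finset G) (hΦ : ∀ N, (Φ N).Nonempty) :
    ∃ m : FinAddMean G, ∀ u : BoundedMeas G,
      Tendsto (fun N => ((Φ N).card : ℝ)⁻¹ * ∑ g ∈ Φ N, u.1 g) (hyperfilter ℕ) (𝓝 (m u)) := by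
  have hc : ∀ N, (0 : ℝ) < (Φ N).card := fun N => by exact_mod_cast (hΦ N).card_pos
  have hex : ∀ u : BoundedMeas G, ∃ l : ℝ,
      Tendsto (fun N => ((Φ N).card : ℝ)⁻¹ * ∑ g ∈ Φ N, u.1 g) (hyperfilter ℕ) (𝓝 l) := by
    intro u
    obtain ⟨C, hC⟩ := u.2.2
    obtain ⟨l, -, hl⟩ := (isCompact_Icc (a := -C) (b := C)).ultrafilter_le_nhds
      ((hyperfilter ℕ).map fun N => ((Φ N).card : ℝ)⁻¹ * ∑ g ∈ Φ N, u.1 g) (by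
        refine tendsto_principal.2 (Filter.Eventually.of_forall fun N => abs_le.1 ?_)
        rw [abs_mul, abs_of_pos (inv_pos.2 (hc N)), inv_mul_le_iff₀ (hc N)]
        exact (Finset.abs_sum_le_sum_abs _ _).trans
          ((Finset.sum_le_card_nsmul _ _ _ fun g _ => hC g).trans_eq (nsmul_eq_mul _ _)))
    exact ⟨l, hl⟩
  choose l hl using hex
  refine ⟨⟨⟨⟨l, fun u v => ?_⟩, fun c u => ?_⟩, fun u hu => ?_, ?_⟩, hl⟩
  · refine tendsto_nhds_unique (hl (u + v)) (((hl u).add (hl v)).congr fun N => ?_)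
    rw [← mul_add, ← Finset.sum_add_distrib]
    rfl
  · refine tendsto_nhds_unique (hl (c • u)) (((hl u).const_mul c).congr fun N => ?_)
    rw [mul_left_comm, Finset.mul_sum]
    rfl
  · exact ge_of_tendsto' (hl u) fun N =>
      mul_nonneg (inv_nonneg.2 (hc N).le) (Finset.sum_nonneg fun g _ => hu g)
  · refine tendsto_nhds_unique (hl 1) (tendsto_const_nhds.congr fun N => ?_)
    change 1 = _ * ∑ g ∈ Φ N, (1 : ℝ)
    rw [Finset.sum_const, nsmul_one, inv_mul_cancel₀ (hc N).ne']

theorem mean_comp_eq_of_folner [DecidableEq G] {Φ : ℕ → Finset G} (hΦ : ∀ N, (Φ N).Nonempty)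
    {m : FinAddMean G} (hm : ∀ u : BoundedMeas G,
      Tendsto (fun N => ((Φ N).card : ℝ)⁻¹ * ∑ g ∈ Φ N, u.1 g) (hyperfilter ℕ) (𝓝 (m u)))
    (σ : {σ : G → G // Measurable σ}) (hσ : Function.Injective σ.1)
    (hlim : Tendsto (fun N => ((Φ N ∩ (Φ N).image σ.1).card : ℝ) / ((Φ N).card : ℝ))
      atTop (𝓝 1)) (u : BoundedMeas G) :
    m (compMap u σ) = m u := by
  obtain ⟨C, hC⟩ := u.2.2
  have h0 : Tendsto (fun N => 2 * C *
      (1 - ((Φ N ∩ (Φ N).image σ.1).card : ℝ) / ((Φ N).card : ℝ))) (hyperfilter ℕ) (𝓝 0) := by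
    simpa using ((hlim.mono_left Nat.hyperfilter_le_atTop).const_sub 1).const_mul (2 * C)
  refine sub_eq_zero.1 (tendsto_nhds_unique ((hm _).sub (hm u)) (squeeze_zero_norm (fun N => ?_) h0))
  have hc : (0 : ℝ) < (Φ N).card := by exact_mod_cast (hΦ N).card_pos
  rw [← mul_sub, Real.norm_eq_abs, abs_mul, abs_of_pos (inv_pos.2 hc), inv_mul_le_iff₀ hc]
  refine (abs_sum_comp_sub_sum_le (Φ N) hσ hC).trans_eq ?_
  field_simp

variable [DiscreteMeasurableSpace G]

theorem isBiinvariant_of_isTwoSidedFolner [Group G] [DecidableEq G] {Φ : ℕ → Finset G}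
    (hΦ : IsTwoSidedFolner Φ) {m : FinAddMean G} (hm : ∀ u : BoundedMeas G,
      Tendsto (fun N => ((Φ N).card : ℝ)⁻¹ * ∑ g ∈ Φ N, u.1 g) (hyperfilter ℕ) (𝓝 (m u))) :
    m.IsBiinvariant where
  left u h := mean_comp_eq_of_folner hΦ.1.1 hm ⟨fun g => h * g, .of_discrete⟩
    (mul_right_injective h) (hΦ.1.2 h) u
  right u h := mean_comp_eq_of_folner hΦ.1.1 hm ⟨fun g => g * h, .of_discrete⟩
    (mul_left_injective h) (hΦ.2.2 h) u

theorem sum_piFinset_snoc {α M : Type*} [AddCommMonoid M] {k : ℕ} (S : Fin (k + 1) → Finset α)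
    (F : (Fin (k + 1) → α) → M) :
    ∑ g ∈ Fintype.piFinset S, F g =
      ∑ g ∈ Fintype.piFinset fun j : Fin k => S j.castSucc, ∑ h ∈ S (Fin.last k),
        F (Fin.snoc g h) := by
  rw [← Finset.sum_product']
  refine Finset.sum_nbij' (fun g => (Fin.init g, g (Fin.last k))) (fun p => Fin.snoc p.1 p.2)
    ?_ ?_ ?_ ?_ ?_
  · intro g hg
    rw [Fintype.mem_piFinset] at hg
    exact Finset.mem_product.2 ⟨Fintype.mem_piFinset.2 fun j => hg _, hg _⟩
  · intro p hp
    rw [Finset.mem_product, Fintype.mem_piFinset] at hp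
    refine Fintype.mem_piFinset.2 fun j => ?_
    refine Fin.lastCases ?_ (fun j => ?_) j
    · simpa using hp.2
    · simpa using hp.1 j
  · intro g _
    exact Fin.snoc_init_self g
  · intro p _
    simp
  · intro g _
    simp

/-- An iterated limit of averages along `Φ` is the iterated mean. -/
theorem eq_iterate_of_iterLimExists [Countable G] {Φ : ℕ → Finset G} {m : FinAddMean G}
    (hm : ∀ u : BoundedMeas G,
      Tendsto (fun N => ((Φ N).card : ℝ)⁻¹ * ∑ g ∈ Φ N, u.1 g) (hyperfilter ℕ) (𝓝 (m u)))
    {k : ℕ} (c : BoundedMeas (Fin k → G)) {l : ℝ}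
    (hl : IterLimExists (fun N : Fin k → ℕ => (∏ j, ((Φ (N j)).card : ℝ))⁻¹ *
      ∑ g ∈ Fintype.piFinset fun j => Φ (N j), c.1 g) l) :
    l = m.iterate k c := by
  induction k generalizing l with
  | zero =>
    refine Eq.trans (Eq.symm hl) ?_
    simp only [Finset.univ_eq_empty, Finset.prod_empty, inv_one, one_mul]
    rw [Fintype.piFinset_of_isEmpty, Finset.univ_unique, Finset.sum_singleton]
    exact congrArg c.1 (Subsingleton.elim _ _)
  | succ k ih =>
    obtain ⟨B, hB, hBl⟩ := hl
    refine ih (evalFamily (fun g => m.map ⟨fun h => (Fin.snoc g h : Fin (k + 1) → G),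
      .of_discrete⟩) c) ?_
    convert hBl using 1
    refine funext fun M => ?_
    refine tendsto_nhds_unique ?_ ((hB M).mono_left Nat.hyperfilter_le_atTop)
    refine ((tendsto_finsetSum (Fintype.piFinset fun j => Φ (M j)) fun g _ =>
      hm (compMap c ⟨fun h => (Fin.snoc g h : Fin (k + 1) → G), .of_discrete⟩)).const_mul
        (∏ j, ((Φ (M j)).card : ℝ))⁻¹).congr fun n => ?_
    simp only [sum_piFinset_snoc, Fin.prod_univ_castSucc, Fin.snoc_castSucc, Fin.snoc_last]
    rw [← Finset.mul_sum, mul_inv, mul_assoc]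
    rfl

end FolnerMean

/-- Integration against a probability measure, as a mean. -/
noncomputable def integralMean {X : Type*} [MeasurableSpace X] (μ : Measure X)
    [IsProbabilityMeasure μ] : FinAddMean X :=
  have hint (f : BoundedMeas X) : Integrable f.1 μ :=
    let ⟨C, hC⟩ := f.2.2
    .of_bound f.2.1.aestronglyMeasurable C (.of_forall hC)
  { toFun :=
      { toFun := fun f => ∫ x, f.1 x ∂μ
        map_add' := fun f g => integral_add (hint f) (hint g)
        map_smul' := fun c f => integral_const_mul c f.1 }
    nonneg' := fun _ hf => integral_nonneg hf
    one' := by simp }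

/-- The iterated-limit cube integral of a family `(f_ε)` of functions
bounded by `1` is at most `min_ε |||f_ε|||_η`, where `|||f|||_η` is the `2ᵏ`-th root of the
corresponding iterated limit with all functions equal to `f`. -/
theorem cube_integral_le_seminorm
    {G X : Type*} [Group G] [Countable G] [DecidableEq G]
    [MeasurableSpace X] (μ : MeasureTheory.Measure X) [MeasureTheory.IsProbabilityMeasure μ]
    (d : ℕ) (T : Fin d → G → X → X)
    (hT_mp : ∀ i g, MeasureTheory.MeasurePreserving (T i g) μ μ)
    (hT_bij : ∀ i g, Function.Bijective (T i g))
    (hT_hom : ∀ i g h, T i (g * h) = T i g ∘ T i h)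
    (hT_comm : ∀ i j, i ≠ j → ∀ g h, T i g ∘ T j h = T j h ∘ T i g)
    (Φ : ℕ → Finset G) (hΦ : IsTwoSidedFolner Φ)
    (k : ℕ) (P : Fin k → Fin d) (hP : Function.Injective P)
    (f : (Fin k → Bool) → X → ℝ)
    (hf_meas : ∀ ε, Measurable (f ε))
    (hf_bdd : ∀ ε x, |f ε x| ≤ 1)
    (l : (Fin k → Bool) → ℝ) (hl_nonneg : ∀ ε, 0 ≤ l ε)
    (hl : ∀ ε, IterLimExists (cubeIntAvg μ T P Φ (fun _ => f ε)) (l ε)) :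
    ∀ I : ℝ, IterLimExists (cubeIntAvg μ T P Φ f) I →
      ∀ ε : Fin k → Bool, I ≤ (l ε) ^ (((2 : ℝ) ^ k)⁻¹) := by
  intro I hI ε
  let : MeasurableSpace G := ⊤
  obtain ⟨m, hm⟩ := exists_mean_tendsto Φ hΦ.1.1
  have hbi := isBiinvariant_of_isTwoSidedFolner hΦ hm
  let S : Fin d → G → {φ : X → X // Measurable φ} := fun i g => ⟨T i g, (hT_mp i g).measurable⟩
  let F : (Fin k → Bool) → BoundedMeas X := fun ε => ⟨f ε, hf_meas ε, 1, hf_bdd ε⟩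
  have hlim : ∀ (h : (Fin k → Bool) → BoundedMeas X) (r : ℝ),
      IterLimExists (cubeIntAvg μ T P Φ fun ε => (h ε).1) r →
        r = m.iterate k (cubeFun (integralMean μ) S P h) := by
    intro h r hr
    refine eq_iterate_of_iterLimExists hm _ ?_
    convert hr using 1
    refine funext fun N => congrArg _ (Finset.sum_congr rfl fun g _ => ?_)
    change ∫ x, (cubeProd S P h g).1 x ∂μ = _
    simp only [cubeProd_apply]
    rfl
  have hI' := hlim F I hI
  have hl' := fun ε => hlim (fun _ => F ε) (l ε) (hl ε)
  have hcsg := abs_iterate_cubeFun_pow_le hbi (integralMean μ) S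
    (fun i g h x => congrFun (hT_hom i g h) x)
    (fun i j hij g h x => congrFun (hT_comm i j hij g h) x) P hP
    (fun j g u => by
      change ∫ x, u.1 (T (P j) g x) ∂μ = ∫ x, u.1 x ∂μ
      conv_rhs => rw [← (hT_mp (P j) g).map_eq]
      exact (integral_map (hT_mp (P j) g).aemeasurable u.2.1.aestronglyMeasurable).symm) F
  rw [← hI'] at hcsg
  simp only [← hl', abs_of_nonneg (hl_nonneg _)] at hcsg
  have hl_one : ∀ ε, l ε ≤ 1 := fun ε => by
    rw [hl' ε]
    refine FinAddMean.le_of_forall_le _ fun g => FinAddMean.le_of_forall_le _ fun x => (le_abs_self _).trans ?_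
    rw [cubeProd_apply, Finset.abs_prod]
    exact Finset.prod_le_one (fun _ _ => abs_nonneg _) fun _ _ => hf_bdd ε _
  have hle : |I| ^ 2 ^ k ≤ l ε := by
    refine hcsg.trans ?_
    rw [← Finset.mul_prod_erase _ _ (Finset.mem_univ ε)]
    exact mul_le_of_le_one_right (hl_nonneg ε)
      (Finset.prod_le_one (fun _ _ => hl_nonneg _) fun _ _ => hl_one _)
  refine (le_abs_self I).trans ?_
  rw [Real.le_rpow_inv_iff_of_pos (abs_nonneg I) (hl_nonneg ε) (by positivity)]
  exact_mod_cast hle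
end

section
/- Let G be a countable amenable group, let (X, 𝒳, μ) be a probability space, and let T⁽¹⁾, …, T⁽ᵈ⁾ be pairwise commuting measure-preserving actions of G on X. Let η ⊆ {1, …, d} with |η| = k, list η = {i₁, …, i_k}, let Φ⁽¹⁾, …, Φ⁽ᵏ⁾ be two-sided Følner sequences in G, and let f_ε ∈ L^∞(μ), ε ∈ {0,1}ᵏ, be real-valued functions uniformly bounded by 1. Then for every δ > 0 there exists N₀ such that whenever N₁, …, N_k > N₀, |(1/(|Φ⁽¹⁾_{N₁}| ⋯ |Φ⁽ᵏ⁾_{N_k}|)) Σ_{g₁ ∈ Φ⁽¹⁾_{N₁}} ⋯ Σ_{g_k ∈ Φ⁽ᵏ⁾_{N_k}} ∫ ∏_{ε ∈ {0,1}ᵏ} f_ε ∘ ∏_{j=1}^k (T^{(i_j)}_{g_j})^{ε_j} dμ| ≤ |||f_𝟎|||_η + δ, where 𝟎 ∈ {0,1}ᵏ is the all-zeros vector. -/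
open MeasureTheory Filter Topology

/-- The multiparameter averages as in `cubeIntAvg`, but with a separate Følner sequence for
each of the `k` coordinates. -/
noncomputable def cubeIntAvgMulti {G X : Type*} [Group G] [MeasurableSpace X]
    (μ : MeasureTheory.Measure X) {d k : ℕ} (T : Fin d → G → X → X) (P : Fin k → Fin d)
    (Φ : Fin k → ℕ → Finset G) (f : (Fin k → Bool) → X → ℝ) (N : Fin k → ℕ) : ℝ :=
  (∏ j, ((Φ j (N j)).card : ℝ))⁻¹ *
    ∑ g ∈ Fintype.piFinset (fun j => Φ j (N j)),
      ∫ x, ∏ ε : Fin k → Bool, f ε (cubeMapP T P g ε x) ∂μ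


namespace CubeAverage

/-- Nonnegative weights on a finite set with total mass one. -/
structure IsProbWeight {α : Type*} (s : Finset α) (w : α → ℝ) : Prop where
  nonneg : ∀ a, 0 ≤ w a
  sum_eq_one : ∑ a ∈ s, w a = 1

/-- The weighted average of `c` over the finite set `s`. -/
def wavg {α : Type*} (s : Finset α) (w : α → ℝ) (c : α → ℝ) : ℝ := ∑ a ∈ s, w a * c a

section WeightedAverage

variable {α β : Type*} {s : Finset α} {w : α → ℝ} {c c' : α → ℝ}

lemma wavg_mono (hw : IsProbWeight s w) (h : ∀ a, c a ≤ c' a) : wavg s w c ≤ wavg s w c' :=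
  Finset.sum_le_sum fun a _ => mul_le_mul_of_nonneg_left (h a) (hw.nonneg a)

lemma wavg_const (hw : IsProbWeight s w) (x : ℝ) : wavg s w (fun _ => x) = x := by
  rw [wavg, ← Finset.sum_mul, hw.sum_eq_one, one_mul]

lemma abs_wavg_le (hw : IsProbWeight s w) {C : ℝ} (h : ∀ a, |c a| ≤ C) : |wavg s w c| ≤ C := by
  rw [abs_le]
  constructor
  · rw [← wavg_const hw (-C)]
    exact wavg_mono hw fun a => (abs_le.1 (h a)).1
  · rw [← wavg_const hw C]
    exact wavg_mono hw fun a => (abs_le.1 (h a)).2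

lemma sq_wavg_le (hw : IsProbWeight s w) : wavg s w c ^ 2 ≤ wavg s w (fun a => c a ^ 2) := by
  have h1 : 0 ≤ wavg s w (fun a => (c a - wavg s w c) ^ 2) :=
    Finset.sum_nonneg fun a _ => mul_nonneg (hw.nonneg a) (sq_nonneg _)
  have h2 : ∀ m : ℝ, wavg s w (fun a => (c a - m) ^ 2)
      = wavg s w (fun a => c a ^ 2) - 2 * m * wavg s w c + m ^ 2 := by
    intro m
    have : m ^ 2 = ∑ a ∈ s, w a * m ^ 2 := by rw [← Finset.sum_mul, hw.sum_eq_one, one_mul]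
    rw [this, wavg, wavg, wavg, Finset.mul_sum, ← Finset.sum_sub_distrib, ← Finset.sum_add_distrib]
    exact Finset.sum_congr rfl fun a _ => by ring
  rw [h2] at h1
  nlinarith

lemma wavg_comm {t : Finset β} {v : β → ℝ} (F : α → β → ℝ) :
    wavg s w (fun a => wavg t v (F a)) = wavg t v (fun b => wavg s w (fun a => F a b)) := by
  simp only [wavg, Finset.mul_sum]
  rw [Finset.sum_comm]
  exact Finset.sum_congr rfl fun b _ => Finset.sum_congr rfl fun a _ => by ring

lemma wavg_sub : wavg s w c - wavg s w c' = wavg s w (fun a => c a - c' a) := by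
  simp only [wavg, ← Finset.sum_sub_distrib, mul_sub]

lemma wavg_mul_left (x : ℝ) : x * wavg s w c = wavg s w (fun a => x * c a) := by
  simp only [wavg, Finset.mul_sum]
  exact Finset.sum_congr rfl fun a _ => by ring

lemma sum_wavg (t : Finset β) (F : β → α → ℝ) :
    ∑ b ∈ t, wavg s w (F b) = wavg s w (fun a => ∑ b ∈ t, F b a) := by
  simp only [wavg, Finset.mul_sum]
  exact Finset.sum_comm

lemma tendsto_wavg {F : β → α → ℝ} {l : Filter β} (h : ∀ a, Tendsto (fun b => F b a) l (𝓝 (c a))) :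
    Tendsto (fun b => wavg s w (F b)) l (𝓝 (wavg s w c)) :=
  tendsto_finsetSum _ fun a _ => (h a).const_mul _

/-- The uniform weights on a nonempty finite set form a probability weight. -/
lemma isProbWeight_uniform (hs : s.Nonempty) : IsProbWeight s (fun _ => (s.card : ℝ)⁻¹) where
  nonneg _ := by positivity
  sum_eq_one := by
    have : (s.card : ℝ) ≠ 0 := by exact_mod_cast hs.card_pos.ne'
    simp [this]

end WeightedAverage

section Product

variable {G ι : Type*} [Fintype ι] [DecidableEq ι]

/-- The average of `c` with respect to the product of the weights `w j` on `s j`. -/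
def piAvg (s : ι → Finset G) (w : ι → G → ℝ) (c : (ι → G) → ℝ) : ℝ :=
  wavg (Fintype.piFinset s) (fun g => ∏ j, w j (g j)) c

variable {s : ι → Finset G} {w : ι → G → ℝ}

lemma isProbWeight_pi (hw : ∀ j, IsProbWeight (s j) (w j)) :
    IsProbWeight (Fintype.piFinset s) (fun g => ∏ j, w j (g j)) where
  nonneg g := Finset.prod_nonneg fun j _ => (hw j).nonneg _
  sum_eq_one := by
    rw [← Finset.prod_univ_sum]
    exact Finset.prod_eq_one fun j _ => (hw j).sum_eq_one

/-- Averaging once more over a single coordinate does not change a product average. -/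
lemma piAvg_resample (hw : ∀ j, IsProbWeight (s j) (w j)) (j : ι) (c : (ι → G) → ℝ) :
    piAvg s w c = piAvg s w (fun g => wavg (s j) (w j) (fun t => c (Function.update g j t))) := by
  have key : ∑ p ∈ Fintype.piFinset s ×ˢ s j, (∏ i, w i (p.1 i)) * (w j p.2 * c p.1)
      = ∑ p ∈ Fintype.piFinset s ×ˢ s j,
        (∏ i, w i (p.1 i)) * (w j p.2 * c (Function.update p.1 j p.2)) := by
    refine Finset.sum_nbij' (fun p => (Function.update p.1 j p.2, p.1 j))
      (fun p => (Function.update p.1 j p.2, p.1 j)) ?_ ?_ ?_ ?_ ?_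
    · rintro ⟨g, t⟩ h
      simp only [Finset.mem_product, Fintype.mem_piFinset] at h ⊢
      refine ⟨fun i => ?_, h.1 j⟩
      by_cases hi : i = j
      · subst hi; simpa using h.2
      · simpa [hi] using h.1 i
    · rintro ⟨g, t⟩ h
      simp only [Finset.mem_product, Fintype.mem_piFinset] at h ⊢
      refine ⟨fun i => ?_, h.1 j⟩
      by_cases hi : i = j
      · subst hi; simpa using h.2
      · simpa [hi] using h.1 i
    · rintro ⟨g, t⟩ _
      simp
    · rintro ⟨g, t⟩ _
      simp
    · rintro ⟨g, t⟩ _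
      have h1 : ∀ g : ι → G, ∏ i, w i (g i) = w j (g j) * ∏ i ∈ Finset.univ.erase j, w i (g i) :=
        fun g => (Finset.mul_prod_erase _ _ (Finset.mem_univ j)).symm
      have h2 : ∏ i ∈ Finset.univ.erase j, w i (Function.update g j t i)
          = ∏ i ∈ Finset.univ.erase j, w i (g i) :=
        Finset.prod_congr rfl fun i hi => by
          rw [Function.update_of_ne (Finset.ne_of_mem_erase hi)]
      simp only [h1, h2, Function.update_self, Function.update_idem, Function.update_eq_self]
      ring
  rw [Finset.sum_product, Finset.sum_product] at key
  simp only [piAvg, wavg, Finset.mul_sum]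
  rw [← key]
  refine Finset.sum_congr rfl fun g _ => ?_
  simp only
  rw [← Finset.mul_sum, ← Finset.sum_mul, (hw j).sum_eq_one, one_mul]

end Product

lemma piAvg_snoc {G : Type*} {k : ℕ} (s : Fin k → Finset G) (w : Fin k → G → ℝ) (t : Finset G)
    (v : G → ℝ) (c : (Fin (k + 1) → G) → ℝ) :
    piAvg (Fin.snoc s t : Fin (k + 1) → Finset G) (Fin.snoc w v : Fin (k + 1) → G → ℝ) c
      = piAvg s w (fun g => wavg t v (fun x => c (Fin.snoc g x))) := by
  simp only [piAvg, wavg, Finset.mul_sum]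
  rw [← Finset.sum_product']
  refine Finset.sum_nbij' (fun g => (Fin.init g, g (Fin.last k)))
    (fun p => (Fin.snoc p.1 p.2 : Fin (k + 1) → G)) ?_ ?_ ?_ ?_ ?_
  · intro g hg
    simp only [Finset.mem_product, Fintype.mem_piFinset] at hg ⊢
    exact ⟨fun i => by simpa [Fin.init] using hg i.castSucc, by simpa using hg (Fin.last k)⟩
  · rintro ⟨g, x⟩ hg
    simp only [Finset.mem_product, Fintype.mem_piFinset] at hg ⊢
    intro i
    refine Fin.lastCases ?_ (fun i => ?_) i
    · simpa using hg.2
    · simpa using hg.1 i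
  · intro g _
    simp
  · rintro ⟨g, x⟩ _
    simp
  · intro g _
    simp only [Fin.prod_univ_castSucc, Fin.snoc_castSucc, Fin.snoc_last, Fin.snoc_init_self,
      Fin.init]
    rw [mul_assoc]

section Folner

/-- The uniform weights on a finite set. -/
noncomputable def unif {α : Type*} (s : Finset α) : α → ℝ := fun _ => (s.card : ℝ)⁻¹

lemma abs_sum_sub_sum_le {α : Type*} [DecidableEq α] {A B : Finset α} (hAB : A.card = B.card)
    {c : α → ℝ} (hc : ∀ a, |c a| ≤ 1) :
    |∑ a ∈ A, c a - ∑ a ∈ B, c a| ≤ 2 * ((A.card : ℝ) - (A ∩ B).card) := by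
  have hb : ∀ s : Finset α, |∑ a ∈ s, c a| ≤ s.card := fun s =>
    (Finset.abs_sum_le_sum_abs _ _).trans
      ((Finset.sum_le_sum fun a _ => hc a).trans (by simp))
  have h1 : ∑ a ∈ A, c a = ∑ a ∈ A ∩ B, c a + ∑ a ∈ A \ B, c a :=
    (Finset.sum_inter_add_sum_sdiff A B c).symm
  have h2 : ∑ a ∈ B, c a = ∑ a ∈ A ∩ B, c a + ∑ a ∈ B \ A, c a := by
    rw [Finset.inter_comm]
    exact (Finset.sum_inter_add_sum_sdiff B A c).symm
  have h3 : ((A \ B).card : ℝ) = A.card - (A ∩ B).card := by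
    rw [eq_sub_iff_add_eq]
    exact_mod_cast Finset.card_sdiff_add_card_inter A B
  have h4 : ((B \ A).card : ℝ) = A.card - (A ∩ B).card := by
    rw [eq_sub_iff_add_eq, hAB, Finset.inter_comm]
    exact_mod_cast Finset.card_sdiff_add_card_inter B A
  have h5 := abs_le.1 (hb (A \ B))
  have h6 := abs_le.1 (hb (B \ A))
  rw [h1, h2, abs_le]
  constructor <;> linarith

lemma abs_wavg_comp_sub_le {α : Type*} [DecidableEq α] {s : Finset α} (hs : s.Nonempty)
    {e : α → α} (he : Function.Injective e) {c : α → ℝ} (hc : ∀ a, |c a| ≤ 1) :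
    |wavg s (unif s) (fun a => c (e a)) - wavg s (unif s) c|
      ≤ 2 * (1 - ((s ∩ s.image e).card : ℝ) / s.card) := by
  have hpos : (0 : ℝ) < s.card := by exact_mod_cast hs.card_pos
  have h := abs_sum_sub_sum_le (A := s) (B := s.image e)
    (Finset.card_image_of_injective s he).symm hc
  rw [Finset.sum_image he.injOn, abs_sub_comm] at h
  simp only [wavg, unif, ← Finset.mul_sum, ← mul_sub]
  rw [abs_mul, abs_of_pos (inv_pos.2 hpos)]
  calc _ ≤ (s.card : ℝ)⁻¹ * (2 * ((s.card : ℝ) - (s ∩ s.image e).card)) := by gcongr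
    _ = _ := by field_simp

lemma piAvg_unif {G ι : Type*} [Fintype ι] [DecidableEq ι] (s : ι → Finset G) (c : (ι → G) → ℝ) :
    piAvg s (fun j => unif (s j)) c = wavg (Fintype.piFinset s) (unif (Fintype.piFinset s)) c := by
  simp [piAvg, wavg, unif]

variable {G : Type*} [Group G] [DecidableEq G]

lemma tendsto_wavg_leftMul_sub {Φ : ℕ → Finset G} (hΦ : IsLeftFolner Φ) {φ : G → ℝ}
    (hφ : ∀ g, |φ g| ≤ 1) (a : G) :
    Tendsto (fun n => wavg (Φ n) (unif (Φ n)) (fun g => φ (a * g)) - wavg (Φ n) (unif (Φ n)) φ)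
      atTop (𝓝 0) := by
  refine squeeze_zero_norm
    (fun n => abs_wavg_comp_sub_le (hΦ.1 n) (mul_right_injective a) hφ) ?_
  simpa using ((hΦ.2 a).const_sub 1).const_mul 2

variable {ι : Type*} [Fintype ι] [DecidableEq ι]

lemma tendsto_piAvg_rightMul_sub {Φ : ι → ℕ → Finset G} (hΦ : ∀ j, IsRightFolner (Φ j))
    {c : (ι → G) → ℝ} (hc : ∀ g, |c g| ≤ 1) (h : ι → G) :
    Tendsto (fun N : ι → ℕ =>
      piAvg (fun j => Φ j (N j)) (fun j => unif (Φ j (N j))) (fun g => c (g * h))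
        - piAvg (fun j => Φ j (N j)) (fun j => unif (Φ j (N j))) c) atTop (𝓝 0) := by
  have hratio : ∀ N : ι → ℕ,
      (((Fintype.piFinset fun j => Φ j (N j)) ∩
        (Fintype.piFinset fun j => Φ j (N j)).image (fun g => g * h)).card : ℝ)
          / (Fintype.piFinset fun j => Φ j (N j)).card
      = ∏ j, (((Φ j (N j)) ∩ (Φ j (N j)).image (fun x => x * h j)).card : ℝ)
          / ((Φ j (N j)).card : ℝ) := by
    intro N
    have h1 : (Fintype.piFinset fun j => Φ j (N j)).image (fun g => g * h)
        = Fintype.piFinset fun j => (Φ j (N j)).image (fun x => x * h j) :=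
      (Fintype.piFinset_image (fun j x => x * h j) _).symm
    rw [h1, ← Fintype.piFinset_inter, Fintype.card_piFinset, Fintype.card_piFinset,
      Finset.prod_div_distrib]
    push_cast
    rfl
  have hlim : Tendsto (fun N : ι → ℕ =>
      ∏ j, (((Φ j (N j)) ∩ (Φ j (N j)).image (fun x => x * h j)).card : ℝ)
          / ((Φ j (N j)).card : ℝ)) atTop (𝓝 (∏ _j : ι, (1 : ℝ))) := by
    refine tendsto_finsetProd _ fun j _ => ((hΦ j).2 (h j)).comp ?_
    exact tendsto_atTop_atTop.2 fun b => ⟨fun _ => b, fun N hN => hN j⟩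
  rw [Finset.prod_const_one] at hlim
  simp only [piAvg_unif]
  refine squeeze_zero_norm (a := fun N : ι → ℕ =>
    2 * (1 - ∏ j, (((Φ j (N j)) ∩ (Φ j (N j)).image (fun x => x * h j)).card : ℝ)
          / ((Φ j (N j)).card : ℝ))) (fun N => ?_) ?_
  · rw [← hratio N]
    exact abs_wavg_comp_sub_le (Fintype.piFinset_nonempty.2 fun j => (hΦ j).1 _)
      (mul_left_injective h) hc
  · simpa using (hlim.const_sub 1).const_mul 2

end Folner

section PositiveDefinite

variable {G : Type*} [Group G]

/-- Real positive definite functions on a group. -/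
structure IsPosDef (φ : G → ℝ) : Prop where
  map_inv : ∀ g, φ g⁻¹ = φ g
  nonneg : ∀ (s : Finset G) (u : G → ℝ), 0 ≤ ∑ a ∈ s, ∑ b ∈ s, u a * u b * φ (a⁻¹ * b)

lemma IsPosDef.wavg {α : Type*} {s : Finset α} {w : α → ℝ} (hw : IsProbWeight s w)
    {φ : α → G → ℝ} (hφ : ∀ a, IsPosDef (φ a)) :
    IsPosDef (fun g => wavg s w (fun a => φ a g)) where
  map_inv g := by simp only [(hφ _).map_inv]
  nonneg t u := by
    have h : ∑ a ∈ t, ∑ b ∈ t, u a * u b * CubeAverage.wavg s w (fun i => φ i (a⁻¹ * b))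
        = CubeAverage.wavg s w (fun i => ∑ a ∈ t, ∑ b ∈ t, u a * u b * φ i (a⁻¹ * b)) := by
      simp only [wavg_mul_left, sum_wavg]
    rw [h]
    exact Finset.sum_nonneg fun i _ => mul_nonneg (hw.nonneg i) ((hφ i).nonneg t u)

lemma IsPosDef.of_tendsto {β : Type*} {l : Filter β} [l.NeBot] {F : β → G → ℝ} {φ : G → ℝ}
    (hF : ∀ b, IsPosDef (F b)) (h : ∀ g, Tendsto (fun b => F b g) l (𝓝 (φ g))) : IsPosDef φ where
  map_inv g := tendsto_nhds_unique (h g⁻¹) ((h g).congr fun b => ((hF b).map_inv g).symm)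
  nonneg s u := ge_of_tendsto' (tendsto_finsetSum _ fun a _ => tendsto_finsetSum _ fun b _ =>
    (h (a⁻¹ * b)).const_mul _) fun b => (hF b).nonneg s u

/-- The bilinear form on finitely supported functions given by the kernel `φ (a⁻¹ * b)`. -/
noncomputable def kernelForm (φ : G → ℝ) : (G →₀ ℝ) →ₗ[ℝ] (G →₀ ℝ) →ₗ[ℝ] ℝ :=
  Finsupp.linearCombination ℝ fun a => Finsupp.linearCombination ℝ fun b => φ (a⁻¹ * b)

lemma linearCombination_eq_wavg {α : Type*} (ψ : α → ℝ) (v : α →₀ ℝ) :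
    Finsupp.linearCombination ℝ ψ v = wavg v.support v ψ := by
  simp [Finsupp.linearCombination_apply, Finsupp.sum, wavg]

lemma kernelForm_apply (φ : G → ℝ) (u v : G →₀ ℝ) :
    kernelForm φ u v
      = wavg u.support u (fun a => Finsupp.linearCombination ℝ (fun b => φ (a⁻¹ * b)) v) := by
  simp [kernelForm, Finsupp.linearCombination_apply, Finsupp.sum, wavg]

lemma kernelForm_symm {φ : G → ℝ} (hφ : IsPosDef φ) (u v : G →₀ ℝ) :
    kernelForm φ u v = kernelForm φ v u := by
  have h : ∀ a b, φ (a⁻¹ * b) = φ (b⁻¹ * a) := fun a b => by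
    rw [← hφ.map_inv (b⁻¹ * a), mul_inv_rev, inv_inv]
  simp only [kernelForm_apply, linearCombination_eq_wavg]
  rw [wavg_comm]
  simp only [h]

/-- The uniform probability weight on a finite set, as a finitely supported function. -/
noncomputable def unifFinsupp {α : Type*} (s : Finset α) : α →₀ ℝ :=
  (s.card : ℝ)⁻¹ • ∑ g ∈ s, Finsupp.single g 1

lemma linearCombination_unifFinsupp {α : Type*} (s : Finset α) (ψ : α → ℝ) :
    Finsupp.linearCombination ℝ ψ (unifFinsupp s) = wavg s (unif s) ψ := by
  simp [unifFinsupp, wavg, unif, Finset.mul_sum]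

lemma unifFinsupp_nonneg {α : Type*} (s : Finset α) (a : α) : 0 ≤ unifFinsupp s a := by
  classical
  simp only [unifFinsupp, Finsupp.smul_apply, Finsupp.finsetSum_apply, smul_eq_mul]
  refine mul_nonneg (by positivity) (Finset.sum_nonneg fun g _ => ?_)
  rw [Finsupp.single_apply]
  split_ifs <;> norm_num

/-- If the averages of a positive definite function along a left Følner sequence accumulate at
`L`, then its quadratic form takes values on probability weights arbitrarily close to or below
`L`. -/
lemma IsPosDef.exists_quadratic_le [DecidableEq G] {φ : G → ℝ} (hφ : IsPosDef φ)
    (hb : ∀ g, |φ g| ≤ 1) {Φ : ℕ → Finset G} (hΦ : IsLeftFolner Φ) {l : Filter ℕ} [l.NeBot]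
    (hl : l ≤ atTop) {L : ℝ}
    (hL : Tendsto (fun n => CubeAverage.wavg (Φ n) (unif (Φ n)) φ) l (𝓝 L)) {δ : ℝ} (hδ : 0 < δ) :
    ∃ (s : Finset G) (w : G → ℝ), IsProbWeight s w ∧
      CubeAverage.wavg s w (fun a => CubeAverage.wavg s w (fun b => φ (a⁻¹ * b))) ≤ L + δ := by
  by_contra! hcon
  let W : Set (G →₀ ℝ) :=
    {u | (∀ a, 0 ≤ u a) ∧ Finsupp.linearCombination ℝ (fun _ => (1 : ℝ)) u = 1}
  have hW : ∀ u ∈ W, IsProbWeight u.support u := fun u hu =>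
    ⟨hu.1, by simpa [linearCombination_eq_wavg, CubeAverage.wavg] using hu.2⟩
  have hv : ∀ n, unifFinsupp (Φ n) ∈ W := fun n =>
    ⟨unifFinsupp_nonneg _, by
      rw [linearCombination_unifFinsupp]
      exact wavg_const (isProbWeight_uniform (hΦ.1 n)) 1⟩
  have hB1 : ∀ u ∈ W, ∀ v ∈ W, |kernelForm φ u v| ≤ 1 := by
    intro u hu v hv
    rw [kernelForm_apply]
    refine abs_wavg_le (hW u hu) fun a => ?_
    rw [linearCombination_eq_wavg]
    exact abs_wavg_le (hW v hv) fun b => hb _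
  have hBlow : ∀ u ∈ W, L + δ < kernelForm φ u u := by
    intro u hu
    simp only [kernelForm_apply, linearCombination_eq_wavg]
    exact hcon _ _ (hW u hu)
  have hBlim : ∀ u ∈ W, Tendsto (fun n => kernelForm φ u (unifFinsupp (Φ n))) l (𝓝 L) := by
    intro u hu
    simp only [kernelForm_apply, linearCombination_unifFinsupp]
    rw [← wavg_const (hW u hu) L]
    refine tendsto_wavg fun a => ?_
    simpa using ((tendsto_wavg_leftMul_sub hΦ hb a⁻¹).mono_left hl).add hL
  have hconv : ∀ u ∈ W, ∀ v ∈ W, ∀ t : ℝ, 0 ≤ t → t ≤ 1 → (1 - t) • u + t • v ∈ W := by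
    intro u hu v hv t h0 h1
    refine ⟨fun a => ?_, ?_⟩
    · have := mul_nonneg (sub_nonneg.2 h1) (hu.1 a)
      have := mul_nonneg h0 (hv.1 a)
      simp only [Finsupp.add_apply, Finsupp.smul_apply, smul_eq_mul]
      linarith
    · rw [map_add, map_smul, map_smul, hu.2, hv.2]
      simp
  let Q : Set ℝ := (fun u => kernelForm φ u u) '' W
  have hQne : Q.Nonempty := ⟨_, _, hv 0, rfl⟩
  have hQbdd : BddBelow Q := ⟨L + δ, by rintro _ ⟨u, hu, rfl⟩; exact (hBlow u hu).le⟩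
  set m := sInf Q with hm
  have hmL : L + δ ≤ m := le_csInf hQne (by rintro _ ⟨u, hu, rfl⟩; exact (hBlow u hu).le)
  have hL1 : |L| ≤ 1 := le_of_tendsto' (hBlim _ (hv 0)).abs fun n => hB1 _ (hv 0) _ (hv n)
  have hm1 : m ≤ 1 := (csInf_le hQbdd ⟨_, hv 0, rfl⟩).trans (abs_le.1 (hB1 _ (hv 0) _ (hv 0))).2
  have hδ2 : δ ≤ 2 := by linarith [(abs_le.1 hL1).1]
  obtain ⟨_, ⟨u, hu, rfl⟩, hum⟩ := exists_lt_of_csInf_lt hQne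
    (show sInf Q < m + δ ^ 2 / 8 by rw [← hm]; linarith [pow_pos hδ 2])
  simp only at hum
  have ht : ∀ n, m ≤ (1 - δ / 4) ^ 2 * kernelForm φ u u
      + 2 * (δ / 4) * (1 - δ / 4) * kernelForm φ u (unifFinsupp (Φ n)) + (δ / 4) ^ 2 := by
    intro n
    have h1 := csInf_le hQbdd
      ⟨_, hconv u hu _ (hv n) (δ / 4) (by positivity) (by linarith), rfl⟩
    rw [← hm] at h1
    simp only [map_add, map_smul, LinearMap.add_apply, LinearMap.smul_apply, smul_eq_mul,
      kernelForm_symm hφ (unifFinsupp (Φ n)) u] at h1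
    have h2 := mul_le_mul_of_nonneg_left (abs_le.1 (hB1 _ (hv n) _ (hv n))).2
      (sq_nonneg (δ / 4))
    linarith
  have hfin := ge_of_tendsto' ((((hBlim u hu).const_mul (2 * (δ / 4) * (1 - δ / 4))).const_add
    ((1 - δ / 4) ^ 2 * kernelForm φ u u)).add_const ((δ / 4) ^ 2)) ht
  have h3 : (1 - δ / 4) ^ 2 * kernelForm φ u u ≤ (1 - δ / 4) ^ 2 * m + δ ^ 2 / 8 := by
    have h5 := mul_le_mul_of_nonneg_left hum.le (sq_nonneg (1 - δ / 4))
    have h6 : (1 - δ / 4) ^ 2 * (δ ^ 2 / 8) ≤ 1 * (δ ^ 2 / 8) :=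
      mul_le_mul_of_nonneg_right (by nlinarith) (by positivity)
    linarith
  have h4 : 2 * (δ / 4) * (1 - δ / 4) * L ≤ 2 * (δ / 4) * (1 - δ / 4) * (m - δ) := by
    have : 0 ≤ 2 * (δ / 4) * (1 - δ / 4) := by
      have : 0 ≤ 1 - δ / 4 := by linarith
      positivity
    exact mul_le_mul_of_nonneg_left (by linarith) this
  have h7 : 0 < δ ^ 2 * (m + 5 - 2 * δ) :=
    mul_pos (pow_pos hδ 2) (by linarith [(abs_le.1 hL1).1])
  linarith

end PositiveDefinite

section IteratedLimit

variable {G : Type*} [Group G] [DecidableEq G]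

/-- If `c` is positive definite in each variable and its averages along a Følner sequence have
iterated limit `l`, then the average of `c (a⁻¹ * b)` over suitable product weights is at most
`l + δ`. -/
lemma exists_weights_piAvg_le {Φ : ℕ → Finset G} (hΦ : IsLeftFolner Φ) {k : ℕ}
    {c : (Fin k → G) → ℝ} (hc : ∀ g, |c g| ≤ 1)
    (hpd : ∀ j g, IsPosDef (fun t => c (Function.update g j t))) {l : ℝ}
    (hl : IterLimExists
      (fun M => piAvg (fun j => Φ (M j)) (fun j => unif (Φ (M j))) c) l) {δ : ℝ} (hδ : 0 < δ) :
    ∃ (s : Fin k → Finset G) (w : Fin k → G → ℝ), (∀ j, IsProbWeight (s j) (w j)) ∧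
      piAvg s w (fun a => piAvg s w (fun b => c (a⁻¹ * b))) ≤ l + δ := by
  induction k generalizing l δ with
  | zero =>
    have h1 : ∀ (s : Fin 0 → Finset G) (w : Fin 0 → G → ℝ) (c' : (Fin 0 → G) → ℝ),
        piAvg s w c' = c' 1 := fun s w c' => by
      rw [show c' = fun _ => c' 1 from funext fun g => congrArg c' (Subsingleton.elim _ _)]
      exact wavg_const (isProbWeight_pi fun j => j.elim0) _
    refine ⟨fun j => j.elim0, fun j => j.elim0, fun j => j.elim0, ?_⟩
    have hl' : _ = l := hl
    simp only [h1] at hl'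
    rw [h1, h1, Subsingleton.elim ((1 : Fin 0 → G)⁻¹ * 1) 1, hl']
    linarith
  | succ k ih =>
    obtain ⟨B, hB, hBl⟩ := hl
    have hsnoc : ∀ (M : Fin k → ℕ) (n : ℕ),
        piAvg (fun j => Φ ((Fin.snoc M n : Fin (k + 1) → ℕ) j))
          (fun j => unif (Φ ((Fin.snoc M n : Fin (k + 1) → ℕ) j))) c
        = piAvg (fun j => Φ (M j)) (fun j => unif (Φ (M j)))
            (fun g => wavg (Φ n) (unif (Φ n)) (fun t => c (Fin.snoc g t))) := by
      intro M n
      rw [← piAvg_snoc]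
      congr 1 <;> funext j <;> refine Fin.lastCases ?_ (fun i => ?_) j <;> simp
    simp only [hsnoc] at hB
    have hU : (hyperfilter ℕ : Filter ℕ) ≤ atTop := by
      rw [← Nat.cofinite_eq_atTop]
      exact hyperfilter_le_cofinite
    have hΦw : ∀ n, IsProbWeight (Φ n) (unif (Φ n)) := fun n => isProbWeight_uniform (hΦ.1 n)
    have hlim : ∀ g : Fin k → G, ∃ x ∈ Set.Icc (-1 : ℝ) 1,
        Tendsto (fun n => wavg (Φ n) (unif (Φ n)) (fun t => c (Fin.snoc g t)))
          (hyperfilter ℕ : Filter ℕ) (𝓝 x) := by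
      intro g
      refine isCompact_Icc.ultrafilter_le_nhds' ((hyperfilter ℕ).map
        fun n => wavg (Φ n) (unif (Φ n)) (fun t => c (Fin.snoc g t))) ?_
      rw [Ultrafilter.mem_map]
      exact Filter.Eventually.of_forall fun n =>
        abs_le.1 (abs_wavg_le (hΦw n) fun t => hc (Fin.snoc g t))
    choose c' hc' hc'lim using hlim
    have hpd' : ∀ j g, IsPosDef (fun t => c' (Function.update g j t)) := by
      intro j g
      refine IsPosDef.of_tendsto
        (F := fun n t => wavg (Φ n) (unif (Φ n)) (fun x => c (Fin.snoc (Function.update g j t) x)))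
        (fun n => IsPosDef.wavg (hΦw n) fun x => ?_) fun t => hc'lim _
      simp only [Fin.snoc_update]
      exact hpd _ _
    have hBc' : B = fun M => piAvg (fun j => Φ (M j)) (fun j => unif (Φ (M j))) c' :=
      funext fun M => tendsto_nhds_unique ((hB M).mono_left hU) (tendsto_wavg hc'lim)
    rw [hBc'] at hBl
    obtain ⟨s, w, hw, hsw⟩ := ih (fun g => abs_le.2 (hc' g)) hpd' hBl (half_pos hδ)
    have hwpi := isProbWeight_pi hw
    let φ : G → ℝ := fun t =>
      piAvg s w (fun a => piAvg s w (fun b => c (Fin.snoc (a⁻¹ * b) t : Fin (k + 1) → G)))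
    have hφpd : IsPosDef φ := by
      refine IsPosDef.wavg hwpi fun a => IsPosDef.wavg hwpi fun b => ?_
      have := hpd (Fin.last k) (Fin.snoc (a⁻¹ * b) (1 : G))
      simpa only [Fin.update_snoc_last] using this
    have hφb : ∀ t, |φ t| ≤ 1 := fun t =>
      abs_wavg_le hwpi fun a => abs_wavg_le hwpi fun b => hc _
    have hφlim : Tendsto (fun n => wavg (Φ n) (unif (Φ n)) φ) (hyperfilter ℕ : Filter ℕ)
        (𝓝 (piAvg s w (fun a => piAvg s w (fun b => c' (a⁻¹ * b))))) := by
      have : ∀ n, wavg (Φ n) (unif (Φ n)) φ = piAvg s w (fun a => piAvg s w (fun b =>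
          wavg (Φ n) (unif (Φ n)) (fun t => c (Fin.snoc (a⁻¹ * b) t)))) := by
        intro n
        simp only [φ, piAvg]
        rw [wavg_comm]
        congr 1
        funext a
        rw [wavg_comm]
      simp only [this]
      exact tendsto_wavg fun a => tendsto_wavg fun b => hc'lim _
    obtain ⟨t, v, hv, htv⟩ := hφpd.exists_quadratic_le hφb hΦ hU hφlim (half_pos hδ)
    refine ⟨Fin.snoc s t, Fin.snoc w v, fun j => ?_, ?_⟩
    · refine Fin.lastCases ?_ (fun i => ?_) j
      · simpa using hv
      · simpa using hw i
    · have hmul : ∀ (a b : Fin k → G) (x y : G),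
          (Fin.snoc a x : Fin (k + 1) → G)⁻¹ * (Fin.snoc b y : Fin (k + 1) → G)
            = (Fin.snoc (a⁻¹ * b) (x⁻¹ * y) : Fin (k + 1) → G) := by
        intro a b x y
        funext j
        refine Fin.lastCases ?_ (fun i => ?_) j <;> simp
      have hswap : piAvg (Fin.snoc s t : Fin (k + 1) → Finset G) (Fin.snoc w v)
          (fun a => piAvg (Fin.snoc s t : Fin (k + 1) → Finset G) (Fin.snoc w v)
            (fun b => c (a⁻¹ * b)))
          = wavg t v (fun x => wavg t v (fun y => φ (x⁻¹ * y))) := by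
        simp only [piAvg_snoc, hmul, φ]
        simp only [piAvg]
        rw [wavg_comm]
        congr 1
        funext x
        rw [wavg_comm (s := t)]
        congr 1
        funext a
        rw [wavg_comm]
      rw [hswap]
      linarith

end IteratedLimit

section Composition

variable {X : Type*}

/-- The composition `a 0 ∘ a 1 ∘ ⋯ ∘ a (k - 1)`. -/
def ofFnComp {k : ℕ} (a : Fin k → X → X) : X → X := (List.ofFn a).foldr (· ∘ ·) id

lemma ofFnComp_succ {k : ℕ} (a : Fin (k + 1) → X → X) :
    ofFnComp a = a 0 ∘ ofFnComp (fun i => a i.succ) := by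
  simp [ofFnComp, List.ofFn_succ]

lemma commute_ofFnComp {k : ℕ} {a : Fin k → X → X} {s : X → X}
    (h : ∀ i, Function.Commute s (a i)) : Function.Commute s (ofFnComp a) := by
  induction k with
  | zero => exact fun x => rfl
  | succ k ih =>
    rw [ofFnComp_succ]
    exact (h 0).comp_right (ih fun i => h i.succ)

lemma ofFnComp_comp {k : ℕ} {a b : Fin k → X → X}
    (h : ∀ i j, i ≠ j → Function.Commute (b i) (a j)) :
    ofFnComp (fun i => a i ∘ b i) = ofFnComp a ∘ ofFnComp b := by
  induction k with
  | zero => rfl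
  | succ k ih =>
    have h0 : Function.Commute (b 0) (ofFnComp fun i => a i.succ) :=
      commute_ofFnComp fun i => h 0 i.succ (Fin.succ_ne_zero i).symm
    rw [ofFnComp_succ, ofFnComp_succ a, ofFnComp_succ b,
      ih fun i j hij => h _ _ fun e => hij (Fin.succ_injective _ e)]
    funext x
    exact congrArg (a 0) (h0 _)

lemma ofFnComp_id {k : ℕ} : ofFnComp (fun _ : Fin k => (id : X → X)) = id := by
  induction k with
  | zero => rfl
  | succ k ih => rw [ofFnComp_succ, ih]; rfl

lemma ofFnComp_single {k : ℕ} (j : Fin k) (s : X → X) :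
    ofFnComp (fun i => if i = j then s else id) = s := by
  induction k with
  | zero => exact j.elim0
  | succ k ih =>
    rw [ofFnComp_succ]
    refine Fin.cases ?_ (fun j => ?_) j
    · simp [Fin.succ_ne_zero, ofFnComp_id]
    · simp [(Fin.succ_ne_zero _).symm, ih]

lemma measurePreserving_ofFnComp [MeasurableSpace X] {μ : Measure X} {k : ℕ} {a : Fin k → X → X}
    (h : ∀ i, MeasurePreserving (a i) μ μ) : MeasurePreserving (ofFnComp a) μ μ := by
  induction k with
  | zero => exact MeasurePreserving.id μ
  | succ k ih =>
    rw [ofFnComp_succ]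
    exact (h 0).comp (ih fun i => h i.succ)

end Composition

section SingleAction

variable {G X : Type*} [Group G] [MeasurableSpace X] {μ : Measure X} [IsProbabilityMeasure μ]
  {S : G → X → X} {F F' : X → ℝ}

lemma integrable_of_abs_le {C : ℝ} (hF : Measurable F) (hb : ∀ x, |F x| ≤ C) : Integrable F μ :=
  Integrable.of_bound hF.aestronglyMeasurable C (Eventually.of_forall hb)

omit [IsProbabilityMeasure μ] in
lemma integral_mul_comp_eq (hS : ∀ g, MeasurePreserving (S g) μ μ)
    (hmul : ∀ g h, S (g * h) = S g ∘ S h) (hF : Measurable F) (hF' : Measurable F') (a b : G) :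
    ∫ x, F x * F' (S (a⁻¹ * b) x) ∂μ = ∫ x, F (S b⁻¹ x) * F' (S a⁻¹ x) ∂μ := by
  have hm : Measurable fun x => F x * F' (S (a⁻¹ * b) x) :=
    hF.mul (hF'.comp (hS _).measurable)
  conv_lhs => rw [← (hS b⁻¹).map_eq]
  rw [integral_map (hS b⁻¹).measurable.aemeasurable hm.aestronglyMeasurable]
  refine integral_congr_ae (Eventually.of_forall fun x => ?_)
  have : S (a⁻¹ * b) (S b⁻¹ x) = S a⁻¹ x := by
    rw [← Function.comp_apply (f := S (a⁻¹ * b)), ← hmul, mul_inv_cancel_right]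
  simp only [this]

lemma sum_sum_mul_integral_eq (hS : ∀ g, MeasurePreserving (S g) μ μ)
    (hmul : ∀ g h, S (g * h) = S g ∘ S h) (hF : Measurable F) (hb : ∀ x, |F x| ≤ 1)
    (s : Finset G) (u : G → ℝ) :
    ∑ a ∈ s, ∑ b ∈ s, u a * u b * ∫ x, F x * F (S (a⁻¹ * b) x) ∂μ
      = ∫ x, (∑ a ∈ s, u a * F (S a⁻¹ x)) ^ 2 ∂μ := by
  have hFS : ∀ a, Measurable fun x => F (S a x) := fun a => hF.comp (hS a).measurable
  have hint : ∀ a b, Integrable (fun x => u a * F (S a⁻¹ x) * (u b * F (S b⁻¹ x))) μ := by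
    intro a b
    refine integrable_of_abs_le (C := |u a| * |u b|)
      (((hFS _).const_mul _).mul ((hFS _).const_mul _)) fun x => ?_
    rw [abs_mul, abs_mul, abs_mul]
    have h2 := mul_le_mul (mul_le_of_le_one_right (abs_nonneg (u a)) (hb (S a⁻¹ x)))
      (mul_le_of_le_one_right (abs_nonneg (u b)) (hb (S b⁻¹ x))) (by positivity) (by positivity)
    exact h2
  simp only [sq, Finset.sum_mul_sum]
  rw [integral_finsetSum _ fun a _ => integrable_finsetSum _ fun b _ => hint a b]
  refine Finset.sum_congr rfl fun a _ => ?_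
  rw [integral_finsetSum _ fun b _ => hint a b]
  refine Finset.sum_congr rfl fun b _ => ?_
  rw [integral_mul_comp_eq hS hmul hF hF, ← integral_const_mul]
  congr 1
  funext x
  ring

lemma sq_integral_le {H : X → ℝ} (hH : MemLp H 2 μ) : (∫ x, H x ∂μ) ^ 2 ≤ ∫ x, H x ^ 2 ∂μ := by
  have h := ProbabilityTheory.variance_nonneg H μ
  rw [ProbabilityTheory.variance_eq_sub hH] at h
  simpa using h

lemma sq_wavg_integral_le (hS : ∀ g, MeasurePreserving (S g) μ μ) (h1 : S 1 = id)
    (hmul : ∀ g h, S (g * h) = S g ∘ S h) (hF : Measurable F) (hb : ∀ x, |F x| ≤ 1)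
    (hF' : Measurable F') (hb' : ∀ x, |F' x| ≤ 1) {s : Finset G} {w : G → ℝ}
    (hw : IsProbWeight s w) :
    wavg s w (fun t => ∫ x, F x * F' (S t x) ∂μ) ^ 2
      ≤ wavg s w (fun a => wavg s w (fun b => ∫ x, F x * F (S (a⁻¹ * b) x) ∂μ)) := by
  have hFS : ∀ a, Measurable fun x => F (S a x) := fun a => hF.comp (hS a).measurable
  let V : X → ℝ := fun x => wavg s w (fun a => F (S a⁻¹ x))
  have hV : Measurable V := Finset.measurable_sum _ fun a _ => (hFS _).const_mul _
  have hVb : ∀ x, |V x| ≤ 1 := fun x => abs_wavg_le hw fun a => hb _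
  have hVF : ∀ x, |F' x * V x| ≤ 1 := fun x => by
    rw [abs_mul]
    exact mul_le_one₀ (hb' x) (abs_nonneg _) (hVb x)
  have hleft : wavg s w (fun t => ∫ x, F x * F' (S t x) ∂μ) = ∫ x, F' x * V x ∂μ := by
    simp only [V, wavg, Finset.mul_sum]
    rw [integral_finsetSum]
    · refine Finset.sum_congr rfl fun t _ => ?_
      have := integral_mul_comp_eq hS hmul hF hF' 1 t
      rw [inv_one, one_mul, h1] at this
      rw [this, ← integral_const_mul]
      congr 1
      funext x
      simp only [id]
      ring
    · intro t _
      refine integrable_of_abs_le (C := |w t|) (hF'.mul ((hFS _).const_mul _)) fun x => ?_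
      rw [abs_mul, abs_mul]
      exact (mul_le_of_le_one_left (by positivity) (hb' x)).trans
        (mul_le_of_le_one_right (abs_nonneg _) (hb _))
  have hright : wavg s w (fun a => wavg s w (fun b => ∫ x, F x * F (S (a⁻¹ * b) x) ∂μ))
      = ∫ x, V x ^ 2 ∂μ := by
    refine Eq.trans ?_ (sum_sum_mul_integral_eq hS hmul hF hb s w)
    simp only [wavg, Finset.mul_sum, mul_assoc]
  rw [hleft, hright]
  refine (sq_integral_le ?_).trans (integral_mono ?_ ?_ fun x => ?_)
  · exact MemLp.of_bound (hF'.mul hV).aestronglyMeasurable 1 (Eventually.of_forall hVF)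
  · refine integrable_of_abs_le (C := 1) ((hF'.mul hV).pow_const 2) fun x => ?_
    rw [abs_pow]
    exact pow_le_one₀ (abs_nonneg _) (hVF x)
  · refine integrable_of_abs_le (C := 1) (hV.pow_const 2) fun x => ?_
    rw [abs_pow]
    exact pow_le_one₀ (abs_nonneg _) (hVb x)
  · have h2 : F' x ^ 2 ≤ 1 := (sq_le_one_iff_abs_le_one _).2 (hb' x)
    simp only [mul_pow]
    exact mul_le_of_le_one_left (sq_nonneg _) h2

lemma isPosDef_integral (hS : ∀ g, MeasurePreserving (S g) μ μ) (h1 : S 1 = id)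
    (hmul : ∀ g h, S (g * h) = S g ∘ S h) (hF : Measurable F) (hb : ∀ x, |F x| ≤ 1) :
    IsPosDef (fun t => ∫ x, F x * F (S t x) ∂μ) where
  map_inv t := by
    have := integral_mul_comp_eq hS hmul hF hF t 1
    rw [mul_one, inv_one, h1] at this
    have h2 := integral_mul_comp_eq hS hmul hF hF 1 t
    rw [inv_one, one_mul, h1] at h2
    rw [h2]
    congr 1
    funext x
    simp only [id]
    ring
  nonneg s u := by
    rw [sum_sum_mul_integral_eq hS hmul hF hb]
    exact integral_nonneg fun x => sq_nonneg _

end SingleAction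

section Cube

variable {G X : Type*} [Group G] [MeasurableSpace X] {μ : Measure X} {k : ℕ}

/-- Measure-preserving actions of `G`, indexed by `Fin k`, which commute pairwise. -/
structure CommutingActions (μ : Measure X) (S : Fin k → G → X → X) : Prop where
  measurePreserving : ∀ j g, MeasurePreserving (S j g) μ μ
  map_one : ∀ j, S j 1 = id
  map_mul : ∀ j g h, S j (g * h) = S j g ∘ S j h
  commute : ∀ i j, i ≠ j → ∀ g h, Function.Commute (S i g) (S j h)

/-- The vertex map `∏ j, (S j (g j)) ^ (ε j)`. -/
def cubeMap (S : Fin k → G → X → X) (g : Fin k → G) (ε : Fin k → Bool) : X → X :=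
  ofFnComp fun j => if ε j then S j (g j) else id

/-- The cube correlation `∫ ∏ ε, f ε ∘ cubeMap S g ε`. -/
noncomputable def corr (μ : Measure X) (S : Fin k → G → X → X) (f : (Fin k → Bool) → X → ℝ)
    (g : Fin k → G) : ℝ :=
  ∫ x, ∏ ε : Fin k → Bool, f ε (cubeMap S g ε x) ∂μ

/-- The product of `f ε` over the vertices with `ε j = 0`. -/
noncomputable def face (S : Fin k → G → X → X) (f : (Fin k → Bool) → X → ℝ) (j : Fin k)
    (g : Fin k → G) (x : X) : ℝ :=
  ∏ ε : Fin k → Bool with ε j = false, f ε (cubeMap S g ε x)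

lemma prod_cube_eq_mul (j : Fin k) (H : (Fin k → Bool) → ℝ) :
    ∏ ε, H ε = (∏ ε : Fin k → Bool with ε j = false, H ε)
      * ∏ ε : Fin k → Bool with ε j = false, H (Function.update ε j true) := by
  rw [← Finset.prod_filter_mul_prod_filter_not Finset.univ (fun ε : Fin k → Bool => ε j = false)]
  congr 1
  refine Finset.prod_nbij' (fun ε => Function.update ε j false)
    (fun ε => Function.update ε j true) ?_ ?_ ?_ ?_ ?_
  · intro ε _
    simp
  · intro ε _
    simp
  · intro ε h
    have : ε j = true := by simpa using h
    simp [← this]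
  · intro ε h
    have : ε j = false := by simpa using h
    simp [← this]
  · intro ε h
    have : ε j = true := by simpa using h
    simp [← this]

omit [Group G] [MeasurableSpace X] in
lemma face_update (S : Fin k → G → X → X) (f : (Fin k → Bool) → X → ℝ) (j : Fin k) (g : Fin k → G) :
    face S (fun ε => f (Function.update ε j false)) j g = face S f j g := by
  funext x
  refine Finset.prod_congr rfl fun ε h => ?_
  have h : ε j = false := by simpa using h
  simp [← h]

omit [Group G] [MeasurableSpace X] in
lemma abs_face_le {S : Fin k → G → X → X} {f : (Fin k → Bool) → X → ℝ} (hb : ∀ ε x, |f ε x| ≤ 1)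
    (j : Fin k) (g : Fin k → G) (x : X) : |face S f j g x| ≤ 1 := by
  rw [face, Finset.abs_prod]
  exact Finset.prod_le_one (fun _ _ => abs_nonneg _) fun ε _ => hb ε _

namespace CommutingActions

variable {S : Fin k → G → X → X} (hS : CommutingActions μ S)
include hS

lemma cubeMap_mul (g h : Fin k → G) (ε : Fin k → Bool) :
    cubeMap S (g * h) ε = cubeMap S g ε ∘ cubeMap S h ε := by
  rw [cubeMap, cubeMap, cubeMap, ← ofFnComp_comp]
  · congr 1
    funext j
    split_ifs
    · exact hS.map_mul j _ _
    · rfl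
  · intro i j hij
    split_ifs
    · exact hS.commute i j hij _ _
    all_goals exact fun x => rfl

lemma cubeMap_update (g : Fin k → G) (j : Fin k) (t : G) (ε : Fin k → Bool) :
    cubeMap S (Function.update g j t) ε
      = cubeMap S g (Function.update ε j false) ∘ (if ε j then S j t else id) := by
  conv_rhs => rw [← ofFnComp_single j (if ε j then S j t else id)]
  rw [cubeMap, cubeMap, ← ofFnComp_comp]
  · congr 1
    funext i
    by_cases hij : i = j
    · subst hij
      simp
    · simp [hij]
  · intro i i' hii'
    by_cases hij : i = j
    · subst hij
      by_cases h1 : ε i = true <;> by_cases h2 : ε i' = true <;>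
        simp only [h1, h2, Function.update_of_ne hii'.symm, if_true, if_false, Bool.false_eq_true]
      · exact hS.commute i i' hii' _ _
      all_goals exact fun x => rfl
    · simp only [hij, if_false]
      exact fun x => rfl

lemma measurePreserving_cubeMap (g : Fin k → G) (ε : Fin k → Bool) :
    MeasurePreserving (cubeMap S g ε) μ μ := by
  refine measurePreserving_ofFnComp fun j => ?_
  split_ifs
  · exact hS.measurePreserving _ _
  · exact MeasurePreserving.id μ

lemma corr_update (f : (Fin k → Bool) → X → ℝ) (g : Fin k → G) (j : Fin k) (t : G) :
    corr μ S f (Function.update g j t)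
      = ∫ x, face S f j g x * face S (fun ε => f (Function.update ε j true)) j g (S j t x) ∂μ := by
  rw [corr]
  congr 1
  funext x
  rw [prod_cube_eq_mul j]
  congr 1
  · refine Finset.prod_congr rfl fun ε h => ?_
    have h : ε j = false := by simpa using h
    have hu : Function.update ε j false = ε := by simp [← h]
    rw [hS.cubeMap_update, hu, h]
    simp
  · refine Finset.prod_congr rfl fun ε h => ?_
    have h : ε j = false := by simpa using h
    rw [hS.cubeMap_update]
    simp [← h]

lemma corr_collapse_update (f : (Fin k → Bool) → X → ℝ) (g : Fin k → G) (j : Fin k) (t : G) :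
    corr μ S (fun ε => f (Function.update ε j false)) (Function.update g j t)
      = ∫ x, face S f j g x * face S f j g (S j t x) ∂μ := by
  rw [hS.corr_update, face_update]
  simp only [Function.update_idem]
  rw [face_update]

variable {f : (Fin k → Bool) → X → ℝ}

lemma measurable_face (hf : ∀ ε, Measurable (f ε)) (j : Fin k) (g : Fin k → G) :
    Measurable (face S f j g) :=
  Finset.measurable_fun_prod _ fun ε _ => (hf ε).comp (hS.measurePreserving_cubeMap g ε).measurable

variable [IsProbabilityMeasure μ]

lemma isPosDef_corr {F : X → ℝ} (hF : Measurable F) (hb : ∀ x, |F x| ≤ 1) (j : Fin k)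
    (g : Fin k → G) : IsPosDef (fun t => corr μ S (fun _ => F) (Function.update g j t)) := by
  have h := fun t => hS.corr_collapse_update (fun _ => F) g j t
  simp only [h]
  exact isPosDef_integral (hS.measurePreserving j) (hS.map_one j) (hS.map_mul j)
    (hS.measurable_face (fun _ => hF) j g) (abs_face_le (fun _ => hb) j g)

lemma sq_wavg_corr_le (hf : ∀ ε, Measurable (f ε)) (hb : ∀ ε x, |f ε x| ≤ 1) (j : Fin k)
    (g : Fin k → G) {s : Finset G} {w : G → ℝ} (hw : IsProbWeight s w) :
    wavg s w (fun t => corr μ S f (Function.update g j t)) ^ 2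
      ≤ wavg s w (fun a => wavg s w (fun b =>
        corr μ S (fun ε => f (Function.update ε j false)) (Function.update g j (a⁻¹ * b)))) := by
  simp only [hS.corr_update f, hS.corr_collapse_update f]
  exact sq_wavg_integral_le (hS.measurePreserving j) (hS.map_one j) (hS.map_mul j)
    (hS.measurable_face hf j g) (abs_face_le hb j g)
    (hS.measurable_face (fun ε => hf _) j g) (abs_face_le (fun ε => hb _) j g) hw

omit hS [Group G] in
lemma abs_corr_le (hb : ∀ ε x, |f ε x| ≤ 1) (g : Fin k → G) : |corr μ S f g| ≤ 1 := by
  have h := norm_integral_le_of_norm_le_const (μ := μ) (C := 1)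
    (f := fun x => ∏ ε : Fin k → Bool, f ε (cubeMap S g ε x)) (Eventually.of_forall fun x => by
      rw [Real.norm_eq_abs, Finset.abs_prod]
      exact Finset.prod_le_one (fun _ _ => abs_nonneg _) fun ε _ => hb ε _)
  simpa [corr] using h

/-- The Gowers–Cauchy–Schwarz inequality for finite weighted averages of cube correlations. -/
lemma piAvg_corr_pow_le (hk : 0 < k) (hf : ∀ ε, Measurable (f ε)) (hb : ∀ ε x, |f ε x| ≤ 1)
    {s : Fin k → Finset G} {w : Fin k → G → ℝ} (hw : ∀ j, IsProbWeight (s j) (w j)) :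
    |piAvg s w (corr μ S f)| ^ 2 ^ k
      ≤ piAvg s w (fun a => piAvg s w (fun b => corr μ S (fun _ => f fun _ => false) (a⁻¹ * b))) := by
  have hwpi := isProbWeight_pi hw
  let pt : Finset (Fin k) → (Fin k → G) → (Fin k → G) → Fin k → G :=
    fun J a b j => if j ∈ J then (a j)⁻¹ * b j else b j
  let fJ : Finset (Fin k) → (Fin k → Bool) → X → ℝ :=
    fun J ε => f fun i => if i ∈ J then false else ε i
  have key : ∀ J : Finset (Fin k), |piAvg s w (corr μ S f)| ^ 2 ^ J.card
        ≤ |piAvg s w (fun a => piAvg s w (fun b => corr μ S (fJ J) (pt J a b)))| ∧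
      (J.Nonempty →
        0 ≤ piAvg s w (fun a => piAvg s w (fun b => corr μ S (fJ J) (pt J a b)))) := by
    intro J
    induction J using Finset.induction_on with
    | empty =>
      have : (fun a => piAvg s w (fun b => corr μ S (fJ ∅) (pt ∅ a b)))
          = fun _ => piAvg s w (corr μ S f) := by
        funext a
        simp [fJ, pt]
      rw [this]
      refine ⟨?_, fun h => absurd h Finset.not_nonempty_empty⟩
      simp [piAvg, wavg_const hwpi]
    | insert j J hj ih =>
      have hcol : fJ (insert j J) = fun ε => fJ J (Function.update ε j false) := by
        funext ε
        simp only [fJ]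
        congr 1
        funext i
        by_cases hi : i = j
        · subst hi; simp
        · simp [hi]
      have hpt1 : ∀ a b y, pt J a (Function.update b j y) = Function.update (pt J a b) j y := by
        intro a b y
        funext i
        by_cases hi : i = j
        · subst hi; simp [pt, hj]
        · simp [pt, hi]
      have hpt2 : ∀ a b x y, pt (insert j J) (Function.update a j x) (Function.update b j y)
          = Function.update (pt J a b) j (x⁻¹ * y) := by
        intro a b x y
        funext i
        by_cases hi : i = j
        · subst hi; simp [pt]
        · simp [pt, hi]
      have hstep : (piAvg s w (fun a => piAvg s w (fun b => corr μ S (fJ J) (pt J a b)))) ^ 2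
          ≤ piAvg s w (fun a => piAvg s w (fun b =>
            corr μ S (fJ (insert j J)) (pt (insert j J) a b))) := by
        have h1 : ∀ a, piAvg s w (fun b => corr μ S (fJ J) (pt J a b))
            = piAvg s w (fun b => wavg (s j) (w j) (fun y =>
              corr μ S (fJ J) (Function.update (pt J a b) j y))) := by
          intro a
          rw [piAvg_resample hw j]
          simp only [hpt1]
        have h2 : piAvg s w (fun a => piAvg s w (fun b =>
              corr μ S (fJ (insert j J)) (pt (insert j J) a b)))
            = piAvg s w (fun a => piAvg s w (fun b => wavg (s j) (w j) (fun x =>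
              wavg (s j) (w j) (fun y =>
                corr μ S (fJ (insert j J)) (Function.update (pt J a b) j (x⁻¹ * y)))))) := by
          rw [piAvg_resample hw j]
          congr 1
          funext a
          rw [show piAvg s w (fun b => wavg (s j) (w j) (fun x => wavg (s j) (w j) (fun y =>
              corr μ S (fJ (insert j J)) (Function.update (pt J a b) j (x⁻¹ * y)))))
              = wavg (s j) (w j) (fun x => piAvg s w (fun b => wavg (s j) (w j) (fun y =>
              corr μ S (fJ (insert j J)) (Function.update (pt J a b) j (x⁻¹ * y))))) from
              wavg_comm _]
          congr 1
          funext x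
          rw [piAvg_resample hw j]
          simp only [hpt2]
        simp only [h1]
        rw [h2]
        refine (sq_wavg_le hwpi).trans (wavg_mono hwpi fun a =>
          (sq_wavg_le hwpi).trans (wavg_mono hwpi fun b => ?_))
        rw [hcol]
        exact hS.sq_wavg_corr_le (fun ε => hf _) (fun ε => hb _) j _ (hw j)
      refine ⟨?_, fun _ => (sq_nonneg _).trans hstep⟩
      rw [Finset.card_insert_of_notMem hj, pow_succ, pow_mul]
      refine (pow_le_pow_left₀ (by positivity) ih.1 2).trans ?_
      rw [sq_abs]
      exact hstep.trans (le_abs_self _)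
  have h := key Finset.univ
  have : Nonempty (Fin k) := ⟨⟨0, hk⟩⟩
  rw [abs_of_nonneg (h.2 Finset.univ_nonempty), Finset.card_univ, Fintype.card_fin] at h
  have hfJ : fJ Finset.univ = fun _ => f fun _ => false := by simp [fJ]
  have hpt : ∀ a b, pt Finset.univ a b = a⁻¹ * b := fun a b => by
    funext j
    simp [pt]
  simpa only [hfJ, hpt] using h.1

end CommutingActions

end Cube

section Eventual

variable {G X : Type*} [Group G] [MeasurableSpace X] {μ : Measure X} [IsProbabilityMeasure μ]
  {k : ℕ} {S : Fin k → G → X → X} {f : (Fin k → Bool) → X → ℝ}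

namespace CommutingActions

omit [IsProbabilityMeasure μ] in
lemma corr_mul (hS : CommutingActions μ S) (g h : Fin k → G) :
    corr μ S f (g * h) = corr μ S (fun ε x => f ε (cubeMap S g ε x)) h := by
  simp only [corr, hS.cubeMap_mul, Function.comp_apply]

/-- The shifted averages of cube correlations satisfy the bound of `piAvg_corr_pow_le`, uniformly in
the shift. -/
lemma abs_piAvg_corr_mul_le (hS : CommutingActions μ S) (hk : 0 < k)
    (hf : ∀ ε, Measurable (f ε)) (hb : ∀ ε x, |f ε x| ≤ 1)
    {s : Fin k → Finset G} {w : Fin k → G → ℝ} (hw : ∀ j, IsProbWeight (s j) (w j)) {L : ℝ}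
    (hL : piAvg s w (fun a => piAvg s w (fun b =>
      corr μ S (fun _ => f fun _ => false) (a⁻¹ * b))) ≤ L) (g : Fin k → G) :
    |piAvg s w (fun h => corr μ S f (g * h))| ≤ L ^ ((2 : ℝ) ^ k)⁻¹ := by
  have hid : cubeMap S g (fun _ => false) = id := by simp [cubeMap, ofFnComp_id]
  have h := hS.piAvg_corr_pow_le hk (f := fun ε x => f ε (cubeMap S g ε x))
    (fun ε => (hf ε).comp (hS.measurePreserving_cubeMap g ε).measurable) (fun ε x => hb ε _) hw
  simp only [hid, id] at h
  rw [show (corr μ S fun ε x => f ε (cubeMap S g ε x)) = fun h => corr μ S f (g * h) from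
    funext fun h => (hS.corr_mul g h).symm] at h
  replace h := h.trans hL
  rw [← Real.rpow_natCast] at h
  push_cast at h
  rwa [Real.le_rpow_inv_iff_of_pos (abs_nonneg _) ((by positivity : (0 : ℝ) ≤ _).trans h)
    (by positivity)]

lemma eventually_abs_piAvg_corr_le [DecidableEq G] (hS : CommutingActions μ S) (hk : 0 < k)
    (hf : ∀ ε, Measurable (f ε)) (hb : ∀ ε x, |f ε x| ≤ 1)
    {Φ : Fin k → ℕ → Finset G} (hΦ : ∀ j, IsRightFolner (Φ j))
    {Φ₀ : ℕ → Finset G} (hΦ₀ : IsLeftFolner Φ₀) {l : ℝ}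
    (hl : IterLimExists (fun M => piAvg (fun j => Φ₀ (M j)) (fun j => unif (Φ₀ (M j)))
      (corr μ S fun _ => f fun _ => false)) l) {δ : ℝ} (hδ : 0 < δ) :
    ∀ᶠ N : Fin k → ℕ in atTop,
      |piAvg (fun j => Φ j (N j)) (fun j => unif (Φ j (N j))) (corr μ S f)|
        ≤ l ^ ((2 : ℝ) ^ k)⁻¹ + δ := by
  have hp : (0 : ℝ) < ((2 : ℝ) ^ k)⁻¹ := by positivity
  obtain ⟨η, hη, hηl⟩ : ∃ η > 0, (l + η) ^ ((2 : ℝ) ^ k)⁻¹ < l ^ ((2 : ℝ) ^ k)⁻¹ + δ / 2 := by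
    have hcont : Tendsto (fun η : ℝ => (l + η) ^ ((2 : ℝ) ^ k)⁻¹) (𝓝[>] 0)
        (𝓝 (l ^ ((2 : ℝ) ^ k)⁻¹)) := by
      have := ((Real.continuous_rpow_const hp.le).comp (continuous_const_add l)).tendsto 0
      simpa [Function.comp_def] using this.mono_left nhdsWithin_le_nhds
    obtain ⟨η, h1, h2⟩ := ((hcont.eventually (gt_mem_nhds
      (lt_add_of_pos_right _ (half_pos hδ)))).and self_mem_nhdsWithin).exists
    exact ⟨η, h2, h1⟩
  obtain ⟨s, w, hw, hsw⟩ := exists_weights_piAvg_le hΦ₀ (abs_corr_le fun _ => hb _)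
    (hS.isPosDef_corr (hf _) (hb _)) hl hη
  have hbound := hS.abs_piAvg_corr_mul_le hk hf hb hw hsw
  have hlim : Tendsto (fun N : Fin k → ℕ => piAvg s w (fun h =>
      piAvg (fun j => Φ j (N j)) (fun j => unif (Φ j (N j))) (fun g => corr μ S f (g * h))
        - piAvg (fun j => Φ j (N j)) (fun j => unif (Φ j (N j))) (corr μ S f)))
      atTop (𝓝 (piAvg s w fun _ => 0)) :=
    tendsto_wavg fun h => tendsto_piAvg_rightMul_sub hΦ (abs_corr_le hb) h
  rw [show piAvg s w (fun _ => (0 : ℝ)) = 0 from wavg_const (isProbWeight_pi hw) 0] at hlim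
  filter_upwards [hlim.eventually (Metric.ball_mem_nhds 0 (half_pos hδ))] with N hN
  have hNw := isProbWeight_pi fun j => isProbWeight_uniform ((hΦ j).1 (N j))
  have hsplit : piAvg s w (fun h =>
      piAvg (fun j => Φ j (N j)) (fun j => unif (Φ j (N j))) (fun g => corr μ S f (g * h))
        - piAvg (fun j => Φ j (N j)) (fun j => unif (Φ j (N j))) (corr μ S f))
      = piAvg (fun j => Φ j (N j)) (fun j => unif (Φ j (N j)))
          (fun g => piAvg s w (fun h => corr μ S f (g * h)))
        - piAvg (fun j => Φ j (N j)) (fun j => unif (Φ j (N j))) (corr μ S f) := by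
    simp only [piAvg]
    rw [← wavg_sub, wavg_const (isProbWeight_pi hw), wavg_comm]
  have hmain : |piAvg (fun j => Φ j (N j)) (fun j => unif (Φ j (N j)))
      (fun g => piAvg s w (fun h => corr μ S f (g * h)))| ≤ (l + η) ^ ((2 : ℝ) ^ k)⁻¹ :=
    abs_wavg_le hNw hbound
  rw [hsplit, Real.dist_0_eq_abs, abs_lt] at hN
  rw [abs_le] at hmain ⊢
  constructor <;> linarith [hN.1, hN.2, hmain.1, hmain.2]

end CommutingActions

end Eventual

lemma cubeIntAvgMulti_eq_piAvg {G X : Type*} [Group G] [MeasurableSpace X] (μ : Measure X)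
    {d k : ℕ} (T : Fin d → G → X → X) (P : Fin k → Fin d) (Φ : Fin k → ℕ → Finset G)
    (f : (Fin k → Bool) → X → ℝ) (N : Fin k → ℕ) :
    cubeIntAvgMulti μ T P Φ f N = piAvg (fun j => Φ j (N j)) (fun j => unif (Φ j (N j)))
      (corr μ (fun j => T (P j)) f) := by
  simp only [piAvg, wavg, unif, Finset.prod_inv_distrib, ← Finset.mul_sum]
  rfl

end CubeAverage

/-- For functions `f_ε` bounded by `1`, the cube averages over Følner
sequences `Φ⁽¹⁾, …, Φ⁽ᵏ⁾` are eventually bounded in absolute value by `|||f_𝟎|||_η + δ`,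
where `|||f_𝟎|||_η` is the `2ᵏ`-th root of the iterated limit `l` computed along a fixed
two-sided Følner sequence `Φ₀`. -/
theorem cube_average_eventually_le_seminorm
    {G X : Type*} [Group G] [Countable G] [DecidableEq G]
    [MeasurableSpace X] (μ : MeasureTheory.Measure X) [MeasureTheory.IsProbabilityMeasure μ]
    (d : ℕ) (T : Fin d → G → X → X)
    (hT_mp : ∀ i g, MeasureTheory.MeasurePreserving (T i g) μ μ)
    (hT_bij : ∀ i g, Function.Bijective (T i g))
    (hT_hom : ∀ i g h, T i (g * h) = T i g ∘ T i h)
    (hT_comm : ∀ i j, i ≠ j → ∀ g h, T i g ∘ T j h = T j h ∘ T i g)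
    (k : ℕ) (P : Fin k → Fin d) (hP : Function.Injective P)
    (Φ : Fin k → ℕ → Finset G) (hΦ : ∀ j, IsTwoSidedFolner (Φ j))
    (Φ₀ : ℕ → Finset G) (hΦ₀ : IsTwoSidedFolner Φ₀)
    (f : (Fin k → Bool) → X → ℝ)
    (hf_meas : ∀ ε, Measurable (f ε))
    (hf_bdd : ∀ ε x, |f ε x| ≤ 1)
    (l : ℝ) (hl_nonneg : 0 ≤ l)
    (hl : IterLimExists (cubeIntAvg μ T P Φ₀ (fun _ => f (fun _ => false))) l) :
    ∀ δ > (0 : ℝ), ∃ N₀ : ℕ, ∀ N : Fin k → ℕ, (∀ j, N₀ < N j) →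
      |cubeIntAvgMulti μ T P Φ f N| ≤ l ^ (((2 : ℝ) ^ k)⁻¹) + δ := by
  intro δ hδ
  let S : Fin k → G → X → X := fun j => T (P j)
  have hS : CubeAverage.CommutingActions μ S :=
    { measurePreserving := fun j => hT_mp (P j)
      map_one := fun j => by
        funext x
        apply (hT_bij (P j) 1).1
        have h := congrFun (hT_hom (P j) 1 1) x
        rw [one_mul] at h
        exact h.symm
      map_mul := fun j => hT_hom (P j)
      commute := fun i j hij g h x => congrFun (hT_comm _ _ (hP.ne hij) g h) x }
  have hA := CubeAverage.cubeIntAvgMulti_eq_piAvg μ T P Φ f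
  have hl' : IterLimExists (fun M => CubeAverage.piAvg (fun j => Φ₀ (M j))
      (fun j => CubeAverage.unif (Φ₀ (M j)))
      (CubeAverage.corr μ S fun _ => f fun _ => false)) l := by
    convert hl using 2 with M
    exact (CubeAverage.cubeIntAvgMulti_eq_piAvg μ T P (fun _ => Φ₀) _ M).symm
  rcases Nat.eq_zero_or_pos k with rfl | hk
  · refine ⟨0, fun N _ => ?_⟩
    have hAl : cubeIntAvgMulti μ T P Φ f N = l := by
      rw [← (show _ = l from hl)]
      simp only [cubeIntAvg, cubeIntAvgMulti, Finset.univ_eq_empty, Finset.prod_empty]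
      congr! with x g _ y ε
    rw [hAl, abs_of_nonneg hl_nonneg]
    simp [hδ.le]
  · obtain ⟨M, hM⟩ := eventually_atTop.1
      (hS.eventually_abs_piAvg_corr_le hk hf_meas hf_bdd (fun j => (hΦ j).2) hΦ₀.1 hl' hδ)
    refine ⟨Finset.univ.sup M, fun N hN => ?_⟩
    rw [hA]
    exact hM N fun j => (Finset.le_sup (Finset.mem_univ j)).trans (hN j).le
end
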